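/- arXiv:0710.0267 — 5 statements merged into one kernel-verified Lean document; each statement's English description precedes it below -/
import Mathlib

section
/- Let A ⊆ B be an extension of integral domains such that B is an essential extension of A (every nonzero ideal of B has nonzero intersection with A) and A is integrally closed in B. Then Frac(A) is integrally closed in Frac(B). -/
universe u

/-- Let `A ⊆ B` be an extension of integral domains such that `B` is an
essential extension of `A` (every nonzero ideal of `B` meets `A` nontrivially) and `A` is
integrally closed in `B`.  Then `Frac A` is integrally closed in `Frac B`.
Here `K` and `L` are the fraction fields of `A` and `B`, compatibly. -/
theorem fractionField_integrallyClosed_of_essential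
    (A : Type u) [CommRing A] [IsDomain A] (B : Type u) [CommRing B] [IsDomain B]
    [Algebra A B] (hinj : Function.Injective (algebraMap A B))
    (K L : Type u) [Field K] [Field L]
    [Algebra A K] [IsFractionRing A K] [Algebra B L] [IsFractionRing B L]
    [Algebra K L] [Algebra A L] [IsScalarTower A B L] [IsScalarTower A K L]
    (hess : ∀ J : Ideal B, J ≠ ⊥ → ∃ a : A, algebraMap A B a ∈ J ∧ algebraMap A B a ≠ 0)
    (hic : ∀ b : B, IsIntegral A b → b ∈ (algebraMap A B).range) :
    ∀ x : L, IsIntegral K x → x ∈ (algebraMap K L).range := by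
  intro x hx
  have halg : IsAlgebraic A x := (IsFractionRing.isAlgebraic_iff A K L).2 hx.isAlgebraic
  obtain ⟨r, hr, hrx⟩ := halg.exists_integral_multiple
  obtain ⟨b, c, hc, rfl⟩ := IsFractionRing.div_surjective (A := B) x
  have hc0 : c ≠ 0 := nonZeroDivisors.ne_zero hc
  obtain ⟨a, hac, ha⟩ := hess (Ideal.span {c}) (by simpa using hc0)
  obtain ⟨d, hd⟩ := Ideal.mem_span_singleton.1 hac
  have hcL : algebraMap B L c ≠ 0 := by simpa using hc0
  have haL : algebraMap A L a = algebraMap B L c * algebraMap B L d := by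
    rw [IsScalarTower.algebraMap_apply A B L, hd, map_mul]
  have hmul : algebraMap B L (r • (b * d)) =
      a • r • (algebraMap B L b / algebraMap B L c) := by
    simp only [Algebra.smul_def, map_mul, ← IsScalarTower.algebraMap_apply A B L, haL]
    field_simp
  have hint : IsIntegral A (r • (b * d)) := by
    rw [← isIntegral_algebraMap_iff (IsFractionRing.injective B L), hmul]
    exact hrx.smul a
  obtain ⟨s, hs⟩ := hic _ hint
  have hinjL : Function.Injective (algebraMap A L) := by
    rw [IsScalarTower.algebraMap_eq A B L]
    exact (IsFractionRing.injective B L).comp hinj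
  have haL0 : algebraMap A L a ≠ 0 := by
    rw [IsScalarTower.algebraMap_apply A B L]
    simpa using ha
  have hrL0 : algebraMap A L r ≠ 0 := (map_ne_zero_iff _ hinjL).2 hr
  refine ⟨algebraMap A K s / (algebraMap A K a * algebraMap A K r), ?_⟩
  rw [← hs, ← IsScalarTower.algebraMap_apply A B L, Algebra.smul_def, Algebra.smul_def] at hmul
  simp only [map_div₀, map_mul, ← IsScalarTower.algebraMap_apply A K L]
  rw [hmul, ← mul_assoc]
  exact mul_div_cancel_left₀ _ (mul_ne_zero haL0 hrL0)
end

section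
/- The ring ℤ is integrally closed in the ring ℤ[T, √2·T] (the subring of ℚ(√2)[T] generated over ℤ by T and √2·T), yet ℚ = Frac(ℤ) is not integrally closed in ℚ(√2, T) = Frac(ℤ[T, √2·T]). Hence the essentiality hypothesis cannot be dropped from the statement: if a domain A is integrally closed in an essential domain extension B, then Frac(A) is integrally closed in Frac(B). -/
/-- The subring `ℤ[T, √2·T]` of `ℝ[T]` (equivalently of `ℚ(√2)[T]`) generated by
`T` and `√2·T`; it automatically contains `ℤ`. -/
noncomputable def zSqrtTwoT : Subring (Polynomial ℝ) :=
  Subring.closure {Polynomial.X, Polynomial.C (Real.sqrt 2) * Polynomial.X}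

theorem zSqrtTwoT_coeff_zero {p : Polynomial ℝ} (hp : p ∈ zSqrtTwoT) :
    ∃ n : ℤ, p.coeff 0 = n := by
  have h : zSqrtTwoT ≤ (Int.castRingHom ℝ).range.comap Polynomial.constantCoeff := by
    refine Subring.closure_le.2 ?_
    rintro x (rfl | rfl) <;> exact ⟨0, by simp⟩
  obtain ⟨n, hn⟩ := h hp
  exact ⟨n, by simpa using hn.symm⟩

theorem Polynomial.natDegree_eq_zero_of_isIntegral {K : Type*} [Field K] {p : Polynomial K}
    (hp : IsIntegral K p) : p.natDegree = 0 := by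
  obtain ⟨f, hf, hfp⟩ := hp
  have h : f.comp p = 0 := hfp
  have hd : f.natDegree * p.natDegree = 0 := by
    rw [← Polynomial.natDegree_comp, h, Polynomial.natDegree_zero]
  refine (mul_eq_zero.1 hd).resolve_left fun h0 ↦ ?_
  rw [hf.natDegree_eq_zero.1 h0] at h
  simp at h

/-- `ℤ` is integrally closed in `ℤ[T, √2·T]`, yet
`ℚ = Frac ℤ` is not integrally closed in `ℚ(√2, T) = Frac (ℤ[T, √2·T])`.
Hence the essentiality hypothesis cannot be dropped from Statement 1. -/
theorem int_integrallyClosed_but_rat_not_integrallyClosed :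
    (∀ r : zSqrtTwoT, IsIntegral ℤ r → ∃ n : ℤ, r = (n : zSqrtTwoT)) ∧
    ¬ (∀ q : FractionRing zSqrtTwoT, IsIntegral ℚ q →
        q ∈ (algebraMap ℚ (FractionRing zSqrtTwoT)).range) := by
  constructor
  · intro r hr
    have hr' : IsIntegral ℤ (r : Polynomial ℝ) := map_isIntegral_int zSqrtTwoT.subtype hr
    have hdeg := Polynomial.natDegree_eq_zero_of_isIntegral (hr'.tower_top (A := ℝ))
    obtain ⟨n, hn⟩ := zSqrtTwoT_coeff_zero r.2
    refine ⟨n, Subtype.ext ?_⟩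
    rw [Polynomial.eq_C_of_natDegree_eq_zero hdeg, hn]
    simp
  · intro h
    let t : zSqrtTwoT := ⟨Polynomial.X, Subring.subset_closure (by simp)⟩
    let s : zSqrtTwoT :=
      ⟨Polynomial.C (Real.sqrt 2) * Polynomial.X, Subring.subset_closure (by simp)⟩
    have hst : s ^ 2 = 2 * t ^ 2 := by
      refine Subtype.ext ?_
      change (Polynomial.C (Real.sqrt 2) * Polynomial.X) ^ 2 = 2 * Polynomial.X ^ 2
      rw [mul_pow, ← Polynomial.C_pow, Real.sq_sqrt (by norm_num),
        Polynomial.C_ofNat]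
    have ht : algebraMap zSqrtTwoT (FractionRing zSqrtTwoT) t ≠ 0 := by
      rw [Ne, IsFractionRing.to_map_eq_zero_iff]
      exact fun h0 ↦ Polynomial.X_ne_zero (congrArg Subtype.val h0)
    have hq : (algebraMap zSqrtTwoT (FractionRing zSqrtTwoT) s /
        algebraMap zSqrtTwoT (FractionRing zSqrtTwoT) t) ^ 2 = 2 := by
      rw [div_pow, div_eq_iff (pow_ne_zero 2 ht), ← map_pow, hst, map_mul, map_pow,
        map_ofNat]
    obtain ⟨x, hx⟩ := h _ (IsIntegral.of_pow (n := 2) two_pos (by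
      rw [hq]
      exact map_ofNat (algebraMap ℚ (FractionRing zSqrtTwoT)) 2 ▸ isIntegral_algebraMap))
    rw [← hx, ← map_pow] at hq
    have hx2 : x ^ 2 = 2 :=
      (algebraMap ℚ (FractionRing zSqrtTwoT)).injective (by rw [hq, map_ofNat])
    refine irrational_sqrt_two ⟨|x|, ?_⟩
    rw [Rat.cast_abs, ← Real.sqrt_sq_eq_abs]
    exact congrArg Real.sqrt (by exact_mod_cast hx2)
end

section
/- A real integral domain A (regarded as a poring with partial ordering A⁺) has a unique real closure * if and only if its quotient field Frac(A) admits exactly one total ordering extending the partial ordering induced by A⁺. -/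
universe u

/-- A partial ordering (positive cone) of a commutative ring: closed under addition and
multiplication, contains all squares, and intersects its negative only in `0`. -/
def IsPartialOrdering {A : Type*} [CommRing A] (P : Set A) : Prop :=
  (∀ a ∈ P, ∀ b ∈ P, a + b ∈ P) ∧ (∀ a ∈ P, ∀ b ∈ P, a * b ∈ P) ∧
  (∀ a : A, a ^ 2 ∈ P) ∧ (∀ a ∈ P, -a ∈ P → a = 0)

/-- A (formally) real ring: a sum of squares vanishes only if each term vanishes. -/
def IsRealRing (A : Type*) [CommRing A] : Prop :=
  ∀ (n : ℕ) (f : Fin n → A), (∑ i, f i ^ 2) = 0 → ∀ i, f i = 0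

/-- A von Neumann regular commutative ring. -/
def IsVonNeumannRegular (A : Type*) [CommRing A] : Prop :=
  ∀ a : A, ∃ b : A, a = a ^ 2 * b

/-- A Baer ring: the annihilator of every subset is generated by an idempotent. -/
def IsBaerRing (A : Type*) [CommRing A] : Prop :=
  ∀ S : Set A, ∃ e : A, e * e = e ∧ ∀ x : A, (∀ s ∈ S, x * s = 0) ↔ ∃ y : A, x = e * y

/-- An essential (ring) extension: an injective ring homomorphism such that every nonzero
ideal of the codomain meets the image of the domain nontrivially. -/
def IsEssentialExtension {A B : Type*} [CommRing A] [CommRing B] (f : A →+* B) : Prop :=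
  Function.Injective f ∧ ∀ J : Ideal B, J ≠ ⊥ → ∃ a : A, f a ∈ J ∧ f a ≠ 0

/-- A real ring is real closed * if it admits no proper essential integral extension
which is again a real ring. -/
def IsRealClosedStar (B : Type u) [CommRing B] : Prop :=
  IsRealRing B ∧ ∀ (C : Type u) [CommRing C] (f : B →+* C),
    IsRealRing C → IsEssentialExtension f → f.IsIntegral → Function.Surjective f

/-- `(B, Q)` together with the embedding `f` is a real closure * of the poring `(A, P)`:
`B` is a real closed * ring, an essential and integral extension of `A`, whose partial
ordering `Q` extends `P`. -/
structure IsRealClosureStarOf (A : Type u) [CommRing A] (P : Set A)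
    (B : Type u) [CommRing B] (Q : Set B) (f : A →+* B) : Prop where
  pos_partial : IsPartialOrdering Q
  rcs : IsRealClosedStar B
  essential : IsEssentialExtension f
  integral : f.IsIntegral
  mono : ∀ a ∈ P, f a ∈ Q

/-- Bundled real closure * of a poring `(A, P)`. -/
structure RealClosureStar (A : Type u) [CommRing A] (P : Set A) : Type (u + 1) where
  carrier : Type u
  [ring : CommRing carrier]
  pos : Set carrier
  emb : A →+* carrier
  is : IsRealClosureStarOf A P carrier pos emb

attribute [instance] RealClosureStar.ring

/-- Two real closures * of `(A, P)` are `A`-isomorphic: there is a ring isomorphism over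
`A` preserving the partial orderings in both directions. -/
def RealClosureStar.AIso {A : Type u} [CommRing A] {P : Set A}
    (B C : RealClosureStar A P) : Prop :=
  ∃ e : B.carrier ≃+* C.carrier, (∀ a : A, e (B.emb a) = C.emb a) ∧
    ∀ b : B.carrier, b ∈ B.pos ↔ e b ∈ C.pos

/-- A poring `(A, P)` has a unique real closure *: one exists, and any two are
`A`-isomorphic as porings. -/
def HasUniqueRealClosureStar (A : Type u) [CommRing A] (P : Set A) : Prop :=
  Nonempty (RealClosureStar A P) ∧ ∀ B C : RealClosureStar A P, B.AIso C

/-- A prime cone of a commutative ring. -/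
structure PrimeCone (A : Type u) [CommRing A] : Type u where
  carrier : Set A
  add_mem : ∀ a ∈ carrier, ∀ b ∈ carrier, a + b ∈ carrier
  mul_mem : ∀ a ∈ carrier, ∀ b ∈ carrier, a * b ∈ carrier
  sq_mem : ∀ a : A, a ^ 2 ∈ carrier
  mem_or_neg_mem : ∀ a : A, a ∈ carrier ∨ -a ∈ carrier
  support : Ideal A
  mem_support : ∀ a : A, a ∈ support ↔ a ∈ carrier ∧ -a ∈ carrier
  support_isPrime : support.IsPrime

/-- The real spectrum of a poring `(A, P)`: the prime cones containing `P`. -/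
def RealSpectrum (A : Type u) [CommRing A] (P : Set A) : Type u :=
  {α : PrimeCone A // P ⊆ α.carrier}

/-- A real closed field: formally real, every element or its negative is a square, and
every polynomial of odd degree has a root. -/
def IsRealClosedField (F : Type u) [Field F] : Prop :=
  IsRealRing F ∧ (∀ x : F, (∃ y : F, y ^ 2 = x) ∨ ∃ y : F, y ^ 2 = -x) ∧
    ∀ p : Polynomial F, Odd p.natDegree → ∃ x : F, Polynomial.eval x p = 0

/-- A total ordering (positive cone) of a ring. -/
def IsTotalOrderingCone {K : Type*} [CommRing K] (T : Set K) : Prop :=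
  (∀ a ∈ T, ∀ b ∈ T, a + b ∈ T) ∧ (∀ a ∈ T, ∀ b ∈ T, a * b ∈ T) ∧
  (∀ x : K, x ∈ T ∨ -x ∈ T) ∧ ∀ x ∈ T, -x ∈ T → x = 0

section OrderedFields

open Polynomial

/-- The intermediate value property for polynomials over an ordered field. -/
def PolynomialIVP (R : Type*) [Field R] [LinearOrder R] : Prop :=
  ∀ (f : R[X]) (a b : R), a < b → f.eval a * f.eval b < 0 → ∃ c, a < c ∧ c < b ∧ f.eval c = 0

namespace PolynomialIVP

variable {R : Type*} [Field R] [LinearOrder R] [IsStrictOrderedRing R]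

theorem exists_eval_eq_zero (hR : PolynomialIVP R) {f : R[X]} {l u a b : R}
    (hla : l < a) (hau : a < u) (hlb : l < b) (hbu : b < u) (h : f.eval a * f.eval b < 0) :
    ∃ c, l < c ∧ c < u ∧ f.eval c = 0 := by
  rcases lt_trichotomy a b with hab | rfl | hab
  · obtain ⟨c, h1, h2, h3⟩ := hR f a b hab h
    exact ⟨c, hla.trans h1, h2.trans hbu, h3⟩
  · exact absurd h (mul_self_nonneg _).not_gt
  · obtain ⟨c, h1, h2, h3⟩ := hR f b a hab (by rwa [mul_comm])
    exact ⟨c, hlb.trans h1, h2.trans hau, h3⟩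

theorem mul_eval_pos (hR : PolynomialIVP R) {f : R[X]} {l u a b : R}
    (hla : l < a) (hau : a < u) (hlb : l < b) (hbu : b < u)
    (h : ∀ c, l < c → c < u → f.eval c ≠ 0) : 0 < f.eval a * f.eval b := by
  by_contra! hc
  rcases hc.lt_or_eq with hc | hc
  · obtain ⟨c, h1, h2, h3⟩ := hR.exists_eval_eq_zero hla hau hlb hbu hc
    exact h c h1 h2 h3
  · exact mul_ne_zero (h a hla hau) (h b hlb hbu) hc

theorem exists_eq_sq (hR : PolynomialIVP R) {x : R} (hx : 0 ≤ x) : ∃ y, x = y ^ 2 := by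
  rcases hx.eq_or_lt with rfl | hx
  · exact ⟨0, by simp⟩
  obtain ⟨c, -, -, hc⟩ := hR (X ^ 2 - C x) 0 (x + 1) (by positivity) (by
    simp only [eval_sub, eval_pow, eval_X, eval_C]
    nlinarith [mul_pos hx hx, mul_pos hx (mul_pos hx hx)])
  exact ⟨c, by linear_combination -(by simpa using hc : c ^ 2 - x = 0)⟩

theorem nonneg_iff (hR : PolynomialIVP R) {x : R} : 0 ≤ x ↔ ∃ y, x = y ^ 2 :=
  ⟨hR.exists_eq_sq, by rintro ⟨y, rfl⟩; positivity⟩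

theorem exists_derivative_eq_zero (hR : PolynomialIVP R) {f : R[X]} {a b : R} (hab : a < b)
    (ha : f.eval a = 0) (hb : f.eval b = 0)
    (hsep : ∀ c, f.eval c = 0 → f.derivative.eval c ≠ 0) :
    ∃ c, a < c ∧ c < b ∧ f.derivative.eval c = 0 := by
  have hf0 : f ≠ 0 := by rintro rfl; exact hsep a ha (by simp)
  obtain ⟨d, hd, hdmin⟩ := (f.roots.toFinset.filter fun c => a < c ∧ c ≤ b).exists_minimal
    ⟨b, by simp [hf0, hb, hab]⟩
  simp only [Finset.mem_filter, Multiset.mem_toFinset, mem_roots hf0, IsRoot.def] at hd hdmin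
  obtain ⟨hd0, had, hdb⟩ := hd
  obtain ⟨g, hg⟩ := dvd_iff_isRoot.mpr ha
  have hgd : g.eval d = 0 := by
    rw [hg] at hd0
    simpa [(sub_pos.mpr had).ne'] using hd0
  obtain ⟨k, hk⟩ := dvd_iff_isRoot.mpr hgd
  have hfk : f = (X - C a) * ((X - C d) * k) := by rw [hg, hk]
  have hda : f.derivative.eval a = (a - d) * k.eval a := by
    rw [hfk]; simp
  have hdd : f.derivative.eval d = (d - a) * k.eval d := by
    rw [hfk]; simp
  have hka : k.eval a ≠ 0 := fun h => hsep a ha (by rw [hda, h, mul_zero])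
  have hkd : k.eval d ≠ 0 := fun h => hsep d hd0 (by rw [hdd, h, mul_zero])
  have hpos : 0 < k.eval a * k.eval d := by
    by_contra! hc
    obtain ⟨c, h1, h2, h3⟩ := hR k a d had (lt_of_le_of_ne hc (mul_ne_zero hka hkd))
    exact (hdmin ⟨by rw [hfk]; simp [h3], h1, h2.le.trans hdb⟩ h2.le).not_gt h2
  obtain ⟨c, h1, h2, h3⟩ := hR f.derivative a d had (by
    rw [hda, hdd]
    nlinarith [mul_pos (mul_pos (sub_pos.mpr had) (sub_pos.mpr had)) hpos])
  exact ⟨c, h1, h2.trans_le hdb, h3⟩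

end PolynomialIVP

section Cuts

variable {L R : Type*} [Field L] [LinearOrder L] [IsStrictOrderedRing L]
  [Field R] [LinearOrder R] [IsStrictOrderedRing R] [Algebra L R]

theorem exists_lt_algebraMap_of_isIntegral (hm : StrictMono (algebraMap L R)) {x : R}
    (hx : IsIntegral L x) : ∃ u : L, x < algebraMap L R u := by
  set p := minpoly L x
  set S : L := ∑ i ∈ Finset.range p.natDegree, |p.coeff i| with hS
  have hS0 : 0 ≤ S := Finset.sum_nonneg fun i _ => abs_nonneg _
  refine ⟨1 + S, ?_⟩
  by_contra! hc
  rw [map_add, map_one] at hc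
  have hS0' : 0 ≤ algebraMap L R S := by simpa using hm.monotone hS0
  have hx1 : 1 ≤ x := by linarith
  have hn : 0 < p.natDegree := minpoly.natDegree_pos hx
  obtain ⟨n, hn⟩ : ∃ n, p.natDegree = n + 1 := ⟨p.natDegree - 1, by omega⟩
  have h0 : aeval x p = 0 := minpoly.aeval L x
  rw [aeval_eq_sum_range, Finset.sum_range_succ, coeff_natDegree,
    (minpoly.monic hx : p.Monic).leadingCoeff, one_smul] at h0
  have hle : -∑ i ∈ Finset.range p.natDegree, p.coeff i • x ^ i
      ≤ algebraMap L R S * x ^ n := by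
    rw [hS, map_sum, Finset.sum_mul, ← Finset.sum_neg_distrib]
    refine Finset.sum_le_sum fun i hi => ?_
    rw [Algebra.smul_def, ← neg_mul, ← map_neg]
    have h1 : x ^ i ≤ x ^ n := pow_le_pow_right₀ hx1 (by
      have := Finset.mem_range.mp hi; omega)
    have h2 : algebraMap L R (-p.coeff i) ≤ algebraMap L R |p.coeff i| :=
      hm.monotone (neg_le_abs _)
    have h3 : 0 ≤ algebraMap L R |p.coeff i| := by simpa using hm.monotone (abs_nonneg _)
    have h4 : 0 ≤ x ^ i := by positivity
    exact (mul_le_mul_of_nonneg_right h2 h4).trans (mul_le_mul_of_nonneg_left h1 h3)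
  have hpow : x ^ p.natDegree = x * x ^ n := by rw [hn, pow_succ']
  have hxn : 0 < x ^ n := by positivity
  nlinarith

theorem exists_algebraMap_lt_of_isIntegral (hm : StrictMono (algebraMap L R)) {x : R}
    (hx : IsIntegral L x) : ∃ l : L, algebraMap L R l < x := by
  obtain ⟨u, hu⟩ := exists_lt_algebraMap_of_isIntegral hm hx.neg
  exact ⟨-u, by rw [map_neg]; linarith⟩

omit [IsStrictOrderedRing L] [IsStrictOrderedRing R] in
theorem exists_interval_disjoint_finset (hm : StrictMono (algebraMap L R)) {D U : Set L}
    (hD : D.Nonempty) (hU : U.Nonempty) (S : Finset R)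
    (hS : ∀ r ∈ S, ∃ l ∈ D, ∃ u ∈ U, ¬ (algebraMap L R l < r ∧ r < algebraMap L R u)) :
    ∃ l ∈ D, ∃ u ∈ U, ∀ r ∈ S, ¬ (algebraMap L R l < r ∧ r < algebraMap L R u) := by
  induction S using Finset.induction_on with
  | empty =>
    obtain ⟨l, hl⟩ := hD
    obtain ⟨u, hu⟩ := hU
    exact ⟨l, hl, u, hu, by simp⟩
  | insert r S _ ih =>
    obtain ⟨l, hl, u, hu, h⟩ := ih fun s hs => hS s (Finset.mem_insert_of_mem hs)
    obtain ⟨l', hl', u', hu', h'⟩ := hS r (Finset.mem_insert_self _ _)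
    refine ⟨max l l', by rcases max_choice l l' with h | h <;> rw [h] <;> assumption,
      min u u', by rcases min_choice u u' with h | h <;> rw [h] <;> assumption, ?_⟩
    intro s hs ⟨h1, h2⟩
    rw [hm.monotone.map_max, max_lt_iff] at h1
    rw [hm.monotone.map_min, lt_min_iff] at h2
    rcases Finset.mem_insert.mp hs with rfl | hs
    · exact h' ⟨h1.2, h2.2⟩
    · exact h s hs ⟨h1.1, h2.1⟩

theorem exists_interval_mul_pos (hm : StrictMono (algebraMap L R)) (hR : PolynomialIVP R)
    {a : R} (ha : IsIntegral L a) (har : a ∉ Set.range (algebraMap L R)) {g : L[X]} (hg : g ≠ 0)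
    (hroots : ∀ x : R, aeval x g = 0 → x ∈ Set.range (algebraMap L R)) :
    ∃ l u : L, algebraMap L R l < a ∧ a < algebraMap L R u ∧
      ∀ m, l < m → m < u → 0 < aeval a g * algebraMap L R (g.eval m) := by
  have hg' : g.map (algebraMap L R) ≠ 0 :=
    (Polynomial.map_ne_zero_iff (algebraMap L R).injective).mpr hg
  obtain ⟨l, hl, u, hu, h⟩ := exists_interval_disjoint_finset hm
    (D := {l | algebraMap L R l < a}) (U := {u | a < algebraMap L R u})
    (exists_algebraMap_lt_of_isIntegral hm ha) (exists_lt_algebraMap_of_isIntegral hm ha)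
    (g.map (algebraMap L R)).roots.toFinset (by
      intro r hr
      rw [Multiset.mem_toFinset, mem_roots hg', IsRoot.def, eval_map_algebraMap] at hr
      obtain ⟨s, rfl⟩ := hroots r hr
      rcases lt_trichotomy (algebraMap L R s) a with h | h | h
      · obtain ⟨u, hu⟩ := exists_lt_algebraMap_of_isIntegral hm ha
        exact ⟨s, h, u, hu, fun h => lt_irrefl _ h.1⟩
      · exact absurd ⟨s, h⟩ har
      · obtain ⟨l, hl⟩ := exists_algebraMap_lt_of_isIntegral hm ha
        exact ⟨l, hl, s, h, fun h => lt_irrefl _ h.2⟩)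
  refine ⟨l, u, hl, hu, fun m hlm hmu => ?_⟩
  have := hR.mul_eval_pos (f := g.map (algebraMap L R)) hl hu (hm hlm) (hm hmu) (by
    intro c h1 h2 h3
    exact h c (by rwa [Multiset.mem_toFinset, mem_roots hg', IsRoot.def]) ⟨h1, h2⟩)
  simpa [eval_map_algebraMap, aeval_algebraMap_apply] using this

end Cuts

section TwoExtensions

variable {L R₁ R₂ : Type*} [Field L] [LinearOrder L] [IsStrictOrderedRing L]
  [Field R₁] [LinearOrder R₁] [IsStrictOrderedRing R₁] [Algebra L R₁]
  [Field R₂] [LinearOrder R₂] [IsStrictOrderedRing R₂] [Algebra L R₂]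

/-- Every element of `L` below (above) `a₁` is also below (above) `a₂`. -/
def CutLE (L : Type*) {R₁ R₂ : Type*} [Field L] [Field R₁] [LinearOrder R₁] [Algebra L R₁]
    [Field R₂] [LinearOrder R₂] [Algebra L R₂] (a₁ : R₁) (a₂ : R₂) : Prop :=
  ∀ l : L, (algebraMap L R₁ l < a₁ → algebraMap L R₂ l < a₂) ∧
    (a₁ < algebraMap L R₁ l → a₂ < algebraMap L R₂ l)

omit [LinearOrder L] [IsStrictOrderedRing L] [IsStrictOrderedRing R₁]
  [IsStrictOrderedRing R₂] in
theorem CutLE.notMem_range {a₁ : R₁} {a₂ : R₂} (h : CutLE L a₁ a₂)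
    (ha : a₁ ∉ Set.range (algebraMap L R₁)) : a₂ ∉ Set.range (algebraMap L R₂) := by
  rintro ⟨l, rfl⟩
  rcases lt_trichotomy (algebraMap L R₁ l) a₁ with h' | h' | h'
  · exact lt_irrefl _ ((h l).1 h')
  · exact ha ⟨l, h'⟩
  · exact lt_irrefl _ ((h l).2 h')

omit [LinearOrder L] [IsStrictOrderedRing L] [IsStrictOrderedRing R₁]
  [IsStrictOrderedRing R₂] in
theorem CutLE.symm {a₁ : R₁} {a₂ : R₂} (h : CutLE L a₁ a₂)
    (ha : a₁ ∉ Set.range (algebraMap L R₁)) : CutLE L a₂ a₁ := by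
  intro l
  rcases lt_trichotomy (algebraMap L R₁ l) a₁ with h' | h' | h'
  · exact ⟨fun _ => h', fun h'' => absurd ((h l).1 h') h''.not_gt⟩
  · exact absurd ⟨l, h'⟩ ha
  · exact ⟨fun h'' => absurd ((h l).2 h') h''.not_gt, fun _ => h'⟩

theorem CutLE.aeval_pos_iff (hm₁ : StrictMono (algebraMap L R₁))
    (hm₂ : StrictMono (algebraMap L R₂)) (hR₁ : PolynomialIVP R₁) (hR₂ : PolynomialIVP R₂)
    {a₁ : R₁} {a₂ : R₂} (h : CutLE L a₁ a₂) (ha₁ : IsIntegral L a₁) (ha₂ : IsIntegral L a₂)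
    (har : a₁ ∉ Set.range (algebraMap L R₁)) {g : L[X]} (hg : g ≠ 0)
    (hroots₁ : ∀ x : R₁, aeval x g = 0 → x ∈ Set.range (algebraMap L R₁))
    (hroots₂ : ∀ x : R₂, aeval x g = 0 → x ∈ Set.range (algebraMap L R₂)) :
    0 < aeval a₁ g ↔ 0 < aeval a₂ g := by
  obtain ⟨l₁, u₁, hl₁, hu₁, h₁⟩ := exists_interval_mul_pos hm₁ hR₁ ha₁ har hg hroots₁
  obtain ⟨l₂, u₂, hl₂, hu₂, h₂⟩ :=
    exists_interval_mul_pos hm₂ hR₂ ha₂ (h.notMem_range har) hg hroots₂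
  have hl : max l₁ l₂ < min u₁ u₂ := by
    have hl₁' := hm₂.lt_iff_lt.mp ((h l₁).1 hl₁ |>.trans ((h u₁).2 hu₁))
    have hl₂' := hm₂.lt_iff_lt.mp (hl₂.trans hu₂)
    have := hm₂.lt_iff_lt.mp (((h l₁).1 hl₁).trans hu₂)
    have := hm₂.lt_iff_lt.mp (hl₂.trans ((h u₁).2 hu₁))
    simp [*]
  obtain ⟨m, hm, hm'⟩ := exists_between hl
  rw [max_lt_iff] at hm
  rw [lt_min_iff] at hm'
  have p₁ := h₁ m hm.1 hm'.1
  have p₂ := h₂ m hm.2 hm'.2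
  rcases lt_trichotomy (g.eval m) 0 with h0 | h0 | h0
  · have q₁ : algebraMap L R₁ (g.eval m) < 0 := by simpa using hm₁ h0
    have q₂ : algebraMap L R₂ (g.eval m) < 0 := by simpa using hm₂ h0
    constructor <;> intro <;> nlinarith
  · simp [h0] at p₁
  · have q₁ : 0 < algebraMap L R₁ (g.eval m) := by simpa using hm₁ h0
    have q₂ : 0 < algebraMap L R₂ (g.eval m) := by simpa using hm₂ h0
    exact iff_of_true (pos_of_mul_pos_left p₁ q₁.le) (pos_of_mul_pos_left p₂ q₂.le)

omit [IsStrictOrderedRing R₂] in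
theorem exists_root_cutLE (hm₁ : StrictMono (algebraMap L R₁))
    (hm₂ : StrictMono (algebraMap L R₂)) (hR₁ : PolynomialIVP R₁) (hR₂ : PolynomialIVP R₂)
    {a₁ : R₁} (ha₁ : IsIntegral L a₁) (har : a₁ ∉ Set.range (algebraMap L R₁))
    (hroots : ∀ x : R₁, aeval x (derivative (minpoly L a₁)) = 0 →
      x ∈ Set.range (algebraMap L R₁)) :
    ∃ a₂ : R₂, aeval a₂ (minpoly L a₁) = 0 ∧ CutLE L a₁ a₂ := by
  set f := minpoly L a₁ with hf
  have hf0 : f ≠ 0 := minpoly.ne_zero ha₁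
  have hirr : Irreducible f := minpoly.irreducible ha₁
  have hsep : f.Separable := hirr.separable
  have hnoroot : ∀ l : L, f.eval l ≠ 0 := by
    intro l hl
    exact har (minpoly.mem_range_of_degree_eq_one L a₁
      (degree_eq_one_of_irreducible_of_root hirr hl))
  have hf1 : f.map (algebraMap L R₁) ≠ 0 :=
    (Polynomial.map_ne_zero_iff (algebraMap L R₁).injective).mpr hf0
  have hf2 : f.map (algebraMap L R₂) ≠ 0 :=
    (Polynomial.map_ne_zero_iff (algebraMap L R₂).injective).mpr hf0
  have hder : ∀ c : R₁, (f.map (algebraMap L R₁)).eval c = 0 →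
      (f.map (algebraMap L R₁)).derivative.eval c ≠ 0 := by
    intro c hc hc'
    rw [derivative_map, eval_map_algebraMap] at hc'
    rw [eval_map_algebraMap] at hc
    exact hsep.aeval_derivative_ne_zero hc hc'
  have ha₁0 : (f.map (algebraMap L R₁)).eval a₁ = 0 := by
    rw [eval_map_algebraMap, hf, minpoly.aeval]
  by_contra! hno
  obtain ⟨l₁, hl₁, u₁, hu₁, h₁⟩ := exists_interval_disjoint_finset hm₁
    (D := {l | algebraMap L R₁ l < a₁}) (U := {u | a₁ < algebraMap L R₁ u})
    (exists_algebraMap_lt_of_isIntegral hm₁ ha₁) (exists_lt_algebraMap_of_isIntegral hm₁ ha₁)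
    ((f.map (algebraMap L R₁)).roots.toFinset.erase a₁) (by
      intro r hr
      rw [Finset.mem_erase, Multiset.mem_toFinset, mem_roots hf1, IsRoot.def] at hr
      obtain ⟨hne, hr⟩ := hr
      by_contra! hcon
      have key : ∀ l : L, ¬ (min r a₁ < algebraMap L R₁ l ∧ algebraMap L R₁ l < max r a₁) := by
        rintro l ⟨h1, h2⟩
        obtain ⟨l₀, hl₀⟩ := exists_algebraMap_lt_of_isIntegral hm₁ ha₁
        obtain ⟨u₀, hu₀⟩ := exists_lt_algebraMap_of_isIntegral hm₁ ha₁
        rcases lt_trichotomy (algebraMap L R₁ l) a₁ with h | h | h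
        · have := (hcon l h u₀ hu₀).1
          rw [min_lt_iff] at h1
          rcases h1 with h1 | h1
          · exact lt_asymm this h1
          · exact lt_asymm h h1
        · exact har ⟨l, h⟩
        · have := (hcon l₀ hl₀ l h).2
          rw [lt_max_iff] at h2
          rcases h2 with h2 | h2
          · exact lt_asymm this h2
          · exact lt_asymm h h2
      have hlt : min r a₁ < max r a₁ := min_lt_max.mpr hne
      have hmin : (f.map (algebraMap L R₁)).eval (min r a₁) = 0 := by
        rcases min_choice r a₁ with h | h <;> rw [h] <;> assumption
      have hmax : (f.map (algebraMap L R₁)).eval (max r a₁) = 0 := by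
        rcases max_choice r a₁ with h | h <;> rw [h] <;> assumption
      obtain ⟨c, h1, h2, h3⟩ := hR₁.exists_derivative_eq_zero hlt hmin hmax hder
      rw [derivative_map, eval_map_algebraMap] at h3
      obtain ⟨l, rfl⟩ := hroots c h3
      exact key l ⟨h1, h2⟩)
  obtain ⟨l₂, hl₂, u₂, hu₂, h₂⟩ := exists_interval_disjoint_finset hm₂
    (D := {l | algebraMap L R₁ l < a₁}) (U := {u | a₁ < algebraMap L R₁ u})
    (exists_algebraMap_lt_of_isIntegral hm₁ ha₁) (exists_lt_algebraMap_of_isIntegral hm₁ ha₁)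
    (f.map (algebraMap L R₂)).roots.toFinset (by
      intro r hr
      rw [Multiset.mem_toFinset, mem_roots hf2, IsRoot.def, eval_map_algebraMap] at hr
      by_contra! hcon
      obtain ⟨l₀, hl₀⟩ := exists_algebraMap_lt_of_isIntegral hm₁ ha₁
      obtain ⟨u₀, hu₀⟩ := exists_lt_algebraMap_of_isIntegral hm₁ ha₁
      exact hno r hr fun l => ⟨fun h => (hcon l h u₀ hu₀).1, fun h => (hcon l₀ hl₀ l h).2⟩)
  simp only [Finset.mem_erase, Multiset.mem_toFinset, mem_roots hf1, mem_roots hf2, IsRoot.def,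
    Set.mem_ofPred_eq] at h₁ h₂ hl₁ hu₁ hl₂ hu₂
  set l := max l₁ l₂ with hldef
  set u := min u₁ u₂ with hudef
  have hl : algebraMap L R₁ l < a₁ := by
    rcases max_choice l₁ l₂ with h | h <;> rw [hldef, h] <;> assumption
  have hu : a₁ < algebraMap L R₁ u := by
    rcases min_choice u₁ u₂ with h | h <;> rw [hudef, h] <;> assumption
  have hlu : l < u := hm₁.lt_iff_lt.mp (hl.trans hu)
  have hpos : 0 < f.eval l * f.eval u := by
    by_contra! hc
    have hneg := hm₂ (lt_of_le_of_ne hc (mul_ne_zero (hnoroot l) (hnoroot u)))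
    obtain ⟨c, h3, h4, h5⟩ := hR₂ (f.map (algebraMap L R₂)) _ _ (hm₂ hlu) (by
      simpa [eval_map_algebraMap, aeval_algebraMap_apply] using hneg)
    exact h₂ c h5 ⟨(hm₂.monotone (le_max_right _ _)).trans_lt h3,
      h4.trans_le (hm₂.monotone (min_le_right _ _))⟩
  obtain ⟨g, hg⟩ := dvd_iff_isRoot.mpr ha₁0
  have hga : g.eval a₁ ≠ 0 := by
    intro h
    refine hder a₁ ha₁0 ?_
    rw [hg]; simp [h]
  have hpos' : 0 < (f.map (algebraMap L R₁)).eval (algebraMap L R₁ l)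
      * (f.map (algebraMap L R₁)).eval (algebraMap L R₁ u) := by
    simpa [eval_map_algebraMap, aeval_algebraMap_apply] using hm₁ hpos
  rw [hg] at hpos'
  simp only [eval_mul, eval_sub, eval_X, eval_C] at hpos'
  obtain ⟨c, h3, h4, h5⟩ := hR₁ g _ _ (hm₁ hlu) (by
    by_contra! hc
    nlinarith [mul_nonneg (mul_pos (sub_pos.mpr hl) (sub_pos.mpr hu)).le hc])
  refine h₁ c ⟨?_, by rw [hg]; simp [h5]⟩
    ⟨(hm₁.monotone (le_max_left _ _)).trans_lt h3, h4.trans_le (hm₁.monotone (min_le_left _ _))⟩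
  rintro rfl
  exact hga h5

theorem aeval_pos_iff_of_cutLE_of_roots (hm₁ : StrictMono (algebraMap L R₁))
    (hm₂ : StrictMono (algebraMap L R₂)) (hR₁ : PolynomialIVP R₁) (hR₂ : PolynomialIVP R₂)
    {a₁ : R₁} {a₂ : R₂} {f : L[X]} (hf : f.Monic) (h₁ : aeval a₁ f = 0) (h₂ : aeval a₂ f = 0)
    (h : CutLE L a₁ a₂) (har : a₁ ∉ Set.range (algebraMap L R₁))
    (hroots : ∀ g : L[X], g ≠ 0 → g.natDegree < f.natDegree →
      (∀ x : R₁, aeval x g = 0 → x ∈ Set.range (algebraMap L R₁)) ∧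
      ∀ x : R₂, aeval x g = 0 → x ∈ Set.range (algebraMap L R₂)) (g : L[X]) :
    0 < aeval a₁ g ↔ 0 < aeval a₂ g := by
  have hf1 : f ≠ 1 := by rintro rfl; simp at h₁
  have e₁ : aeval a₁ g = aeval a₁ (g %ₘ f) := by
    conv_lhs => rw [← modByMonic_add_div g f]
    simp [h₁]
  have e₂ : aeval a₂ g = aeval a₂ (g %ₘ f) := by
    conv_lhs => rw [← modByMonic_add_div g f]
    simp [h₂]
  rw [e₁, e₂]
  by_cases h0 : g %ₘ f = 0
  · simp [h0]
  · obtain ⟨r₁, r₂⟩ := hroots _ h0 (natDegree_modByMonic_lt g hf hf1)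
    exact h.aeval_pos_iff hm₁ hm₂ hR₁ hR₂ ⟨f, hf, h₁⟩ ⟨f, hf, h₂⟩ har h0 r₁ r₂

theorem algebraMap_surjective_of_forall_aeval_pos_iff (hm₁ : StrictMono (algebraMap L R₁))
    (hm₂ : StrictMono (algebraMap L R₂)) (hR₁ : PolynomialIVP R₁) (hR₂ : PolynomialIVP R₂)
    [Algebra.IsIntegral L R₁] [Algebra.IsIntegral L R₂]
    (hmax : ∀ (a₁ : R₁) (a₂ : R₂), (∀ g : L[X], 0 < aeval a₁ g ↔ 0 < aeval a₂ g) →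
      a₁ ∈ Set.range (algebraMap L R₁)) :
    Function.Surjective (algebraMap L R₁) ∧ Function.Surjective (algebraMap L R₂) := by
  have key : ∀ (n : ℕ) (g : L[X]), g ≠ 0 → g.natDegree < n →
      (∀ x : R₁, aeval x g = 0 → x ∈ Set.range (algebraMap L R₁)) ∧
      ∀ x : R₂, aeval x g = 0 → x ∈ Set.range (algebraMap L R₂) := by
    intro n
    induction n with
    | zero => simp
    | succ n ih =>
      intro g hg hgn
      have hder : ∀ (f : L[X]), f.Monic → f.natDegree ≠ 0 → f.derivative ≠ 0 ∧
          f.derivative.natDegree < f.natDegree := fun f hf hf0 =>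
        ⟨fun h => hf0 (derivative_eq_zero.mp h), natDegree_derivative_lt hf0⟩
      refine ⟨fun x hx => ?_, fun x hx => ?_⟩
      · by_contra hxr
        have hint := Algebra.IsIntegral.isIntegral (R := L) x
        have hdeg : (minpoly L x).natDegree ≤ n :=
          (natDegree_le_of_dvd (minpoly.dvd L x hx) hg).trans (by omega)
        obtain ⟨hd0, hdlt⟩ := hder _ (minpoly.monic hint) (minpoly.natDegree_pos hint).ne'
        obtain ⟨a₂, ha₂, hc⟩ := exists_root_cutLE (R₂ := R₂) hm₁ hm₂ hR₁ hR₂ hint hxr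
          (ih _ hd0 (hdlt.trans_le hdeg)).1
        exact hxr (hmax x a₂ (aeval_pos_iff_of_cutLE_of_roots hm₁ hm₂ hR₁ hR₂
          (minpoly.monic hint) (minpoly.aeval L x) ha₂ hc hxr
          fun g hg hgd => ih g hg (hgd.trans_le hdeg)))
      · by_contra hxr
        have hint := Algebra.IsIntegral.isIntegral (R := L) x
        have hdeg : (minpoly L x).natDegree ≤ n :=
          (natDegree_le_of_dvd (minpoly.dvd L x hx) hg).trans (by omega)
        obtain ⟨hd0, hdlt⟩ := hder _ (minpoly.monic hint) (minpoly.natDegree_pos hint).ne'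
        obtain ⟨a₁, ha₁, hc⟩ := exists_root_cutLE (R₂ := R₁) hm₂ hm₁ hR₂ hR₁ hint hxr
          (ih _ hd0 (hdlt.trans_le hdeg)).2
        exact hc.notMem_range hxr (hmax a₁ x fun g => (aeval_pos_iff_of_cutLE_of_roots hm₂ hm₁
          hR₂ hR₁ (minpoly.monic hint) (minpoly.aeval L x) ha₁ hc hxr
          (fun g hg hgd => (ih g hg (hgd.trans_le hdeg)).symm) g).symm)
  refine ⟨fun x => ?_, fun x => ?_⟩
  · have hint := Algebra.IsIntegral.isIntegral (R := L) x
    exact (key _ _ (minpoly.ne_zero hint) (Nat.lt_succ_self _)).1 x (minpoly.aeval L x)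
  · have hint := Algebra.IsIntegral.isIntegral (R := L) x
    exact (key _ _ (minpoly.ne_zero hint) (Nat.lt_succ_self _)).2 x (minpoly.aeval L x)

end TwoExtensions

theorem isIntegral_prod_of_field {K R₁ R₂ : Type*} [Field K] [CommRing R₁] [CommRing R₂]
    [Algebra K R₁] [Algebra K R₂] {z : R₁ × R₂} (h₁ : IsIntegral K z.1) (h₂ : IsIntegral K z.2) :
    IsIntegral K z := by
  refine ⟨minpoly K z.1 * minpoly K z.2, (minpoly.monic h₁).mul (minpoly.monic h₂), ?_⟩
  rw [← aeval_def]
  ext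
  · change AlgHom.fst K R₁ R₂ _ = 0
    rw [← aeval_algHom_apply]
    simp
  · change AlgHom.snd K R₁ R₂ _ = 0
    rw [← aeval_algHom_apply]
    simp

section Uniqueness

variable {K R₁ R₂ : Type*} [Field K]
  [Field R₁] [LinearOrder R₁] [IsStrictOrderedRing R₁] [Algebra K R₁]
  [Field R₂] [LinearOrder R₂] [IsStrictOrderedRing R₂] [Algebra K R₂]

theorem surjective_of_forall_eval₂_pos_iff {G : Type*} [Field G] (f₁ : G →+* R₁) (f₂ : G →+* R₂)
    (hf₁ : f₁.IsIntegral) (hf₂ : f₂.IsIntegral) (hR₁ : PolynomialIVP R₁) (hR₂ : PolynomialIVP R₂)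
    (hpos : ∀ x, 0 < f₁ x ↔ 0 < f₂ x)
    (hmax : ∀ (a₁ : R₁) (a₂ : R₂), (∀ g : G[X], 0 < g.eval₂ f₁ a₁ ↔ 0 < g.eval₂ f₂ a₂) →
      a₁ ∈ Set.range f₁) :
    Function.Surjective f₁ ∧ Function.Surjective f₂ := by
  let : LinearOrder G := LinearOrder.lift' f₁ f₁.injective
  have : IsStrictOrderedRing G := Function.Injective.isStrictOrderedRing f₁ (map_zero f₁)
    (map_one f₁) (map_add f₁) (map_mul f₁) (by intros; rfl) (by intros; rfl)
  let : Algebra G R₁ := f₁.toAlgebra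
  let : Algebra G R₂ := f₂.toAlgebra
  have : Algebra.IsIntegral G R₁ := ⟨hf₁⟩
  have : Algebra.IsIntegral G R₂ := ⟨hf₂⟩
  have hm₂ : StrictMono f₂ := fun x y h => by
    rw [← sub_pos, ← map_sub, ← hpos, map_sub, sub_pos]
    exact h
  exact algebraMap_surjective_of_forall_aeval_pos_iff (fun _ _ h => h) hm₂ hR₁ hR₂ hmax

/-- Two algebraic extensions of a field which have the intermediate value property for polynomials
and induce the same ordering on the base field are isomorphic. -/
theorem nonempty_algEquiv_of_polynomialIVP [Algebra.IsAlgebraic K R₁] [Algebra.IsAlgebraic K R₂]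
    (hR₁ : PolynomialIVP R₁) (hR₂ : PolynomialIVP R₂)
    (h : ∀ x : K, 0 ≤ algebraMap K R₁ x ↔ 0 ≤ algebraMap K R₂ x) :
    Nonempty (R₁ ≃ₐ[K] R₂) := by
  obtain ⟨G, -, hG⟩ := zorn_le_nonempty₀
    {G : Subalgebra K (R₁ × R₂) | ∀ z ∈ G, 0 ≤ z.1 ↔ 0 ≤ z.2} (by
      intro c hc hchain y hy
      have : Nonempty c := ⟨⟨y, hy⟩⟩
      refine ⟨sSup c, ?_, fun z hz => le_sSup hz⟩
      intro z hz
      rw [sSup_eq_iSup', ← SetLike.mem_coe, Subalgebra.coe_iSup_of_directed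
        hchain.directedOn.directed_val, Set.mem_iUnion] at hz
      obtain ⟨i, hi⟩ := hz
      exact hc i.2 z hi) ⊥ (by
      rintro z hz
      obtain ⟨x, rfl⟩ := Algebra.mem_bot.mp hz
      exact h x)
  have hGp : ∀ z ∈ G, 0 ≤ z.1 ↔ 0 ≤ z.2 := hG.prop
  have hneg : ∀ z ∈ G, z.1 ≤ 0 ↔ z.2 ≤ 0 := fun z hz => by
    simpa using hGp _ (neg_mem hz)
  have hpos : ∀ z ∈ G, 0 < z.1 ↔ 0 < z.2 := fun z hz => by
    rw [← not_le, ← not_le, hneg z hz]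
  have hzero : ∀ z ∈ G, z.1 = 0 ↔ z.2 = 0 := fun z hz => by
    rw [le_antisymm_iff, le_antisymm_iff, hneg z hz, hGp z hz]
  let f₁ : G →ₐ[K] R₁ := (AlgHom.fst K R₁ R₂).comp G.val
  let f₂ : G →ₐ[K] R₂ := (AlgHom.snd K R₁ R₂).comp G.val
  have hf₁ : Function.Injective f₁ := by
    rw [injective_iff_map_eq_zero]
    exact fun z hz => Subtype.ext (Prod.ext hz ((hzero z z.2).mp hz))
  have hf₂ : Function.Injective f₂ := by
    rw [injective_iff_map_eq_zero]
    exact fun z hz => Subtype.ext (Prod.ext ((hzero z z.2).mpr hz) hz)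
  have : IsDomain G := hf₁.isDomain f₁.toRingHom
  have : Algebra.IsIntegral K G := ⟨fun z => (isIntegral_algHom_iff G.val
    Subtype.val_injective).mp (isIntegral_prod_of_field (Algebra.IsIntegral.isIntegral _)
      (Algebra.IsIntegral.isIntegral _))⟩
  let : Field G := (isField_of_isIntegral_of_isField' (Field.toIsField K)).toField
  let : Algebra G R₁ := f₁.toRingHom.toAlgebra
  let : Algebra G R₂ := f₂.toRingHom.toAlgebra
  have : IsScalarTower K G R₁ := .of_algebraMap_eq fun _ => rfl
  have : IsScalarTower K G R₂ := .of_algebraMap_eq fun _ => rfl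
  have : Algebra.IsIntegral G R₁ := .tower_top K
  have : Algebra.IsIntegral G R₂ := .tower_top K
  obtain ⟨hs₁, hs₂⟩ := surjective_of_forall_eval₂_pos_iff f₁.toRingHom f₂.toRingHom
    (fun x => Algebra.IsIntegral.isIntegral (R := G) x)
    (fun x => Algebra.IsIntegral.isIntegral (R := G) x) hR₁ hR₂ (fun z => hpos z z.2) (by
    intro a₁ a₂ ha
    let φ : G[X] →ₐ[K] R₁ × R₂ :=
      ((aeval a₁ : G[X] →ₐ[G] R₁).restrictScalars K).prod
        ((aeval a₂ : G[X] →ₐ[G] R₂).restrictScalars K)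
    have hle : G ≤ φ.range := fun z hz => ⟨C ⟨z, hz⟩, Prod.ext (aeval_C _ _) (aeval_C _ _)⟩
    have hmem : φ.range ∈ {G : Subalgebra K (R₁ × R₂) | ∀ z ∈ G, 0 ≤ z.1 ↔ 0 ≤ z.2} := by
      rintro _ ⟨g, rfl⟩
      have := ha (-g)
      rw [eval₂_neg, eval₂_neg, neg_pos, neg_pos] at this
      rw [← not_lt, ← not_lt]
      exact not_congr this
    have hx : (a₁, a₂) ∈ G := hG.le_of_ge hmem hle ⟨X, Prod.ext (aeval_X _) (aeval_X _)⟩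
    exact ⟨⟨_, hx⟩, rfl⟩)
  exact ⟨(AlgEquiv.ofBijective f₁ ⟨hf₁, hs₁⟩).symm.trans (AlgEquiv.ofBijective f₂ ⟨hf₂, hs₂⟩)⟩

end Uniqueness

section Existence

theorem IsTotalOrderingCone.exists_linearOrder {F : Type*} [Field F] {T : Set F}
    (hT : IsTotalOrderingCone T) :
    ∃ _ : LinearOrder F, IsStrictOrderedRing F ∧ ∀ x : F, 0 ≤ x ↔ x ∈ T := by
  classical
  obtain ⟨hadd, hmul, htot, hneg⟩ := hT
  have hsq : ∀ x, x * x ∈ T := fun x => by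
    rcases htot x with h | h
    · exact hmul x h x h
    · simpa using hmul _ h _ h
  let C : RingCone F :=
    { carrier := T
      add_mem' := fun {a b} ha hb => hadd a ha b hb
      mul_mem' := fun {a b} ha hb => hmul a ha b hb
      zero_mem' := by simpa using hsq 0
      one_mem' := by simpa using hsq 1
      eq_zero_of_mem_of_neg_mem' := fun {a} h h' => hneg a h h' }
  have : HasMemOrNegMem C := ⟨htot⟩
  let : LinearOrder F := LinearOrder.mkOfAddGroupCone C
  have : IsOrderedRing F := IsOrderedRing.mkOfCone C
  refine ⟨inferInstance, IsOrderedRing.toIsStrictOrderedRing F, fun x => ?_⟩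
  change x - 0 ∈ T ↔ x ∈ T
  rw [sub_zero]

section SignChange

variable {L Ω : Type*} [Field L] [LinearOrder L] [IsStrictOrderedRing L]
  [Field Ω] [Algebra L Ω]

theorem exists_irreducible_dvd_eval_mul_eval_neg {f : L[X]} {a b : L}
    (h : f.eval a * f.eval b < 0) : ∃ p, Irreducible p ∧ p ∣ f ∧ p.eval a * p.eval b < 0 := by
  induction f using WfDvdMonoid.induction_on_irreducible with
  | zero => simp at h
  | unit u hu =>
    obtain ⟨c, -, rfl⟩ := isUnit_iff.mp hu
    rw [eval_C, eval_C] at h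
    exact absurd h (mul_self_nonneg c).not_gt
  | mul f p hf hp ih =>
    by_cases hpn : p.eval a * p.eval b < 0
    · exact ⟨p, hp, dvd_mul_right _ _, hpn⟩
    · obtain ⟨q, hq, hqf, hqn⟩ := ih (by
        by_contra! hc
        rw [not_lt] at hpn
        rw [eval_mul, eval_mul] at h
        nlinarith [mul_nonneg hpn hc])
      exact ⟨q, hq, hqf.mul_left _, hqn⟩

/-- The sums of squares of elements of `L[ξ]` with nonnegative coefficients from `L`. -/
def adjoinCone (L : Type*) {Ω : Type*} [Field L] [LinearOrder L] [Field Ω] [Algebra L Ω] (ξ : Ω) :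
    AddSubmonoid Ω :=
  AddSubmonoid.closure {x | ∃ t : L, 0 ≤ t ∧ ∃ g : L[X], x = algebraMap L Ω t * aeval ξ g ^ 2}

theorem exists_polynomial_of_mem_adjoinCone {f : L[X]} (hf : f.natDegree ≠ 0) {ξ : Ω}
    (hξ : aeval ξ f = 0) {y : Ω} (hy : y ∈ adjoinCone L ξ) :
    ∃ F : L[X], aeval ξ F = y ∧ (∀ x, 0 ≤ F.eval x) ∧ F.natDegree ≤ 2 * (f.natDegree - 1) ∧
      ∀ ζ : Ω, aeval ζ F ∈ adjoinCone L ζ := by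
  induction hy using AddSubmonoid.closure_induction with
  | zero => exact ⟨0, by simp⟩
  | add y z _ _ hy hz =>
    obtain ⟨F, hF, hF0, hFd, hFm⟩ := hy
    obtain ⟨G, hG, hG0, hGd, hGm⟩ := hz
    refine ⟨F + G, by simp [hF, hG], fun x => ?_,
      (natDegree_add_le _ _).trans (max_le hFd hGd), fun ζ => ?_⟩
    · rw [eval_add]; exact add_nonneg (hF0 x) (hG0 x)
    · rw [map_add]; exact add_mem (hFm ζ) (hGm ζ)
  | mem y hy =>
    obtain ⟨t, ht, g, rfl⟩ := hy
    refine ⟨C t * (g % f) ^ 2, ?_, fun x => ?_, ?_, fun ζ => ?_⟩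
    · have : aeval ξ g = aeval ξ (g % f) := by
        conv_lhs => rw [← EuclideanDomain.mod_add_div g f]
        simp [hξ]
      simp [this]
    · simp only [eval_mul, eval_C, eval_pow]; positivity
    · refine (natDegree_C_mul_le _ _).trans (natDegree_pow_le.trans ?_)
      have := natDegree_mod_lt g hf
      omega
    · exact AddSubmonoid.subset_closure ⟨t, ht, g % f, by simp⟩

theorem neg_one_notMem_adjoinCone [IsAlgClosed Ω] {f : L[X]} (hf : Irreducible f) {a b : L}
    (hab : f.eval a * f.eval b < 0) {ξ : Ω} (hξ : aeval ξ f = 0) : -1 ∉ adjoinCone L ξ := by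
  induction hn : f.natDegree using Nat.strong_induction_on generalizing f ξ with
  | _ n ih =>
    intro hmem
    have hn0 := hf.natDegree_pos
    obtain ⟨F, hF, hF0, hFd, hFm⟩ := exists_polynomial_of_mem_adjoinCone hn0.ne' hξ hmem
    have hdvd : f ∣ 1 + F := by
      by_contra hnd
      obtain ⟨u, v, huv⟩ := hf.coprime_iff_not_dvd.mpr hnd
      have := congrArg (aeval ξ) huv
      simp [hξ, hF] at this
    obtain ⟨h, hh⟩ := hdvd
    have hpos : ∀ x, 0 < f.eval x * h.eval x := fun x => by
      rw [← eval_mul, ← hh, eval_add, eval_one]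
      linarith [hF0 x]
    have hne : h ≠ 0 := by rintro rfl; simpa using hpos 0
    have hdeg : h.natDegree < n := by
      have h1 := natDegree_mul hf.ne_zero hne
      rw [← hh] at h1
      have h2 : (1 + F).natDegree ≤ max (natDegree (1 : L[X])) F.natDegree := natDegree_add_le _ _
      rw [natDegree_one, Nat.zero_max] at h2
      omega
    have hhab : h.eval a * h.eval b < 0 := by
      by_contra! hc
      nlinarith [mul_pos (hpos a) (hpos b), mul_nonneg hc (neg_nonneg.mpr hab.le)]
    obtain ⟨p, hp, hph, hpab⟩ := exists_irreducible_dvd_eval_mul_eval_neg hhab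
    obtain ⟨ζ, hζ⟩ := IsAlgClosed.exists_aeval_eq_zero Ω p hp.degree_pos.ne'
    refine ih _ ((natDegree_le_of_dvd hph hne).trans_lt hdeg) hp hpab hζ rfl ?_
    have hζh : aeval ζ h = 0 := by
      obtain ⟨q, rfl⟩ := hph
      simp [hζ]
    have := congrArg (aeval ζ) hh
    rw [map_mul, hζh, mul_zero, map_add, map_one, add_comm, add_eq_zero_iff_eq_neg] at this
    rw [← this]
    exact hFm ζ

end SignChange

section WeightedCone

variable {K Ω : Type*} [Field K] [Field Ω] [Algebra K Ω]

/-- The sums of squares of elements of `L` with coefficients from `W`. -/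
def weightedCone (W : Set K) (L : IntermediateField K Ω) : AddSubmonoid Ω :=
  AddSubmonoid.closure {x | ∃ w ∈ W, ∃ s ∈ L, x = algebraMap K Ω w * s ^ 2}

variable {W : Set K} {L L' : IntermediateField K Ω}

theorem weightedCone_mono (h : L ≤ L') : weightedCone W L ≤ weightedCone W L' :=
  AddSubmonoid.closure_mono fun _ ⟨w, hw, s, hs, hx⟩ => ⟨w, hw, s, h hs, hx⟩

theorem mem_of_mem_weightedCone {x : Ω} (hx : x ∈ weightedCone W L) : x ∈ L := by
  induction hx using AddSubmonoid.closure_induction with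
  | zero => exact zero_mem L
  | add x y _ _ hx hy => exact add_mem hx hy
  | mem x hx =>
    obtain ⟨w, -, s, hs, rfl⟩ := hx
    exact mul_mem (L.algebraMap_mem w) (pow_mem hs 2)

theorem mul_mem_weightedCone (hW : ∀ v ∈ W, ∀ w ∈ W, v * w ∈ W) {x y : Ω}
    (hx : x ∈ weightedCone W L) (hy : y ∈ weightedCone W L) : x * y ∈ weightedCone W L := by
  induction hx using AddSubmonoid.closure_induction with
  | zero => rw [zero_mul]; exact zero_mem _
  | add x x' _ _ hx hx' => rw [add_mul]; exact add_mem hx hx'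
  | mem x hx =>
    obtain ⟨v, hv, s, hs, rfl⟩ := hx
    induction hy using AddSubmonoid.closure_induction with
    | zero => rw [mul_zero]; exact zero_mem _
    | add y y' _ _ hy hy' => rw [mul_add]; exact add_mem hy hy'
    | mem y hy =>
      obtain ⟨w, hw, t, ht, rfl⟩ := hy
      exact AddSubmonoid.subset_closure
        ⟨v * w, hW v hv w hw, s * t, mul_mem hs ht, by rw [map_mul]; ring⟩

theorem sq_mem_weightedCone (hW : 1 ∈ W) {x : Ω} (hx : x ∈ L) : x ^ 2 ∈ weightedCone W L :=
  AddSubmonoid.subset_closure ⟨1, hW, x, hx, by simp⟩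

theorem exists_eq_aeval_of_mem_adjoin_simple {F E : Type*} [Field F] [Field E] [Algebra F E]
    {ξ y : E} (hξ : IsIntegral F ξ) (hy : y ∈ IntermediateField.adjoin F {ξ}) :
    ∃ g : F[X], y = aeval ξ g := by
  rw [← IntermediateField.mem_toSubalgebra,
    IntermediateField.adjoin_simple_toSubalgebra_of_isAlgebraic hξ.isAlgebraic,
    Algebra.adjoin_singleton_eq_range_aeval] at hy
  obtain ⟨g, rfl⟩ := hy
  exact ⟨g, rfl⟩

theorem exists_eq_add_mul_of_mem_adjoin_sqrt {r y : Ω} (hr : r ^ 2 ∈ L)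
    (hy : y ∈ IntermediateField.adjoin L {r}) : ∃ u ∈ L, ∃ v ∈ L, y = u + v * r := by
  obtain ⟨g, rfl⟩ := exists_eq_aeval_of_mem_adjoin_simple (F := L)
    (⟨X ^ 2 - C ⟨r ^ 2, hr⟩, monic_X_pow_sub_C _ two_ne_zero, by simp⟩) hy
  clear hy
  induction g using Polynomial.induction_on with
  | C a => exact ⟨a, a.2, 0, zero_mem _, by simp⟩
  | add p q hp hq =>
    obtain ⟨u, hu, v, hv, h⟩ := hp
    obtain ⟨u', hu', v', hv', h'⟩ := hq
    exact ⟨u + u', add_mem hu hu', v + v', add_mem hv hv', by rw [map_add, h, h']; ring⟩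
  | monomial n a h =>
    obtain ⟨u, hu, v, hv, h⟩ := h
    exact ⟨v * r ^ 2, mul_mem hv hr, u, hu, by rw [pow_succ, ← mul_assoc, map_mul, h, aeval_X]; ring⟩

theorem exists_maximal_weightedCone (h : -1 ∉ weightedCone (Ω := Ω) W ⊥) :
    ∃ L : IntermediateField K Ω, Maximal (fun L => -1 ∉ weightedCone W L) L := by
  obtain ⟨L, -, hL⟩ := zorn_le_nonempty₀
    {L : IntermediateField K Ω | -1 ∉ weightedCone W L} (by
      intro c hc hchain y hy
      have : Nonempty c := ⟨⟨y, hy⟩⟩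
      refine ⟨sSup c, fun hmem => ?_, fun z hz => le_sSup hz⟩
      have hdir : Directed (· ≤ ·) fun i : c => weightedCone W i.1 := fun i j => by
        obtain ⟨k, hk, hk'⟩ := hchain.directedOn.directed_val i j
        exact ⟨k, weightedCone_mono hk, weightedCone_mono hk'⟩
      have hle : weightedCone W (sSup c) ≤ ⨆ i : c, weightedCone W i.1 := by
        refine (AddSubmonoid.closure_le).mpr ?_
        rintro _ ⟨w, hw, s, hs, rfl⟩
        rw [sSup_eq_iSup', ← SetLike.mem_coe, IntermediateField.coe_iSup_of_directed
          hchain.directedOn.directed_val, Set.mem_iUnion] at hs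
        obtain ⟨i, hi⟩ := hs
        exact AddSubmonoid.mem_iSup_of_mem i (AddSubmonoid.subset_closure ⟨w, hw, s, hi, rfl⟩)
      obtain ⟨i, hi⟩ := (AddSubmonoid.mem_iSup_of_directed hdir).mp (hle hmem)
      exact hc i.2 hi) ⊥ h
  exact ⟨L, hL⟩

variable [IsAlgClosed Ω]

theorem mem_or_neg_mem_weightedCone (hW1 : 1 ∈ W) (hW : ∀ v ∈ W, ∀ w ∈ W, v * w ∈ W)
    (hL : Maximal (fun L : IntermediateField K Ω => -1 ∉ weightedCone W L) L) {x : Ω}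
    (hx : x ∈ L) : x ∈ weightedCone W L ∨ -x ∈ weightedCone W L := by
  obtain ⟨r, rfl⟩ := IsAlgClosed.exists_pow_nat_eq x two_pos
  by_cases hr : r ∈ L
  · exact Or.inl (sq_mem_weightedCone hW1 hr)
  right
  set M := (IntermediateField.adjoin L {r}).restrictScalars K
  have hLM : L ≤ M := fun y hy => (IntermediateField.adjoin L {r}).algebraMap_mem ⟨y, hy⟩
  have hneg : -1 ∈ weightedCone W M := by
    by_contra hcon
    exact hr (hL.le_of_ge hcon hLM (IntermediateField.mem_adjoin_simple_self L r))
  have key : ∀ y ∈ weightedCone W M, ∃ c ∈ weightedCone W L, ∃ d ∈ weightedCone W L, ∃ e ∈ L,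
      y = c + d * r ^ 2 + e * r := by
    intro y hy
    induction hy using AddSubmonoid.closure_induction with
    | zero => exact ⟨0, zero_mem _, 0, zero_mem _, 0, zero_mem _, by simp⟩
    | add y z _ _ hy hz =>
      obtain ⟨c, hc, d, hd, e, he, rfl⟩ := hy
      obtain ⟨c', hc', d', hd', e', he', rfl⟩ := hz
      exact ⟨c + c', add_mem hc hc', d + d', add_mem hd hd', e + e', add_mem he he', by ring⟩
    | mem y hy =>
      obtain ⟨w, hw, s, hs, rfl⟩ := hy
      obtain ⟨u, hu, v, hv, rfl⟩ := exists_eq_add_mul_of_mem_adjoin_sqrt hx hs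
      refine ⟨algebraMap K Ω w * u ^ 2, AddSubmonoid.subset_closure ⟨w, hw, u, hu, rfl⟩,
        algebraMap K Ω w * v ^ 2, AddSubmonoid.subset_closure ⟨w, hw, v, hv, rfl⟩,
        algebraMap K Ω w * (u * v + u * v), ?_, by ring⟩
      exact mul_mem (L.algebraMap_mem w) (add_mem (mul_mem hu hv) (mul_mem hu hv))
  obtain ⟨c, hc, d, hd, e, he, h⟩ := key _ hneg
  have hcL := mem_of_mem_weightedCone hc
  have hdL := mem_of_mem_weightedCone hd
  have he0 : e = 0 := by
    by_contra he0
    refine hr ?_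
    have : r = (-1 - c - d * r ^ 2) / e := by
      field_simp
      linear_combination -h
    rw [this]
    exact div_mem (sub_mem (sub_mem (neg_mem (one_mem L)) hcL) (mul_mem hdL hx)) he
  subst he0
  have hd0 : d ≠ 0 := by
    rintro rfl
    refine hL.prop ?_
    rw [h]
    simpa using hc
  have : -r ^ 2 = (1 + c) * d * d⁻¹ ^ 2 := by
    field_simp
    linear_combination h
  rw [this]
  refine mul_mem_weightedCone hW (mul_mem_weightedCone hW (add_mem ?_ hc) hd)
    (sq_mem_weightedCone hW1 (inv_mem hdL))
  simpa using sq_mem_weightedCone hW1 (one_mem L)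

theorem isTotalOrderingCone_weightedCone (hW1 : 1 ∈ W) (hW : ∀ v ∈ W, ∀ w ∈ W, v * w ∈ W)
    (hL : Maximal (fun L : IntermediateField K Ω => -1 ∉ weightedCone W L) L) :
    IsTotalOrderingCone {x : L | (x : Ω) ∈ weightedCone W L} := by
  refine ⟨fun a ha b hb => (weightedCone W L).add_mem ha hb,
    fun a ha b hb => mul_mem_weightedCone hW ha hb,
    fun x => mem_or_neg_mem_weightedCone hW1 hW hL x.2, fun x hx hx' => ?_⟩
  by_contra h0
  have h0' : (x : Ω) ≠ 0 := fun h => h0 (Subtype.ext h)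
  refine hL.prop ?_
  have : (-1 : Ω) = x * -x * (x : Ω)⁻¹ ^ 2 := by field_simp
  rw [this]
  exact mul_mem_weightedCone hW (mul_mem_weightedCone hW hx hx')
    (sq_mem_weightedCone hW1 (inv_mem x.2))

theorem polynomialIVP_of_maximal_weightedCone [LinearOrder L] [IsStrictOrderedRing L]
    [Algebra.IsAlgebraic K Ω]
    (hL : Maximal (fun L : IntermediateField K Ω => -1 ∉ weightedCone W L) L)
    (hnn : ∀ w ∈ W, 0 ≤ algebraMap K L w) : PolynomialIVP L := by
  intro f a b hab hf
  obtain ⟨p, hp, ⟨q, rfl⟩, hpab⟩ := exists_irreducible_dvd_eval_mul_eval_neg hf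
  obtain ⟨ξ, hξ⟩ := IsAlgClosed.exists_aeval_eq_zero Ω p hp.degree_pos.ne'
  set M := (IntermediateField.adjoin L {ξ}).restrictScalars K
  have hLM : L ≤ M := fun y hy => (IntermediateField.adjoin L {ξ}).algebraMap_mem ⟨y, hy⟩
  have hle : weightedCone W M ≤ adjoinCone L ξ := by
    refine AddSubmonoid.closure_mono ?_
    rintro _ ⟨w, hw, s, hs, rfl⟩
    obtain ⟨g, rfl⟩ := exists_eq_aeval_of_mem_adjoin_simple
      (Algebra.IsIntegral.isIntegral (R := K) ξ).tower_top hs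
    exact ⟨algebraMap K L w, hnn w hw, g, rfl⟩
  have hξL : ξ ∈ L := hL.le_of_ge (fun h => neg_one_notMem_adjoinCone hp hpab hξ (hle h)) hLM
    (IntermediateField.mem_adjoin_simple_self L ξ)
  obtain ⟨ξ, rfl⟩ : ∃ z : L, algebraMap L Ω z = ξ := ⟨⟨ξ, hξL⟩, rfl⟩
  have hroot : p.IsRoot ξ := by
    rw [aeval_algebraMap_apply] at hξ
    exact (algebraMap L Ω).injective (by simpa using hξ)
  obtain ⟨u, hu⟩ := dvd_iff_isRoot.mpr hroot
  obtain ⟨c, -, rfl⟩ := isUnit_iff.mp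
    ((hp.isUnit_or_isUnit hu).resolve_left (not_isUnit_X_sub_C ξ))
  rw [hu] at hpab
  simp only [eval_mul, eval_sub, eval_X, eval_C] at hpab
  have h1 : (a - ξ) * (b - ξ) < 0 := by
    by_contra! hc
    nlinarith [mul_nonneg hc (mul_self_nonneg c)]
  rcases mul_neg_iff.mp h1 with h | h
  · exact absurd hab (by linarith)
  · exact ⟨ξ, by linarith, by linarith, by simp [hroot.eq_zero]⟩

end WeightedCone

theorem exists_polynomialIVP_extension_of_field {K : Type u} [Field K] {W : Set K} (hW1 : 1 ∈ W)
    (hW : ∀ v ∈ W, ∀ w ∈ W, v * w ∈ W)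
    (h : -1 ∉ AddSubmonoid.closure {x : K | ∃ w ∈ W, ∃ s, x = w * s ^ 2}) :
    ∃ (R : Type u) (_ : Field R) (_ : LinearOrder R) (_ : IsStrictOrderedRing R)
      (_ : Algebra K R), Algebra.IsAlgebraic K R ∧ PolynomialIVP R ∧
      ∀ w ∈ W, 0 ≤ algebraMap K R w := by
  have hbot : -1 ∉ weightedCone (Ω := AlgebraicClosure K) W ⊥ := by
    intro hmem
    have hle : weightedCone (Ω := AlgebraicClosure K) W ⊥ ≤
        (AddSubmonoid.closure {x : K | ∃ w ∈ W, ∃ s, x = w * s ^ 2}).map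
          (algebraMap K (AlgebraicClosure K)) := by
      refine AddSubmonoid.closure_le.mpr ?_
      rintro _ ⟨w, hw, s, hs, rfl⟩
      obtain ⟨s, rfl⟩ := IntermediateField.mem_bot.mp hs
      exact ⟨w * s ^ 2, AddSubmonoid.subset_closure ⟨w, hw, s, rfl⟩, by simp⟩
    obtain ⟨c, hc, hc'⟩ := hle hmem
    refine h ?_
    rwa [← (algebraMap K (AlgebraicClosure K)).injective (a₁ := c) (a₂ := -1) (by simpa using hc')]
  obtain ⟨L, hL⟩ := exists_maximal_weightedCone hbot
  obtain ⟨_, _, hord⟩ := (isTotalOrderingCone_weightedCone hW1 hW hL).exists_linearOrder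
  have hnn : ∀ w ∈ W, 0 ≤ algebraMap K L w := fun w hw => (hord _).mpr
    (AddSubmonoid.subset_closure ⟨w, hw, 1, one_mem _, by simp⟩)
  exact ⟨L, inferInstance, inferInstance, inferInstance, inferInstance, inferInstance,
    polynomialIVP_of_maximal_weightedCone hL hnn, hnn⟩

end Existence

section Cones

theorem IsTotalOrderingCone.isPartialOrdering {K : Type*} [CommRing K] {T : Set K}
    (hT : IsTotalOrderingCone T) : IsPartialOrdering T := by
  obtain ⟨hadd, hmul, htot, hneg⟩ := hT
  refine ⟨hadd, hmul, fun a => ?_, hneg⟩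
  rcases htot a with h | h
  · rw [sq]; exact hmul a h a h
  · rw [← neg_sq, sq]; exact hmul _ h _ h

theorem IsTotalOrderingCone.div_mem_iff {F : Type*} [Field F] {T : Set F}
    (hT : IsTotalOrderingCone T) {x y : F} (hy : y ≠ 0) : x / y ∈ T ↔ x * y ∈ T := by
  have hsq := hT.isPartialOrdering.2.2.1
  constructor <;> intro h
  · have := hT.2.1 _ h _ (hsq y)
    rwa [show x / y * y ^ 2 = x * y by field_simp] at this
  · have := hT.2.1 _ h _ (hsq y⁻¹)
    rwa [show x * y * y⁻¹ ^ 2 = x / y by field_simp] at this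

theorem IsTotalOrderingCone.eq_of_forall_algebraMap_mem_iff {A F : Type*} [CommRing A] [IsDomain A]
    [Field F] [Algebra A F] [IsFractionRing A F] {S T : Set F} (hS : IsTotalOrderingCone S)
    (hT : IsTotalOrderingCone T) (h : ∀ a : A, algebraMap A F a ∈ S ↔ algebraMap A F a ∈ T) :
    S = T := by
  ext x
  obtain ⟨a, b, hb, rfl⟩ := IsFractionRing.div_surjective (A := A) x
  have hb' : algebraMap A F b ≠ 0 := IsFractionRing.to_map_ne_zero_of_mem_nonZeroDivisors hb
  rw [hS.div_mem_iff hb', hT.div_mem_iff hb', ← map_mul, h]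

theorem isTotalOrderingCone_setOf_nonneg {F R : Type*} [Field F] [Field R] [LinearOrder R]
    [IsStrictOrderedRing R] (φ : F →+* R) : IsTotalOrderingCone {x : F | 0 ≤ φ x} := by
  refine ⟨fun a ha b hb => ?_, fun a ha b hb => ?_, fun x => ?_, fun x hx hx' => ?_⟩
  · rw [Set.mem_ofPred, map_add]; exact add_nonneg ha hb
  · rw [Set.mem_ofPred, map_mul]; exact mul_nonneg ha hb
  · rw [Set.mem_ofPred, Set.mem_ofPred, map_neg, neg_nonneg]; exact le_total _ _
  · rw [Set.mem_ofPred] at hx hx'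
    rw [map_neg, neg_nonneg] at hx'
    exact φ.injective ((le_antisymm hx' hx).trans (map_zero φ).symm)

theorem isRealRing_of_injective {B R : Type*} [CommRing B] [Field R] [LinearOrder R]
    [IsStrictOrderedRing R] {φ : B →+* R} (hφ : Function.Injective φ) : IsRealRing B := by
  intro n f hf i
  have := congrArg φ hf
  rw [map_sum, map_zero, Finset.sum_eq_zero_iff_of_nonneg fun i _ => by
    rw [map_pow]; exact sq_nonneg _] at this
  have := this i (Finset.mem_univ i)
  rw [map_pow, sq_eq_zero_iff] at this
  exact hφ (this.trans (map_zero φ).symm)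

theorem IsSumSq.exists_eq_sum_fin {D : Type*} [CommRing D] {x : D} (hx : IsSumSq x) :
    ∃ (n : ℕ) (f : Fin n → D), x = ∑ i, f i ^ 2 := by
  induction hx with
  | zero => exact ⟨0, Fin.elim0, by simp⟩
  | sq_add a _ ih =>
    obtain ⟨n, f, rfl⟩ := ih
    exact ⟨n + 1, Fin.cons a f, by simp [Fin.sum_univ_succ, sq]⟩

theorem IsRealRing.isPartialOrdering_setOf_isSumSq {D : Type*} [CommRing D] (hD : IsRealRing D) :
    IsPartialOrdering {x : D | IsSumSq x} := by
  refine ⟨fun a ha b hb => IsSumSq.add ha hb, fun a ha b hb => IsSumSq.mul ha hb,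
    fun a => by rw [sq]; exact IsSumSq.mul_self a, fun a ha ha' => ?_⟩
  obtain ⟨m, f, hf⟩ := ha.exists_eq_sum_fin
  obtain ⟨n, g, hg⟩ := ha'.exists_eq_sum_fin
  have hfg := hD (m + n) (Fin.append f g) (by simp [Fin.sum_univ_add, ← hf, ← hg])
  have : ∀ i, f i = 0 := fun i => by simpa using hfg (Fin.castAdd n i)
  simpa [this] using hf

theorem nonneg_iff_nonneg_of_imp {C R₁ R₂ : Type*} [CommRing C]
    [Field R₁] [LinearOrder R₁] [IsStrictOrderedRing R₁]
    [Field R₂] [LinearOrder R₂] [IsStrictOrderedRing R₂] {φ : C →+* R₁} {ψ : C →+* R₂}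
    (hψ : Function.Injective ψ) (h : ∀ c, 0 ≤ φ c → 0 ≤ ψ c) (c : C) : 0 ≤ φ c ↔ 0 ≤ ψ c := by
  refine ⟨h c, fun hc => ?_⟩
  rcases le_total 0 (φ c) with h0 | h0
  · exact h0
  · have h1 := h (-c) (by rwa [map_neg, neg_nonneg])
    rw [map_neg, neg_nonneg] at h1
    have : c = 0 := hψ ((le_antisymm h1 hc).trans (map_zero ψ).symm)
    rw [this, map_zero]

end Cones

section Domains

theorem exists_polynomialIVP_extension (A : Type u) [CommRing A] [IsDomain A] {P : Set A}
    (hP : IsPartialOrdering P) :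
    ∃ (R : Type u) (_ : Field R) (_ : LinearOrder R) (_ : IsStrictOrderedRing R)
      (_ : Algebra A R), FaithfulSMul A R ∧ Algebra.IsAlgebraic A R ∧ PolynomialIVP R ∧
      ∀ p ∈ P, 0 ≤ algebraMap A R p := by
  obtain ⟨hadd, hmul, hsq, hneg⟩ := hP
  let K := FractionRing A
  have h1 : (1 : A) ∈ P := by simpa using hsq 1
  have hcl : ∀ x ∈ AddSubmonoid.closure {x : K | ∃ w ∈ algebraMap A K '' P, ∃ s, x = w * s ^ 2},
      ∃ p ∈ P, ∃ b : A, b ≠ 0 ∧ x * algebraMap A K b ^ 2 = algebraMap A K p := by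
    intro x hx
    induction hx using AddSubmonoid.closure_induction with
    | zero => exact ⟨0, by simpa using hsq 0, 1, one_ne_zero, by simp⟩
    | add x y _ _ hx hy =>
      obtain ⟨p, hp, b, hb, hx⟩ := hx
      obtain ⟨q, hq, c, hc, hy⟩ := hy
      refine ⟨p * c ^ 2 + q * b ^ 2, hadd _ (hmul _ hp _ (hsq c)) _ (hmul _ hq _ (hsq b)), b * c,
        mul_ne_zero hb hc, ?_⟩
      simp only [map_add, map_mul, map_pow, ← hx, ← hy]
      ring
    | mem x hx =>
      obtain ⟨_, ⟨p, hp, rfl⟩, s, rfl⟩ := hx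
      obtain ⟨a, b, hb, rfl⟩ := IsFractionRing.div_surjective (A := A) s
      have hb' : algebraMap A K b ≠ 0 := IsFractionRing.to_map_ne_zero_of_mem_nonZeroDivisors hb
      refine ⟨p * a ^ 2, hmul _ hp _ (hsq a), b, nonZeroDivisors.ne_zero hb, ?_⟩
      rw [mul_assoc, ← mul_pow, div_mul_cancel₀ _ hb', map_mul, map_pow]
  obtain ⟨R, _, _, _, _, halg, hR, hnn⟩ := exists_polynomialIVP_extension_of_field
    (W := algebraMap A K '' P) ⟨1, h1, map_one _⟩
    (by
      rintro _ ⟨p, hp, rfl⟩ _ ⟨q, hq, rfl⟩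
      exact ⟨p * q, hmul p hp q hq, map_mul _ _ _⟩)
    (fun hmem => by
      obtain ⟨p, hp, b, hb, h⟩ := hcl _ hmem
      have : p = -b ^ 2 := IsFractionRing.injective A K (by rw [← h, map_neg, map_pow]; ring)
      exact hb (pow_eq_zero_iff two_ne_zero |>.mp (hneg _ (hsq b) (this ▸ hp))))
  let : Algebra A R := ((algebraMap K R).comp (algebraMap A K)).toAlgebra
  have : IsScalarTower A K R := .of_algebraMap_eq fun _ => rfl
  exact ⟨R, inferInstance, inferInstance, inferInstance, inferInstance,
    (faithfulSMul_iff_algebraMap_injective A R).mpr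
      ((algebraMap K R).injective.comp (IsFractionRing.injective A K)),
    (IsFractionRing.comap_isAlgebraic_iff (K := K)).mpr halg, hR, fun p hp => hnn _ ⟨p, hp, rfl⟩⟩

theorem nonempty_algEquiv_of_polynomialIVP_of_isDomain {A R₁ R₂ : Type*} [CommRing A] [IsDomain A]
    [Field R₁] [LinearOrder R₁] [IsStrictOrderedRing R₁] [Algebra A R₁] [FaithfulSMul A R₁]
    [Algebra.IsAlgebraic A R₁]
    [Field R₂] [LinearOrder R₂] [IsStrictOrderedRing R₂] [Algebra A R₂] [FaithfulSMul A R₂]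
    [Algebra.IsAlgebraic A R₂] (hR₁ : PolynomialIVP R₁) (hR₂ : PolynomialIVP R₂)
    (h : ∀ a : A, 0 ≤ algebraMap A R₁ a ↔ 0 ≤ algebraMap A R₂ a) : Nonempty (R₁ ≃ₐ[A] R₂) := by
  let K := FractionRing A
  let : Algebra K R₁ := FractionRing.liftAlgebra A R₁
  let : Algebra K R₂ := FractionRing.liftAlgebra A R₂
  have : Algebra.IsAlgebraic K R₁ := (IsFractionRing.comap_isAlgebraic_iff (A := A)).mp inferInstance
  have : Algebra.IsAlgebraic K R₂ := (IsFractionRing.comap_isAlgebraic_iff (A := A)).mp inferInstance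
  have hS : {x : K | 0 ≤ algebraMap K R₁ x} = {x : K | 0 ≤ algebraMap K R₂ x} :=
    (isTotalOrderingCone_setOf_nonneg _).eq_of_forall_algebraMap_mem_iff (A := A)
      (isTotalOrderingCone_setOf_nonneg _) fun a => by
        rw [Set.mem_ofPred, Set.mem_ofPred, ← IsScalarTower.algebraMap_apply,
          ← IsScalarTower.algebraMap_apply, h]
  obtain ⟨e⟩ := nonempty_algEquiv_of_polynomialIVP (K := K) hR₁ hR₂ (Set.ext_iff.mp hS)
  exact ⟨e.restrictScalars A⟩

theorem IsEssentialExtension.isDomain {A B : Type*} [CommRing A] [IsDomain A] [CommRing B]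
    {f : A →+* B} (hf : IsEssentialExtension f) : IsDomain B := by
  have : Nontrivial B := hf.1.nontrivial
  have : NoZeroDivisors B := ⟨fun {b c} hbc => by
    by_contra! hne
    obtain ⟨a, ha, ha0⟩ := hf.2 (Ideal.span {b}) (by simpa using hne.1)
    obtain ⟨a', ha', ha0'⟩ := hf.2 (Ideal.span {c}) (by simpa using hne.2)
    obtain ⟨u, hu⟩ := Ideal.mem_span_singleton.mp ha
    obtain ⟨v, hv⟩ := Ideal.mem_span_singleton.mp ha'
    have : f (a * a') = f 0 := by
      rw [map_mul, hu, hv, map_zero]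
      linear_combination u * v * hbc
    rcases mul_eq_zero.mp (hf.1 this) with h | h
    · exact ha0 (by rw [h, map_zero])
    · exact ha0' (by rw [h, map_zero])⟩
  exact NoZeroDivisors.to_isDomain B

theorem isEssentialExtension_algebraMap {A C : Type*} [CommRing A] [IsDomain A] [CommRing C]
    [IsDomain C] [Algebra A C] [FaithfulSMul A C] [Algebra.IsIntegral A C] :
    IsEssentialExtension (algebraMap A C) := by
  have hinj := FaithfulSMul.algebraMap_injective A C
  refine ⟨hinj, fun J hJ => ?_⟩
  obtain ⟨a, ha, ha0⟩ := Submodule.exists_mem_ne_zero_of_ne_bot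
    (mt (Ideal.eq_bot_of_comap_eq_bot (R := A)) hJ)
  exact ⟨a, ha, fun h => ha0 (hinj (h.trans (map_zero _).symm))⟩

end Domains

section RealClosure

variable {A R : Type u} [CommRing A] [IsDomain A] [Field R] [LinearOrder R]
  [IsStrictOrderedRing R] [Algebra A R]

theorem isRealClosedStar_integralClosure [FaithfulSMul A R] [Algebra.IsAlgebraic A R] (hR : PolynomialIVP R) :
    IsRealClosedStar (integralClosure A R) := by
  refine ⟨isRealRing_of_injective (φ := algebraMap (integralClosure A R) R)
    Subtype.val_injective, fun D _ f hD hf hint d => ?_⟩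
  have := hf.isDomain
  obtain ⟨R', _, _, _, _, _, _, hR', -⟩ :=
    exists_polynomialIVP_extension D hD.isPartialOrdering_setOf_isSumSq
  let C := integralClosure A R
  let : Algebra C D := f.toAlgebra
  let : Algebra C R' := ((algebraMap D R').comp f).toAlgebra
  have : IsScalarTower C D R' := .of_algebraMap_eq fun _ => rfl
  have : Algebra.IsIntegral C D := ⟨hint⟩
  have : Algebra.IsAlgebraic C R' := .trans C D R'
  have : Algebra.IsAlgebraic C R := .extendScalars (FaithfulSMul.algebraMap_injective A C)
  have hinj : Function.Injective (algebraMap C R') :=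
    (FaithfulSMul.algebraMap_injective D R').comp hf.1
  have : FaithfulSMul C R' := (faithfulSMul_iff_algebraMap_injective C R').mpr hinj
  obtain ⟨e⟩ := nonempty_algEquiv_of_polynomialIVP_of_isDomain (A := C) hR hR'
    (nonneg_iff_nonneg_of_imp hinj fun c hc => by
      obtain ⟨y, hy⟩ := hR.exists_eq_sq hc
      have hyC : IsIntegral A y := .of_pow two_pos (hy ▸ c.2)
      have : c = (⟨y, hyC⟩ : C) ^ 2 := Subtype.ext hy
      rw [this, map_pow]
      exact sq_nonneg _)
  have hd : IsIntegral C (e.symm (algebraMap D R' d)) :=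
    ((Algebra.IsIntegral.isIntegral (R := C) d).algebraMap).map e.symm
  refine ⟨⟨_, isIntegral_trans (R := A) _ hd⟩, FaithfulSMul.algebraMap_injective D R' ?_⟩
  rw [← e.symm.injective.eq_iff]
  exact e.symm.commutes _

theorem isRealClosureStarOf_integralClosure [FaithfulSMul A R] [Algebra.IsAlgebraic A R]
    (hR : PolynomialIVP R) {P : Set A} (hP : ∀ p ∈ P, 0 ≤ algebraMap A R p) :
    IsRealClosureStarOf A P (integralClosure A R) {x | 0 ≤ (x : R)}
      (algebraMap A (integralClosure A R)) where
  pos_partial := ⟨fun _ ha _ hb => add_nonneg ha hb, fun _ ha _ hb => mul_nonneg ha hb,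
    fun a => sq_nonneg (a : R), fun _ ha ha' => Subtype.ext (le_antisymm (neg_nonneg.mp ha') ha)⟩
  rcs := isRealClosedStar_integralClosure hR
  essential := isEssentialExtension_algebraMap
  integral := Algebra.IsIntegral.isIntegral
  mono := hP

theorem IsRealClosureStarOf.exists_polynomialIVP_extension {A B : Type u} [CommRing A] [IsDomain A]
    [CommRing B] [Algebra A B] {P : Set A} {Q : Set B}
    (hB : IsRealClosureStarOf A P B Q (algebraMap A B)) :
    ∃ (R : Type u) (_ : Field R) (_ : LinearOrder R) (_ : IsStrictOrderedRing R)
      (_ : Algebra A R) (_ : Algebra B R), IsScalarTower A B R ∧ FaithfulSMul A R ∧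
      Algebra.IsAlgebraic A R ∧ PolynomialIVP R ∧ IsIntegralClosure B A R ∧
      ∀ b, b ∈ Q ↔ 0 ≤ algebraMap B R b := by
  have := hB.essential.isDomain
  obtain ⟨R, _, _, _, _, _, _, hR, hQ⟩ := _root_.exists_polynomialIVP_extension B hB.pos_partial
  let : Algebra A R := ((algebraMap B R).comp (algebraMap A B)).toAlgebra
  have : IsScalarTower A B R := .of_algebraMap_eq fun _ => rfl
  have hinj := FaithfulSMul.algebraMap_injective B R
  have : Algebra.IsIntegral A B := ⟨hB.integral⟩
  have hsurj := hB.rcs.2 (integralClosure B R) (algebraMap B _)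
    (isRealRing_of_injective (φ := algebraMap (integralClosure B R) R) Subtype.val_injective)
    isEssentialExtension_algebraMap Algebra.IsIntegral.isIntegral
  have hrange : ∀ x : R, IsIntegral B x → ∃ b, algebraMap B R b = x := fun x hx => by
    obtain ⟨b, hb⟩ := hsurj ⟨x, hx⟩
    exact ⟨b, congrArg Subtype.val hb⟩
  refine ⟨R, inferInstance, inferInstance, inferInstance, inferInstance, inferInstance,
    inferInstance, (faithfulSMul_iff_algebraMap_injective A R).mpr (hinj.comp hB.essential.1),
    .trans A B R, hR, ⟨hinj, fun {x} => ⟨fun hx => hrange x hx.tower_top, ?_⟩⟩,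
    fun b => ⟨hQ b, fun hb => ?_⟩⟩
  · rintro ⟨b, rfl⟩
    exact (Algebra.IsIntegral.isIntegral b).algebraMap
  · obtain ⟨y, hy⟩ := hR.exists_eq_sq hb
    obtain ⟨c, rfl⟩ := hrange y (.of_pow two_pos (hy ▸ isIntegral_algebraMap))
    rw [← map_pow] at hy
    rw [hinj hy]
    exact hB.pos_partial.2.2.1 c

end RealClosure

section Main

variable {A : Type u} [CommRing A] [IsDomain A] {P : Set A}

theorem IsTotalOrderingCone.exists_realClosureStar {T : Set (FractionRing A)}
    (hT : IsTotalOrderingCone T) (hP : ∀ a ∈ P, algebraMap A (FractionRing A) a ∈ T) :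
    ∃ B : RealClosureStar A P, ∀ a, B.emb a ∈ B.pos ↔ algebraMap A (FractionRing A) a ∈ T := by
  let K := FractionRing A
  obtain ⟨R, _, _, _, _, _, _, hR, hnn⟩ := exists_polynomialIVP_extension K hT.isPartialOrdering
  let : Algebra A R := ((algebraMap K R).comp (algebraMap A K)).toAlgebra
  have : IsScalarTower A K R := .of_algebraMap_eq fun _ => rfl
  have : FaithfulSMul A R := (faithfulSMul_iff_algebraMap_injective A R).mpr
    ((algebraMap K R).injective.comp (IsFractionRing.injective A K))
  have : Algebra.IsAlgebraic A R := (IsFractionRing.comap_isAlgebraic_iff (K := K)).mpr inferInstance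
  refine ⟨⟨_, _, _, isRealClosureStarOf_integralClosure hR fun a ha => hnn _ (hP a ha)⟩,
    fun a => ⟨fun ha => ?_, fun ha => hnn _ ha⟩⟩
  rcases hT.2.2.1 (algebraMap A K a) with h | h
  · exact h
  · have h' := hnn _ h
    rw [map_neg, neg_nonneg] at h'
    have : algebraMap A K a = 0 :=
      (algebraMap K R).injective ((le_antisymm h' ha).trans (map_zero _).symm)
    rwa [this, neg_zero, ← this] at h

theorem IsTotalOrderingCone.eq_of_forall_aIso {S T : Set (FractionRing A)}
    (hS : IsTotalOrderingCone S) (hT : IsTotalOrderingCone T)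
    (hPS : ∀ a ∈ P, algebraMap A (FractionRing A) a ∈ S)
    (hPT : ∀ a ∈ P, algebraMap A (FractionRing A) a ∈ T)
    (h : ∀ B C : RealClosureStar A P, B.AIso C) : S = T := by
  obtain ⟨B, hB⟩ := hS.exists_realClosureStar hPS
  obtain ⟨C, hC⟩ := hT.exists_realClosureStar hPT
  obtain ⟨e, he, hpos⟩ := h B C
  exact hS.eq_of_forall_algebraMap_mem_iff hT fun a => by rw [← hB, ← hC, hpos, he]

theorem RealClosureStar.aIso_of_forall_eq (B C : RealClosureStar A P)
    (h : ∀ S T : Set (FractionRing A), IsTotalOrderingCone S → IsTotalOrderingCone T →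
      (∀ a ∈ P, algebraMap A (FractionRing A) a ∈ S) →
      (∀ a ∈ P, algebraMap A (FractionRing A) a ∈ T) → S = T) : B.AIso C := by
  let K := FractionRing A
  let : Algebra A B.carrier := B.emb.toAlgebra
  let : Algebra A C.carrier := C.emb.toAlgebra
  obtain ⟨R, _, _, _, _, _, _, _, _, hR, _, hB⟩ := B.is.exists_polynomialIVP_extension
  obtain ⟨R', _, _, _, _, _, _, _, _, hR', _, hC⟩ := C.is.exists_polynomialIVP_extension
  let : Algebra K R := FractionRing.liftAlgebra A R
  let : Algebra K R' := FractionRing.liftAlgebra A R'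
  have hST := h _ _ (isTotalOrderingCone_setOf_nonneg (algebraMap K R))
    (isTotalOrderingCone_setOf_nonneg (algebraMap K R'))
    (fun a ha => by
      rw [Set.mem_ofPred, ← IsScalarTower.algebraMap_apply,
        IsScalarTower.algebraMap_apply A B.carrier R, ← hB]
      exact B.is.mono a ha)
    (fun a ha => by
      rw [Set.mem_ofPred, ← IsScalarTower.algebraMap_apply,
        IsScalarTower.algebraMap_apply A C.carrier R', ← hC]
      exact C.is.mono a ha)
  obtain ⟨e⟩ := nonempty_algEquiv_of_polynomialIVP_of_isDomain (A := A) hR hR' fun a => by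
    have := Set.ext_iff.mp hST (algebraMap A K a)
    rwa [Set.mem_ofPred, Set.mem_ofPred, ← IsScalarTower.algebraMap_apply,
      ← IsScalarTower.algebraMap_apply] at this
  have he : ∀ x, 0 ≤ e x ↔ 0 ≤ x :=
    fun x => (hR'.nonneg_iff.trans ⟨by
      rintro ⟨y, hy⟩
      exact ⟨e.symm y, by rw [← map_pow, ← hy, e.symm_apply_apply]⟩, by
      rintro ⟨y, rfl⟩
      exact ⟨e y, map_pow e y 2⟩⟩).trans hR.nonneg_iff.symm
  let : Algebra B.carrier R' := (e.toRingHom.comp (algebraMap B.carrier R)).toAlgebra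
  have : IsScalarTower A B.carrier R' := .of_algebraMap_eq fun a =>
    (e.commutes a).symm.trans (congrArg e (IsScalarTower.algebraMap_apply A B.carrier R a))
  have : IsIntegralClosure B.carrier A R' := .of_algEquiv B.carrier e fun _ => rfl
  let g := IsIntegralClosure.equiv A B.carrier R' C.carrier
  refine ⟨g.toRingEquiv, g.commutes, fun b => ?_⟩
  rw [hB, hC, ← he]
  change _ ↔ 0 ≤ algebraMap C.carrier R' (g b)
  rw [IsIntegralClosure.algebraMap_equiv]
  rfl

end Main

end OrderedFields

/-- A real integral domain `A`, regarded as a poring with partial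
ordering `P`, has a unique real closure * iff its quotient field admits exactly one total
ordering extending the partial ordering induced by `P`. -/
theorem hasUniqueRealClosureStar_iff_existsUnique_totalOrdering
    (A : Type u) [CommRing A] [IsDomain A] (P : Set A)
    (hP : IsPartialOrdering P) (hreal : IsRealRing A) :
    HasUniqueRealClosureStar A P ↔
      ∃! T : Set (FractionRing A), IsTotalOrderingCone T ∧
        ∀ a ∈ P, algebraMap A (FractionRing A) a ∈ T := by
  constructor
  · rintro ⟨-, huniq⟩
    obtain ⟨R, _, _, _, _, _, _, hR, hnn⟩ := exists_polynomialIVP_extension A hP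
    let : Algebra (FractionRing A) R := FractionRing.liftAlgebra A R
    refine existsUnique_of_exists_of_unique
      ⟨_, isTotalOrderingCone_setOf_nonneg (algebraMap (FractionRing A) R), fun a ha => ?_⟩ ?_
    · rw [Set.mem_ofPred, ← IsScalarTower.algebraMap_apply]
      exact hnn a ha
    · rintro S T ⟨hS, hPS⟩ ⟨hT, hPT⟩
      exact hS.eq_of_forall_aIso hT hPS hPT huniq
  · rintro ⟨T, -, huniq⟩
    obtain ⟨R, _, _, _, _, _, _, hR, hnn⟩ := exists_polynomialIVP_extension A hP
    exact ⟨⟨⟨_, _, _, isRealClosureStarOf_integralClosure hR hnn⟩⟩, fun B C =>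
      B.aIso_of_forall_eq C fun S T hS hT hPS hPT =>
        (huniq S ⟨hS, hPS⟩).trans (huniq T ⟨hT, hPT⟩).symm⟩
end

section
/- Let A be a real integral domain regarded as a poring with partial ordering A⁺. A ring B is a real closure * of A if and only if B is the integral closure of A in some real closed field K that is algebraic over Frac(A), whose ordering extends the partial ordering of Frac(A) induced by A⁺, and the partial ordering of B is B⁺ = B ∩ K⁺ (where K⁺ is the set of squares of K). -/
universe u

/-- Witness that `(B, Q)` is (isomorphic over `A` to) the integral closure of `A` in a
real closed field `K` algebraic over `Frac A`, whose ordering (the squares of `K`)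
extends the partial ordering of `Frac A` induced by `P`, with `Q = B ∩ K⁺`. -/
structure IntegralClosureInRCFWitness (A : Type u) [CommRing A] (P : Set A)
    (B : Type u) [CommRing B] (Q : Set B) (f : A →+* B) : Type (u + 1) where
  K : Type u
  [fieldK : Field K]
  /-- the inclusion of `B` into `K` -/
  g : B →+* K
  inj : Function.Injective g
  injA : Function.Injective (g.comp f)
  rcf : IsRealClosedField K
  /-- `K` is algebraic over `Frac A`: every element is algebraic over the image of `A` -/
  alg : ∀ x : K, ∃ q : Polynomial A,
    Polynomial.eval₂ (g.comp f) x q = 0 ∧ q.map (g.comp f) ≠ 0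
  /-- the ordering of `K` extends the partial ordering of `Frac A` induced by `P` -/
  ordext : ∀ a ∈ P, ∃ y : K, y ^ 2 = g (f a)
  /-- `B` is the integral closure of `A` in `K` -/
  range_ic : Set.range g = {x : K | (g.comp f).IsIntegralElem x}
  /-- `B⁺ = B ∩ K⁺` where `K⁺` is the set of squares of `K` -/
  posQ : ∀ b : B, b ∈ Q ↔ ∃ y : K, y ^ 2 = g b

open Polynomial

/-- A description of real rings in terms of `IsSumSq`. -/
theorem isRealRing_iff_of_isSumSq {A : Type*} [CommRing A] :
    IsRealRing A ↔ ∀ s a : A, IsSumSq s → a * a + s = 0 → a = 0 := by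
  constructor
  · intro h s a hs has
    have key : ∃ (n : ℕ) (v : Fin n → A), s = ∑ i, v i ^ 2 := by
      clear has
      induction hs with
      | zero => exact ⟨0, Fin.elim0, by simp⟩
      | @sq_add b t _ ih =>
        obtain ⟨n, v, rfl⟩ := ih
        exact ⟨n + 1, Fin.cons b v, by simp [Fin.sum_univ_succ, pow_two]⟩
    obtain ⟨n, v, rfl⟩ := key
    simpa using h (n + 1) (Fin.cons a v) (by simpa [Fin.sum_univ_succ, pow_two] using has) 0
  · intro h n v hv i
    rw [← Finset.add_sum_erase _ _ (Finset.mem_univ i), pow_two] at hv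
    refine h _ _ (IsSumSq.sum fun j _ => ?_) hv
    rw [pow_two]
    exact IsSumSq.mul_self _

theorem IsRealRing.of_injective {A B : Type*} [CommRing A] [CommRing B] (f : A →+* B)
    (hf : Function.Injective f) (hB : IsRealRing B) : IsRealRing A := by
  intro n v hv i
  refine hf ?_
  rw [map_zero]
  refine hB n (fun i => f (v i)) ?_ i
  simpa using congrArg f hv

theorem isRealRing_iff_not_isSumSq_neg_one {F : Type*} [Field F] :
    IsRealRing F ↔ ¬ IsSumSq (-1 : F) := by
  rw [isRealRing_iff_of_isSumSq]
  constructor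
  · intro h hs
    exact one_ne_zero (h (-1) 1 hs (by ring))
  · intro h s a hs has
    by_contra ha
    apply h
    have : (-1 : F) = s * (a⁻¹ * a⁻¹) := by
      field_simp
      linear_combination -has
    rw [this]
    exact hs.mul (IsSumSq.mul_self _)

/-- The fraction field of a real domain is real. -/
theorem IsRealRing.isFractionRing {B K : Type*} [CommRing B] [IsDomain B] [Field K] [Algebra B K]
    [IsFractionRing B K] (hB : IsRealRing B) : IsRealRing K := by
  rw [isRealRing_iff_not_isSumSq_neg_one]
  have key : ∀ s : K, IsSumSq s → ∃ b t : B, b ≠ 0 ∧ IsSumSq t ∧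
      s * algebraMap B K (b * b) = algebraMap B K t := by
    intro s hs
    induction hs with
    | zero => exact ⟨1, 0, one_ne_zero, .zero, by simp⟩
    | @sq_add x s _ ih =>
      obtain ⟨b, t, hb, ht, h⟩ := ih
      obtain ⟨c, d, hd, rfl⟩ := IsFractionRing.div_surjective (A := B) x
      have hd0 : d ≠ 0 := nonZeroDivisors.ne_zero hd
      have hd' : algebraMap B K d ≠ 0 := by
        simpa using hd0
      refine ⟨b * d, (c * b) * (c * b) + d * d * t, mul_ne_zero hb hd0,
        (IsSumSq.mul_self _).add ((IsSumSq.mul_self _).mul ht), ?_⟩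
      simp only [map_mul, map_add] at h ⊢
      field_simp
      linear_combination (algebraMap B K d) ^ 2 * h
  intro h
  obtain ⟨b, t, hb, ht, hbt⟩ := key _ h
  apply hb
  refine isRealRing_iff_of_isSumSq.1 hB t b ht (IsFractionRing.injective B K ?_)
  rw [map_add, ← hbt, map_zero]
  ring

/-- A nonzero sum of squares of polynomials over a real field has even degree, and its leading
coefficient is a sum of squares. -/
theorem IsSumSq.polynomial_even_natDegree {F : Type*} [Field F] (hF : IsRealRing F) {h : F[X]}
    (hs : IsSumSq h) : h = 0 ∨ (Even h.natDegree ∧ IsSumSq h.leadingCoeff) := by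
  induction hs with
  | zero => exact .inl rfl
  | @sq_add g s _ ih =>
    by_cases hg : g = 0
    · simpa [hg] using ih
    have hgd : (g * g).natDegree = g.natDegree + g.natDegree := natDegree_mul hg hg
    rcases ih with rfl | ⟨h1, h2⟩
    · refine .inr ⟨?_, ?_⟩
      · rw [add_zero, hgd]; exact ⟨_, rfl⟩
      · rw [add_zero, leadingCoeff_mul]; exact IsSumSq.mul_self _
    by_cases hs0 : s = 0
    · refine .inr ⟨?_, ?_⟩
      · rw [hs0, add_zero, hgd]; exact ⟨_, rfl⟩
      · rw [hs0, add_zero, leadingCoeff_mul]; exact IsSumSq.mul_self _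
    refine .inr ?_
    rcases lt_trichotomy (g * g).degree s.degree with hlt | heq | hgt
    · rw [natDegree_add_eq_right_of_degree_lt hlt, leadingCoeff_add_of_degree_lt hlt]
      exact ⟨h1, h2⟩
    · have hne : (g * g).leadingCoeff + s.leadingCoeff ≠ 0 := by
        rw [leadingCoeff_mul]
        intro h0
        exact hg (leadingCoeff_eq_zero.1 (isRealRing_iff_of_isSumSq.1 hF _ _ h2 h0))
      have hd : (g * g + s).degree = s.degree := by
        rw [degree_add_eq_of_leadingCoeff_add_ne_zero hne, heq, max_self]
      rw [leadingCoeff_add_of_degree_eq heq hne, natDegree_eq_of_degree_eq hd, leadingCoeff_mul]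
      exact ⟨h1, (IsSumSq.mul_self _).add h2⟩
    · rw [natDegree_add_eq_left_of_degree_lt hgt, leadingCoeff_add_of_degree_lt' hgt, hgd,
        leadingCoeff_mul]
      exact ⟨⟨_, rfl⟩, IsSumSq.mul_self _⟩

theorem IsSumSq.map_ringHom {A B : Type*} [CommRing A] [CommRing B] (f : A →+* B) {s : A}
    (hs : IsSumSq s) : IsSumSq (f s) := by
  induction hs with
  | zero => simp
  | sq_add a _ ih => simpa using IsSumSq.sq_add (f a) ih

/-- If `-1` is a sum of squares after adjoining a square root of `x`, then `-1 = u + v * x` for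
sums of squares `u` and `v`. -/
theorem exists_isSumSq_add_mul_eq_neg_one {K : Type*} [Field K] {x : K}
    (h : IsSumSq (-1 : AdjoinRoot (X ^ 2 - C x))) :
    ∃ u v : K, IsSumSq u ∧ IsSumSq v ∧ u + v * x = -1 := by
  set p : K[X] := X ^ 2 - C x with hp
  have hr : AdjoinRoot.root p ^ 2 = AdjoinRoot.of p x := by
    have := AdjoinRoot.eval₂_root p
    simpa [hp, sub_eq_zero] using this
  have hdeg : p.degree = 2 := degree_X_pow_sub_C (by norm_num) x
  have hmonic : p.Monic := monic_X_pow_sub_C x (by norm_num)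
  have hrep : ∀ y : AdjoinRoot p, ∃ a b : K,
      y = AdjoinRoot.of p a + AdjoinRoot.of p b * AdjoinRoot.root p := by
    intro y
    induction y using AdjoinRoot.induction_on with
    | ih q =>
      have hlt : (q %ₘ p).degree ≤ 1 := by
        have := degree_modByMonic_lt q hmonic
        rw [hdeg] at this
        exact Order.le_of_lt_succ this
      refine ⟨(q %ₘ p).coeff 0, (q %ₘ p).coeff 1, ?_⟩
      conv_lhs => rw [← modByMonic_add_div q p]
      rw [map_add, map_mul, AdjoinRoot.mk_self, zero_mul, add_zero]
      conv_lhs => rw [eq_X_add_C_of_degree_le_one hlt]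
      simp [add_comm]
  have key : ∀ s : AdjoinRoot p, IsSumSq s → ∃ u v w : K, IsSumSq u ∧ IsSumSq v ∧
      s = AdjoinRoot.of p (u + v * x) + AdjoinRoot.of p w * AdjoinRoot.root p := by
    intro s hs
    induction hs with
    | zero => exact ⟨0, 0, 0, .zero, .zero, by simp⟩
    | @sq_add y s _ ih =>
      obtain ⟨u, v, w, hu, hv, rfl⟩ := ih
      obtain ⟨a, b, rfl⟩ := hrep y
      refine ⟨a * a + u, b * b + v, 2 * a * b + w, .sq_add a hu, .sq_add b hv, ?_⟩
      simp only [map_add, map_mul, map_ofNat]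
      linear_combination (AdjoinRoot.of p b) ^ 2 * hr
  obtain ⟨u, v, w, hu, hv, huv⟩ := key _ h
  refine ⟨u, v, hu, hv, ?_⟩
  have hdvd : p ∣ C w * X + C (u + v * x + 1) := by
    rw [← AdjoinRoot.mk_eq_zero]
    simp only [map_add, map_mul, AdjoinRoot.mk_C, AdjoinRoot.mk_X, map_one] at huv ⊢
    linear_combination -huv
  have h0 := eq_zero_of_dvd_of_degree_lt hdvd
    (degree_linear_le.trans_lt (by rw [hdeg]; norm_num))
  have := congrArg (fun q => coeff q 0) h0
  simp only [coeff_add, coeff_mul_X_zero, coeff_C_zero, coeff_zero, zero_add] at this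
  linear_combination this

/-- A real field without proper real simple algebraic extensions is real closed. -/
theorem IsRealClosedField.of_forall_adjoinRoot {K : Type u} [Field K] (hK : IsRealRing K)
    (hmax : ∀ p : K[X], Irreducible p → IsRealRing (AdjoinRoot p) → p.natDegree ≤ 1) :
    IsRealClosedField K := by
  have hirr_neg : ∀ p : K[X], Irreducible p → 1 < p.natDegree →
      IsSumSq (-1 : AdjoinRoot p) := by
    intro p hp hd
    have : Fact (Irreducible p) := ⟨hp⟩
    by_contra h
    exact absurd (hmax p hp (isRealRing_iff_not_isSumSq_neg_one.2 h)) (by omega)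
  have hneg := isRealRing_iff_not_isSumSq_neg_one.1 hK
  -- the negative of a non-square is a sum of squares
  have hsum : ∀ x : K, ¬ IsSquare x → IsSumSq (-x) := by
    intro x hx
    have hirr : Irreducible (X ^ 2 - C x : K[X]) := by
      refine (X_pow_sub_C_irreducible_iff_of_prime Nat.prime_two).2 fun b hb => hx ⟨b, ?_⟩
      rw [← hb, pow_two]
    obtain ⟨u, v, hu, hv, huv⟩ := exists_isSumSq_add_mul_eq_neg_one
      (hirr_neg _ hirr (by rw [natDegree_X_pow_sub_C]; norm_num))
    have hv0 : v ≠ 0 := by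
      rintro rfl
      apply hneg
      rw [← huv]
      simpa using hu
    have : -x = (1 * 1 + u) * v * (v⁻¹ * v⁻¹) := by
      field_simp
      linear_combination -huv
    rw [this]
    exact ((IsSumSq.sq_add 1 hu).mul hv).mul (IsSumSq.mul_self _)
  have hsq : ∀ x : K, IsSumSq x → IsSquare x := by
    intro x hx
    by_contra hns
    have hx0 : x ≠ 0 := by
      rintro rfl
      exact hns ⟨0, by simp⟩
    apply hneg
    have : (-1 : K) = -x * x * (x⁻¹ * x⁻¹) := by
      field_simp
    rw [this]
    exact ((hsum x hns).mul hx).mul (IsSumSq.mul_self _)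
  refine ⟨hK, fun x => ?_, ?_⟩
  · by_cases hx : IsSquare x
    · obtain ⟨y, hy⟩ := hx
      exact .inl ⟨y, by rw [hy, pow_two]⟩
    · obtain ⟨y, hy⟩ := hsq _ (hsum x hx)
      exact .inr ⟨y, by rw [hy, pow_two]⟩
  · intro q hq
    induction hn : q.natDegree using Nat.strong_induction_on generalizing q with
    | _ n ih =>
    subst hn
    have hq0 : q ≠ 0 := by
      rintro rfl
      simp at hq
    by_cases hirr : Irreducible q
    · by_cases h1 : q.natDegree ≤ 1
      · have hd : q.natDegree = 1 := by
          have := hq.pos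
          omega
        obtain ⟨x, hx⟩ := exists_root_of_degree_eq_one
          (by rw [degree_eq_natDegree hq0, hd, Nat.cast_one])
        exact ⟨x, hx⟩
      · have hlift : ∀ s : AdjoinRoot q, IsSumSq s → ∃ h : K[X], IsSumSq h ∧
            h.natDegree + 2 ≤ 2 * q.natDegree ∧ AdjoinRoot.mk q h = s := by
          intro s hs
          induction hs with
          | zero => exact ⟨0, .zero, by rw [natDegree_zero]; omega, by simp⟩
          | @sq_add y s _ ih' =>
            obtain ⟨h, hh, hd, rfl⟩ := ih'
            obtain ⟨g, rfl⟩ := AdjoinRoot.mk_surjective y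
            refine ⟨g % q * (g % q) + h, .sq_add _ hh, ?_, ?_⟩
            · have hg : (g % q).natDegree < q.natDegree := natDegree_mod_lt g (by omega)
              have h2 := natDegree_mul_le (p := g % q) (q := g % q)
              have h3 := natDegree_add_le (g % q * (g % q)) h
              omega
            · have : AdjoinRoot.mk q (g % q) = AdjoinRoot.mk q g := by
                conv_rhs => rw [← EuclideanDomain.mod_add_div g q]
                simp
              simp [this]
        obtain ⟨h, hh, hd, hhq⟩ := hlift _ (hirr_neg q hirr (by omega))
        obtain ⟨r, hr⟩ : q ∣ 1 * 1 + h := by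
          rw [← AdjoinRoot.mk_eq_zero]
          simp [hhq]
        have hne : 1 * 1 + h ≠ 0 := by
          intro h0
          have hev : IsSumSq (eval 0 h) := by
            simpa using hh.map_ringHom (evalRingHom (0 : K))
          apply hneg
          have := congrArg (eval 0) h0
          simp only [mul_one, eval_add, eval_one, eval_zero] at this
          rwa [show (-1 : K) = eval 0 h by linear_combination -this]
        have hev := ((IsSumSq.sq_add 1 hh).polynomial_even_natDegree hK).resolve_left hne
        have hr0 : r ≠ 0 := by
          rintro rfl
          exact hne (by rw [hr, mul_zero])
        have hdr := hev.1
        have hle := natDegree_add_le (1 * 1) h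
        rw [hr, natDegree_mul hq0 hr0] at hle hdr
        have hrodd : Odd r.natDegree := by
          rcases Nat.even_or_odd r.natDegree with he | ho
          · exact absurd hdr (Nat.not_even_iff_odd.2 (hq.add_even he))
          · exact ho
        have : natDegree (1 * 1 : K[X]) = 0 := by simp
        obtain ⟨x, hx⟩ := ih r.natDegree (by omega) r hrodd rfl
        exfalso
        have h0 := congrArg (eval x) hr
        rw [eval_mul, hx, mul_zero, eval_add, eval_mul, eval_one] at h0
        apply hneg
        rw [show (-1 : K) = eval x h by linear_combination -h0]
        simpa using hh.map_ringHom (evalRingHom x)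
    · have hnu : ¬ IsUnit q := fun hu => by
        rw [natDegree_eq_zero_of_isUnit hu] at hq
        exact absurd hq (by decide)
      rw [irreducible_iff] at hirr
      push Not at hirr
      obtain ⟨a, b, hab, ha, hb⟩ := hirr hnu
      subst hab
      have ha0 := left_ne_zero_of_mul hq0
      have hb0 := right_ne_zero_of_mul hq0
      have hda := (natDegree_pos_iff_degree_pos.2 (degree_pos_of_ne_zero_of_nonunit ha0 ha))
      have hdb := (natDegree_pos_iff_degree_pos.2 (degree_pos_of_ne_zero_of_nonunit hb0 hb))
      rw [natDegree_mul ha0 hb0] at hq ih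
      rcases Nat.even_or_odd a.natDegree with he | ho
      · have hbo : Odd b.natDegree := by
          by_contra hc
          exact (Nat.not_even_iff_odd.2 hq) (he.add (Nat.not_odd_iff_even.1 hc))
        obtain ⟨x, hx⟩ := ih _ (by omega) b hbo rfl
        exact ⟨x, by simp [hx]⟩
      · obtain ⟨x, hx⟩ := ih _ (by omega) a ho rfl
        exact ⟨x, by simp [hx]⟩

theorem exists_eval_eq_zero_of_isSquare_discrim {F : Type*} [Field F] [NeZero (2 : F)] {p : F[X]}
    (hp : p.natDegree = 2)
    (h : IsSquare (discrim (p.coeff 2) (p.coeff 1) (p.coeff 0))) : ∃ x, p.eval x = 0 := by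
  have h2 : p.coeff 2 ≠ 0 := by
    rw [← hp]
    exact leadingCoeff_ne_zero.2 (by rintro rfl; simp at hp)
  obtain ⟨x, hx⟩ := exists_quadratic_eq_zero h2 h
  refine ⟨x, ?_⟩
  rw [eval_eq_sum_range, hp]
  simp only [Finset.sum_range_succ, Finset.sum_range_zero]
  linear_combination hx

/-- If every element of `N` is a square, `N` has no proper quadratic extensions. -/
theorem natDegree_le_one_of_forall_isSquare {N : Type*} [Field N] [NeZero (2 : N)]
    (hN : ∀ x : N, IsSquare x) {p : N[X]} (hp : Irreducible p) (hd : p.natDegree ≤ 2) :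
    p.natDegree ≤ 1 := by
  by_contra h
  obtain ⟨x, hx⟩ := exists_eval_eq_zero_of_isSquare_discrim (p := p) (by omega) (hN _)
  have : p.natDegree = 1 := natDegree_eq_of_degree_eq_some (degree_eq_one_of_irreducible_of_root hp hx)
  omega

namespace IsRealClosedField

variable {F : Type u} [Field F]

theorem exists_sq_eq_add_sq (hF : IsRealClosedField F) (a b : F) : ∃ c, c ^ 2 = a ^ 2 + b ^ 2 := by
  obtain h | ⟨y, hy⟩ := hF.2.1 (a ^ 2 + b ^ 2)
  · exact h
  · have h3 := hF.1 3 ![a, b, y] (by simp [Fin.sum_univ_succ, hy])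
    have ha : a = 0 := h3 0
    have hb : b = 0 := h3 1
    exact ⟨0, by simp [ha, hb]⟩

theorem charZero (hF : IsRealClosedField F) : CharZero F :=
  have : IsSemireal F := .of_not_isSumSq_neg_one (isRealRing_iff_not_isSumSq_neg_one.1 hF.1)
  inferInstance

/-- Over a real closed field every `a + b * i` has a square root of the same form. -/
theorem exists_sq_add_mul_eq (hF : IsRealClosedField F) {E : Type*} [Field E] [Algebra F E] {i : E}
    (hi : i ^ 2 = -1) (a b : F) : ∃ c d : F,
      (algebraMap F E c + algebraMap F E d * i) ^ 2 = algebraMap F E a + algebraMap F E b * i := by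
  have := hF.charZero
  by_cases hb : b = 0
  · subst hb
    obtain ⟨y, hy⟩ | ⟨y, hy⟩ := hF.2.1 a
    · exact ⟨y, 0, by simp [← hy]⟩
    · refine ⟨0, y, ?_⟩
      have hy' := congrArg (algebraMap F E) hy
      simp only [map_pow, map_neg, map_zero] at hy' ⊢
      linear_combination (algebraMap F E y) ^ 2 * hi - hy'
  have key : ∃ s c : F, s ^ 2 = a ^ 2 + b ^ 2 ∧ 2 * c ^ 2 = a + s ∧ c ≠ 0 := by
    obtain ⟨s, hs⟩ := hF.exists_sq_eq_add_sq a b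
    have hmul : (a + s) * (a - s) = - b ^ 2 := by linear_combination -hs
    have hne : a + s ≠ 0 := by
      intro h
      rw [h, zero_mul] at hmul
      exact hb (by simpa using hmul.symm)
    obtain ⟨y, hy⟩ | ⟨y, hy⟩ := hF.2.1 ((a + s) / 2)
    · refine ⟨s, y, hs, by rw [hy]; ring, ?_⟩
      rintro rfl
      apply hne
      linear_combination -2 * hy
    · have hy0 : y ≠ 0 := by
        rintro rfl
        apply hne
        linear_combination 2 * hy
      refine ⟨-s, b / (2 * y), by rw [neg_sq, hs], ?_, div_ne_zero hb (mul_ne_zero two_ne_zero hy0)⟩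
      field_simp
      linear_combination hmul - 2 * (a - s) * hy
  obtain ⟨s, c, hs, hc, hc0⟩ := key
  refine ⟨c, b / (2 * c), ?_⟩
  have h1 : c ^ 2 - (b / (2 * c)) ^ 2 = a := by
    have h4 : b ^ 2 = (s - a) * (2 * c ^ 2) := by rw [hc]; linear_combination -hs
    field_simp
    linear_combination 2 * c ^ 2 * hc - h4
  have h2 : 2 * c * (b / (2 * c)) = b := by field_simp
  have h3 : algebraMap F E b = 2 * algebraMap F E c * algebraMap F E (b / (2 * c)) := by
    rw [← map_ofNat (algebraMap F E) 2, ← map_mul, ← map_mul, h2]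
  rw [← h1, h3]
  simp only [map_sub, map_pow]
  linear_combination (algebraMap F E (b / (2 * c))) ^ 2 * hi

theorem exists_eq_add_mul_of_mem_adjoin {E : Type*} [Field E] [Algebra F E] {i : E}
    (hi : i ^ 2 = -1) {x : E} (hx : x ∈ IntermediateField.adjoin F {i}) :
    ∃ a b : F, x = algebraMap F E a + algebraMap F E b * i := by
  have hint : IsIntegral F i := ⟨X ^ 2 + 1, by monicity!, by simp [hi]⟩
  rw [← IntermediateField.mem_toSubalgebra,
    IntermediateField.adjoin_simple_toSubalgebra_of_isAlgebraic hint.isAlgebraic] at hx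
  induction hx using Algebra.adjoin_induction with
  | mem x hx =>
    obtain rfl := Set.mem_singleton_iff.1 hx
    exact ⟨0, 1, by simp⟩
  | algebraMap r => exact ⟨r, 0, by simp⟩
  | add x y _ _ hx hy =>
    obtain ⟨a, b, rfl⟩ := hx
    obtain ⟨c, d, rfl⟩ := hy
    exact ⟨a + c, b + d, by simp only [map_add]; ring⟩
  | mul x y _ _ hx hy =>
    obtain ⟨a, b, rfl⟩ := hx
    obtain ⟨c, d, rfl⟩ := hy
    refine ⟨a * c - b * d, a * d + b * c, ?_⟩
    simp only [map_add, map_sub, map_mul]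
    linear_combination (algebraMap F E b * algebraMap F E d) * hi

theorem isSquare_adjoin (hF : IsRealClosedField F) {E : Type*} [Field E] [Algebra F E] {i : E}
    (hi : i ^ 2 = -1) (x : IntermediateField.adjoin F {i}) : IsSquare x := by
  obtain ⟨a, b, hab⟩ := exists_eq_add_mul_of_mem_adjoin hi x.2
  obtain ⟨c, d, hcd⟩ := hF.exists_sq_add_mul_eq hi a b
  have hmem : algebraMap F E c + algebraMap F E d * i ∈ IntermediateField.adjoin F {i} :=
    add_mem (IntermediateField.algebraMap_mem _ _)
      (mul_mem (IntermediateField.algebraMap_mem _ _)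
        (IntermediateField.mem_adjoin_simple_self F i))
  refine ⟨⟨_, hmem⟩, Subtype.ext ?_⟩
  rw [hab, ← hcd, pow_two]
  rfl

/-- A finite extension of odd degree of a real closed field is trivial. -/
theorem finrank_eq_one_of_odd (hF : IsRealClosedField F) {E : Type*} [Field E] [Algebra F E]
    [FiniteDimensional F E] (hodd : Odd (Module.finrank F E)) : Module.finrank F E = 1 := by
  have := hF.charZero
  obtain ⟨β, hβ⟩ := Field.exists_primitive_element F E
  have hint : IsIntegral F β := .of_finite F β
  have hdeg : (minpoly F β).natDegree = Module.finrank F E := by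
    rw [← IntermediateField.adjoin.finrank hint, hβ, IntermediateField.finrank_top']
  rw [← hdeg] at hodd ⊢
  obtain ⟨x, hx⟩ := hF.2.2 _ hodd
  exact natDegree_eq_of_degree_eq_some
    (degree_eq_one_of_irreducible_of_root (minpoly.irreducible hint) hx)

/-- A finite Galois extension of a real closed field containing a square root `i` of `-1` is
generated by `i`. -/
theorem adjoin_eq_top (hF : IsRealClosedField F) {E : Type*} [Field E] [Algebra F E]
    [FiniteDimensional F E] [IsGalois F E] {i : E} (hi : i ^ 2 = -1) :
    IntermediateField.adjoin F {i} = ⊤ := by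
  have := hF.charZero
  have : Fact (Nat.Prime 2) := ⟨Nat.prime_two⟩
  set N := IntermediateField.adjoin F {i} with hN
  have h2 : IsPGroup 2 Gal(E/F) := by
    obtain ⟨S⟩ := (inferInstance : Nonempty (Sylow 2 Gal(E/F)))
    have hodd : Odd (S : Subgroup Gal(E/F)).index := by
      rw [← Nat.not_even_iff_odd, even_iff_two_dvd]
      exact S.not_dvd_index
    have hfin : Module.finrank F (IntermediateField.fixedField (S : Subgroup Gal(E/F))) =
        (S : Subgroup Gal(E/F)).index := by
      rw [IntermediateField.finrank_eq_fixingSubgroup_index,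
        IntermediateField.fixingSubgroup_fixedField]
    have h1 := hF.finrank_eq_one_of_odd (by rwa [hfin])
    rw [hfin, Subgroup.index_eq_one] at h1
    exact S.isPGroup'.of_surjective (S : Subgroup Gal(E/F)).subtype
      fun σ => ⟨⟨σ, by rw [h1]; trivial⟩, rfl⟩
  have hcard : Nat.card N.fixingSubgroup = Module.finrank N E :=
    IsGalois.card_fixingSubgroup_eq_finrank N
  obtain ⟨k, hk⟩ := (h2.to_subgroup N.fixingSubgroup).exists_card_eq
  rcases k with _ | k
  · rw [pow_zero] at hk
    have hbot : N.fixingSubgroup = ⊥ := Subgroup.card_eq_one.1 hk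
    rw [← IsGalois.fixedField_fixingSubgroup N, hbot, IntermediateField.fixedField_bot]
  exfalso
  obtain ⟨H', hH', hle⟩ : ∃ H' : Subgroup Gal(E/F), Nat.card H' = 2 ^ k ∧
      H' ≤ N.fixingSubgroup := by
    obtain ⟨H, hH⟩ := Sylow.exists_subgroup_card_pow_prime (G := N.fixingSubgroup) 2 (n := k)
      (by rw [hk]; exact pow_dvd_pow 2 k.le_succ)
    refine ⟨H.map N.fixingSubgroup.subtype, ?_, Subgroup.map_subtype_le H⟩
    rw [← hH]
    exact Subgroup.card_map_of_injective N.fixingSubgroup.subtype_injective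
  have hNM : N ≤ IntermediateField.fixedField H' := (IntermediateField.le_iff_le _ _).2 hle
  set M := IntermediateField.extendScalars hNM with hM
  have hME : Module.finrank M E = 2 ^ k := by
    rw [← hH']
    exact IntermediateField.finrank_fixedField_eq_card H'
  have hNM2 : Module.finrank N M = 2 := by
    have := Module.finrank_mul_finrank N M E
    rw [hME, ← hcard, hk, pow_succ, mul_comm] at this
    exact Nat.eq_of_mul_eq_mul_left (by positivity) this
  have hNM1 : Module.finrank N M = 1 := by
    obtain ⟨β, hβ⟩ := Field.exists_primitive_element N M
    have hint : IsIntegral N β := .of_finite N β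
    have hdeg : (minpoly N β).natDegree = Module.finrank N M := by
      rw [← IntermediateField.adjoin.finrank hint, hβ, IntermediateField.finrank_top']
    rw [← hdeg]
    exact le_antisymm (natDegree_le_one_of_forall_isSquare (isSquare_adjoin hF hi)
      (minpoly.irreducible hint) (by rw [hdeg, hNM2])) (minpoly.natDegree_pos hint)
  omega

/-- A real closed field has no proper real algebraic extension. -/
theorem algebraMap_surjective (hF : IsRealClosedField F) {L : Type*} [Field L] [Algebra F L]
    [Algebra.IsAlgebraic F L] (hL : IsRealRing L) : Function.Surjective (algebraMap F L) := by
  intro α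
  have := hF.charZero
  have hint : IsIntegral F α := Algebra.IsIntegral.isIntegral α
  have hirr := minpoly.irreducible hint
  have hdeg : (minpoly F α).natDegree ≤ 2 := by
    set p := minpoly F α * (X ^ 2 + 1) with hp
    have hX : (X ^ 2 + 1 : F[X]) ≠ 0 := (by monicity! : (X ^ 2 + 1 : F[X]).Monic).ne_zero
    have hdX : (X ^ 2 + 1 : F[X]).natDegree = 2 := by compute_degree!
    have hsplit := SplittingField.splits p
    have : IsGalois F p.SplittingField := ⟨⟩
    conv at hsplit =>
      rw [hp, Polynomial.map_mul]
    obtain ⟨hs1, hs2⟩ := (splits_mul (map_ne_zero hirr.ne_zero) (map_ne_zero hX)).1 hsplit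
    obtain ⟨i, hi⟩ : ∃ i : p.SplittingField, i ^ 2 = -1 := by
      obtain ⟨i, hi⟩ := hs2.exists_eval_eq_zero (by
        rw [degree_map, degree_eq_natDegree hX, hdX]
        decide)
      exact ⟨i, by simpa [eq_neg_iff_add_eq_zero] using hi⟩
    obtain ⟨β, hβ⟩ : ∃ β : p.SplittingField, aeval β (minpoly F α) = 0 := by
      obtain ⟨β, hβ⟩ := hs1.exists_eval_eq_zero (by
        rw [degree_map]
        exact (minpoly.degree_pos hint).ne')
      exact ⟨β, by rwa [eval_map_algebraMap] at hβ⟩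
    have hm : minpoly F β = minpoly F α :=
      (minpoly.eq_of_irreducible_of_monic hirr hβ (minpoly.monic hint)).symm
    have hintβ : IsIntegral F β := .of_finite F β
    have htop := hF.adjoin_eq_top hi
    have hinti : IsIntegral F i := .of_finite F i
    have hfin : Module.finrank F p.SplittingField ≤ 2 := by
      rw [← IntermediateField.finrank_top', ← htop, IntermediateField.adjoin.finrank hinti]
      rw [← hdX]
      exact natDegree_le_of_dvd (minpoly.dvd F i (by simp [hi])) hX
    rw [← hm]
    exact (minpoly.natDegree_le β).trans hfin
  have hroot : ∃ x, (minpoly F α).eval x = 0 := by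
    have hpos := minpoly.natDegree_pos hint
    rcases Nat.lt_or_ge (minpoly F α).natDegree 2 with hlt | hge
    · exact hF.2.2 _ (by rw [show (minpoly F α).natDegree = 1 by omega]; exact odd_one)
    have hd : (minpoly F α).natDegree = 2 := le_antisymm hdeg hge
    have hα : algebraMap F L ((minpoly F α).coeff 0) +
        algebraMap F L ((minpoly F α).coeff 1) * α + α ^ 2 = 0 := by
      have h0 := minpoly.aeval F α
      rw [aeval_eq_sum_range, hd] at h0
      have h1 : (minpoly F α).coeff 2 = 1 := by rw [← hd]; exact minpoly.monic hint
      simpa [Finset.sum_range_succ, Algebra.smul_def, h1] using h0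
    set b := (minpoly F α).coeff 1
    set c := (minpoly F α).coeff 0
    have hdisc : (2 * α + algebraMap F L b) ^ 2 = algebraMap F L (b ^ 2 - 4 * c) := by
      simp only [map_sub, map_mul, map_pow, map_ofNat]
      linear_combination 4 * hα
    obtain ⟨e, he⟩ | ⟨e, he⟩ := hF.2.1 (b ^ 2 - 4 * c)
    · refine exists_eval_eq_zero_of_isSquare_discrim hd ⟨e, ?_⟩
      have h1 : (minpoly F α).coeff 2 = 1 := by rw [← hd]; exact minpoly.monic hint
      rw [discrim, h1]
      linear_combination -he
    · have h2 := hL 2 ![2 * α + algebraMap F L b, algebraMap F L e] (by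
        simp [Fin.sum_univ_succ, hdisc, ← map_pow, he]) 0
      have h2' : 2 * α + algebraMap F L b = 0 := h2
      have : CharZero L := charZero_of_injective_algebraMap (algebraMap F L).injective
      have hαb : α = algebraMap F L (-b / 2) := by
        rw [map_div₀, map_neg, map_ofNat, eq_div_iff two_ne_zero]
        linear_combination h2'
      refine ⟨-b / 2, (algebraMap F L).injective ?_⟩
      rw [map_zero, ← aeval_algebraMap_apply_eq_algebraMap_eval, ← hαb, minpoly.aeval]
  obtain ⟨x, hx⟩ := hroot
  have h1 := degree_eq_one_of_irreducible_of_root hirr hx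
  exact minpoly.mem_range_of_degree_eq_one F α h1

end IsRealClosedField

/-- An injective integral ring homomorphism into a domain is an essential extension. -/
theorem RingHom.IsIntegral.isEssentialExtension {A B : Type*} [CommRing A] [CommRing B] [IsDomain B]
    {f : A →+* B} (hint : f.IsIntegral) (hf : Function.Injective f) : IsEssentialExtension f := by
  refine ⟨hf, fun J hJ => ?_⟩
  obtain ⟨x, hxJ, hx0⟩ := Submodule.exists_mem_ne_zero_of_ne_bot hJ
  have : Nontrivial A := f.domain_nontrivial
  let _ := f.toAlgebra
  obtain ⟨a, ha, ha0⟩ := Submodule.exists_mem_ne_zero_of_ne_bot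
    (Ideal.comap_ne_bot_of_integral_mem (R := A) hx0 hxJ (hint x))
  exact ⟨a, ha, (map_ne_zero_iff f hf).2 ha0⟩

namespace IsRealClosedStar

variable {B : Type u} [CommRing B]

/-- A real closed * ring is integrally closed in every real extension field. -/
theorem exists_eq_of_isIntegral (hB : IsRealClosedStar B) {L : Type u} [Field L] [Algebra B L]
    [FaithfulSMul B L] (hL : IsRealRing L) {x : L} (hx : IsIntegral B x) :
    ∃ b, algebraMap B L b = x := by
  have hinj := FaithfulSMul.algebraMap_injective B L
  let f := algebraMap B (integralClosure B L)
  have hf : Function.Injective f := by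
    refine Function.Injective.of_comp (f := (integralClosure B L).val) ?_
    exact hinj
  have hint : f.IsIntegral := algebraMap_isIntegral_iff.2 inferInstance
  obtain ⟨b, hb⟩ := hB.2 (integralClosure B L) f
    (hL.of_injective (integralClosure B L).val.toRingHom Subtype.val_injective)
    (hint.isEssentialExtension hf) hint ⟨x, hx⟩
  exact ⟨b, congrArg Subtype.val hb⟩

/-- The fraction field of a real closed * domain is real closed. -/
theorem isRealClosedField [IsDomain B] (hB : IsRealClosedStar B) {K : Type u} [Field K] [Algebra B K]
    [IsFractionRing B K] : IsRealClosedField K := by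
  refine .of_forall_adjoinRoot hB.1.isFractionRing fun p hp hL => ?_
  have : Fact (Irreducible p) := ⟨hp⟩
  have : FiniteDimensional K (AdjoinRoot p) := (AdjoinRoot.powerBasis hp.ne_zero).finite
  have : FaithfulSMul B (AdjoinRoot p) := by
    rw [faithfulSMul_iff_algebraMap_injective, IsScalarTower.algebraMap_eq B K (AdjoinRoot p)]
    exact (algebraMap K (AdjoinRoot p)).injective.comp (IsFractionRing.injective B K)
  have halg : Algebra.IsAlgebraic B (AdjoinRoot p) :=
    (IsFractionRing.comap_isAlgebraic_iff (K := K)).2 inferInstance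
  obtain ⟨b, hb0, hb⟩ := (halg.isAlgebraic (AdjoinRoot.root p)).exists_integral_multiple
  obtain ⟨c, hc⟩ := hB.exists_eq_of_isIntegral hL hb
  have hroot : AdjoinRoot.root p = AdjoinRoot.of p (algebraMap B K c / algebraMap B K b) := by
    have hb' : algebraMap B (AdjoinRoot p) b ≠ 0 := by simpa using hb0
    rw [Algebra.smul_def] at hc
    rw [map_div₀, eq_div_iff (by simpa using hb0), mul_comm]
    exact hc.symm
  have hx : eval (algebraMap B K c / algebraMap B K b) p = 0 := by
    have := AdjoinRoot.eval₂_root p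
    rw [hroot, eval₂_at_apply] at this
    exact (map_eq_zero _).1 this
  exact (natDegree_eq_of_degree_eq_some (degree_eq_one_of_irreducible_of_root hp hx)).le

end IsRealClosedStar

theorem IsRealClosureStarOf.nonempty_witness {A : Type u} [CommRing A] [IsDomain A] {P : Set A}
    {B : Type u} [CommRing B] {Q : Set B} {f : A →+* B} (h : IsRealClosureStarOf A P B Q f) :
    Nonempty (IntegralClosureInRCFWitness A P B Q f) := by
  have hdom := h.essential.isDomain
  let K := FractionRing B
  have hinj : Function.Injective (algebraMap B K) := IsFractionRing.injective B K
  have hK : IsRealClosedField K := h.rcs.isRealClosedField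
  have hsq : ∀ b : B, (∃ y : K, y ^ 2 = algebraMap B K b) → b ∈ Q := by
    rintro b ⟨y, hy⟩
    obtain ⟨c, rfl⟩ := h.rcs.exists_eq_of_isIntegral hK.1 (x := y)
      (.of_pow two_pos (by rw [hy]; exact isIntegral_algebraMap))
    rw [← map_pow] at hy
    rw [← hinj hy]
    exact h.pos_partial.2.2.1 c
  have hQ : ∀ b : B, b ∈ Q ↔ ∃ y : K, y ^ 2 = algebraMap B K b := by
    refine fun b => ⟨fun hb => ?_, hsq b⟩
    obtain hy | ⟨y, hy⟩ := hK.2.1 (algebraMap B K b)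
    · exact hy
    · have h0 := h.pos_partial.2.2.2 b hb (hsq (-b) ⟨y, by rw [hy, map_neg]⟩)
      exact ⟨0, by simp [h0]⟩
  have hcomp : Function.Injective ((algebraMap B K).comp f) := hinj.comp h.essential.1
  refine ⟨{
    K := K
    g := algebraMap B K
    inj := hinj
    injA := hcomp
    rcf := hK
    alg := ?_
    ordext := fun a ha => (hQ _).1 (h.mono a ha)
    range_ic := ?_
    posQ := hQ }⟩
  · intro x
    let _ := f.toAlgebra
    have : Algebra.IsIntegral A B := ⟨h.integral⟩
    have : Algebra.IsAlgebraic B K := IsLocalization.isAlgebraic _ (nonZeroDivisors B)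
    have halg : Algebra.IsAlgebraic A K := .trans A B K
    obtain ⟨q, hq0, hq⟩ := halg.isAlgebraic x
    exact ⟨q, by rwa [aeval_def, IsScalarTower.algebraMap_eq A B K] at hq, (Polynomial.map_ne_zero_iff hcomp).2 hq0⟩
  · ext x
    constructor
    · rintro ⟨b, rfl⟩
      exact (h.integral b).map (algebraMap B K)
    · intro hx
      exact h.rcs.exists_eq_of_isIntegral hK.1 (RingHom.IsIntegralElem.of_comp hx)

theorem IntegralClosureInRCFWitness.isRealClosureStarOf {A : Type u} [CommRing A] {P : Set A}
    {B : Type u} [CommRing B] {Q : Set B} {f : A →+* B}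
    (W : IntegralClosureInRCFWitness A P B Q f) : IsRealClosureStarOf A P B Q f := by
  obtain ⟨K, g, hg, hgf, hK, halg, hord, hrange, hQ⟩ := W
  have hdom : IsDomain B := hg.isDomain g
  have hint : f.IsIntegral := fun b => by
    have hb : g b ∈ Set.range g := ⟨b, rfl⟩
    rw [hrange] at hb
    obtain ⟨p, hp, hpb⟩ := hb
    refine ⟨p, hp, hg ?_⟩
    rw [map_zero, hom_eval₂, hpb]
  refine ⟨⟨?_, ?_, ?_, ?_⟩, ⟨hK.1.of_injective g hg, ?_⟩,
    hint.isEssentialExtension (Function.Injective.of_comp (f := g) hgf), hint, fun a ha => (hQ _).2 (hord a ha)⟩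
  · intro a ha b hb
    rw [hQ] at ha hb ⊢
    obtain ⟨x, hx⟩ := ha
    obtain ⟨y, hy⟩ := hb
    obtain ⟨z, hz⟩ := hK.exists_sq_eq_add_sq x y
    exact ⟨z, by rw [hz, hx, hy, map_add]⟩
  · intro a ha b hb
    rw [hQ] at ha hb ⊢
    obtain ⟨x, hx⟩ := ha
    obtain ⟨y, hy⟩ := hb
    exact ⟨x * y, by rw [mul_pow, hx, hy, map_mul]⟩
  · exact fun a => (hQ _).2 ⟨g a, (map_pow g a 2).symm⟩
  · intro a ha hna
    rw [hQ] at ha hna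
    obtain ⟨x, hx⟩ := ha
    obtain ⟨y, hy⟩ := hna
    have h0 : x = 0 := hK.1 2 ![x, y] (by simp [Fin.sum_univ_succ, hx, hy]) 0
    apply hg
    rw [← hx, h0, map_zero]
    simp
  · intro C _ h hC hess hhint
    have hCdom := hess.isDomain
    let L := FractionRing C
    have hL : IsRealRing L := hC.isFractionRing (K := L)
    have hCL : Function.Injective (algebraMap C L) := IsFractionRing.injective C L
    let _ : Algebra B K := g.toAlgebra
    have hfrac : IsFractionRing B K := by
      let _ := f.toAlgebra
      let _ : Algebra A K := (g.comp f).toAlgebra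
      have : IsScalarTower A B K := .of_algebraMap_eq fun _ => rfl
      have : IsIntegralClosure B A K := ⟨hg, fun {x} => by
        have := Set.ext_iff.1 hrange x
        exact this.symm⟩
      have hdomA : IsDomain A := hgf.isDomain (g.comp f)
      have : Algebra.IsAlgebraic A K := ⟨fun x => by
        obtain ⟨q, hq, hq0⟩ := halg x
        exact ⟨q, fun h0 => hq0 (by rw [h0, Polynomial.map_zero]), hq⟩⟩
      exact IsIntegralClosure.isFractionRing_of_algebraic A B
        fun x hx => hgf (by rw [map_zero]; exact hx)
    have hBL : Function.Injective ((algebraMap C L).comp h) := hCL.comp hess.1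
    let φ : K →+* L := IsFractionRing.lift hBL
    have hφ : ∀ b, φ (g b) = algebraMap C L (h b) := fun b => IsFractionRing.lift_algebraMap hBL b
    let _ : Algebra K L := φ.toAlgebra
    let _ : Algebra B C := h.toAlgebra
    have : IsScalarTower B K L := .of_algebraMap_eq fun b => by
      rw [IsScalarTower.algebraMap_apply B C L]
      exact (hφ b).symm
    have : Algebra.IsIntegral B C := ⟨hhint⟩
    have : Algebra.IsAlgebraic C L := IsLocalization.isAlgebraic _ (nonZeroDivisors C)
    have : Algebra.IsAlgebraic B L := .trans B C L
    have : Algebra.IsAlgebraic K L := (IsFractionRing.comap_isAlgebraic_iff (A := B)).1 this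
    intro c
    obtain ⟨k, hk⟩ := hK.algebraMap_surjective hL (algebraMap C L c)
    have hk' : (g.comp f).IsIntegralElem k := by
      obtain ⟨p, hp, hpc⟩ := (hint.trans f h hhint) c
      refine ⟨p, hp, φ.injective ?_⟩
      have hcomp : φ.comp (g.comp f) = (algebraMap C L).comp (h.comp f) :=
        RingHom.ext fun a => hφ (f a)
      rw [map_zero, hom_eval₂, hcomp, show φ k = _ from hk, ← hom_eval₂, hpc, map_zero]
    have hmem : k ∈ Set.range g := by
      rw [hrange]
      exact hk'
    obtain ⟨b, rfl⟩ := hmem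
    exact ⟨b, hCL ((hφ b).symm.trans hk)⟩

/-- For a real integral domain `A` with partial ordering `P`, the poring
`(B, Q)` with embedding `f : A →+* B` is a real closure * of `A` iff `B` is the integral
closure of `A` in some real closed field `K` algebraic over `Frac A` whose ordering
extends the induced partial ordering of `Frac A`, with `Q = B ∩ K⁺`. -/
theorem isRealClosureStarOf_iff_integralClosure_in_realClosedField
    (A : Type u) [CommRing A] [IsDomain A] (P : Set A)
    (hP : IsPartialOrdering P) (hreal : IsRealRing A)
    (B : Type u) [CommRing B] (Q : Set B) (f : A →+* B) :
    IsRealClosureStarOf A P B Q f ↔ Nonempty (IntegralClosureInRCFWitness A P B Q f) := by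
  exact ⟨fun h => h.nonempty_witness, fun ⟨W⟩ => W.isRealClosureStarOf⟩
end

section
/- Let A be a real von Neumann regular poring and let B be an essential extension of A (as porings, so A⁺ ⊆ B⁺) which is a von Neumann regular real closed * ring. Then the integral closure of A in B, equipped with the partial ordering induced from B, is a real closure * of A. -/
universe u

section RealClosure

open Polynomial

theorem exists_irreducible_dvd_of_odd_natDegree {F : Type*} [Field F] (f : F[X])
    (hf : Odd f.natDegree) : ∃ q : F[X], Irreducible q ∧ q ∣ f ∧ Odd q.natDegree := by
  induction hn : f.natDegree using Nat.strong_induction_on generalizing f with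
  | _ n ih =>
    subst hn
    by_cases hirr : Irreducible f
    · exact ⟨f, hirr, dvd_rfl, hf⟩
    have hf0 : f ≠ 0 := by rintro rfl; simp at hf
    have hu : ¬ IsUnit f := fun h ↦ by simp [natDegree_eq_zero_of_isUnit h] at hf
    obtain ⟨a, b, hab, ha, hb⟩ : ∃ a b, f = a * b ∧ ¬ IsUnit a ∧ ¬ IsUnit b := by
      simpa [irreducible_iff, hu] using hirr
    have ha0 : a ≠ 0 := by rintro rfl; simp at hab; exact hf0 hab
    have hb0 : b ≠ 0 := by rintro rfl; simp at hab; exact hf0 hab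
    have hdeg : f.natDegree = a.natDegree + b.natDegree := by rw [hab, natDegree_mul ha0 hb0]
    have hda : a.natDegree ≠ 0 := fun h ↦
      ha (isUnit_iff_degree_eq_zero.2 (by rw [degree_eq_natDegree ha0, h]; rfl))
    have hdb : b.natDegree ≠ 0 := fun h ↦
      hb (isUnit_iff_degree_eq_zero.2 (by rw [degree_eq_natDegree hb0, h]; rfl))
    rcases Nat.even_or_odd a.natDegree with h | h
    · have h' : Odd b.natDegree := by rw [hdeg] at hf; grind
      obtain ⟨q, h1, h2, h3⟩ := ih _ (by omega) b h' rfl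
      exact ⟨q, h1, hab ▸ h2.mul_left a, h3⟩
    · obtain ⟨q, h1, h2, h3⟩ := ih _ (by omega) a h rfl
      exact ⟨q, h1, hab ▸ h2.mul_right b, h3⟩

theorem IsSumSq.map_ringHom_s5 {R S : Type*} [NonAssocSemiring R] [NonAssocSemiring S] (f : R →+* S)
    {s : R} (hs : IsSumSq s) : IsSumSq (f s) := by
  induction hs with
  | zero => simp
  | sq_add a _ ih => simpa using IsSumSq.sq_add (f a) ih

theorem IsSumSq.inv_of_field {F : Type*} [Field F] {s : F} (hs : IsSumSq s) : IsSumSq s⁻¹ := by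
  have : s⁻¹ = s * (s⁻¹ * s⁻¹) := by
    by_cases h : s = 0
    · simp [h]
    · field_simp
  rw [this]
  exact hs.mul (.mul_self _)

theorem IsSemireal.eq_zero_of_add {F : Type*} [Field F] [IsSemireal F] {s t : F}
    (hs : IsSumSq s) (ht : IsSumSq t) (h : s + t = 0) : s = 0 := by
  by_contra h0
  refine IsSemireal.one_add_ne_zero (hs.inv_of_field.mul ht) ?_
  field_simp
  rw [h, mul_zero]

theorem IsSemireal.of_ringHom {R S : Type*} [Ring R] [Ring S] [IsSemireal S] (f : R →+* S) :
    IsSemireal R where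
  one_add_ne_zero hs h := IsSemireal.one_add_ne_zero (hs.map_ringHom_s5 f) (by
    rw [← map_one f, ← map_add, h, map_zero])

namespace Polynomial

variable {F : Type*} [Field F] [IsSemireal F]

theorem even_natDegree_of_isSumSq {s : F[X]} (hs : IsSumSq s) :
    Even s.natDegree ∧ IsSumSq s.leadingCoeff := by
  induction hs with
  | zero => simp
  | @sq_add a s hs ih =>
    obtain ⟨h1, h2⟩ := ih
    have ha : Even (a * a).natDegree ∧ IsSumSq (a * a).leadingCoeff := by
      by_cases h : a = 0
      · subst h; simp
      rw [natDegree_mul h h, leadingCoeff_mul]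
      exact ⟨⟨_, rfl⟩, .mul_self _⟩
    generalize a * a = b at ha
    obtain ⟨h3, h4⟩ := ha
    rcases lt_trichotomy b.degree s.degree with h | h | h
    · rw [natDegree_add_eq_right_of_degree_lt h, leadingCoeff_add_of_degree_lt h]
      exact ⟨h1, h2⟩
    · by_cases hb : b = 0
      · subst hb; simpa using ⟨h1, h2⟩
      have hne : b.leadingCoeff + s.leadingCoeff ≠ 0 := fun h0 ↦
        hb (leadingCoeff_eq_zero.1 (IsSemireal.eq_zero_of_add h4 h2 h0))
      rw [leadingCoeff_add_of_degree_eq h hne]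
      refine ⟨?_, h4.add h2⟩
      rwa [natDegree_eq_of_degree_eq ((degree_add_eq_of_leadingCoeff_add_ne_zero hne).trans
        (show _ = b.degree by rw [← h, max_self]))]
    · rw [natDegree_add_eq_left_of_degree_lt h, leadingCoeff_add_of_degree_lt' h]
      exact ⟨h3, h4⟩

/-- Reduce the summands of a sum of squares modulo `p`. -/
theorem exists_isSumSq_natDegree_lt {F : Type*} [Field F] {p : F[X]} (hp : 0 < p.natDegree)
    {s : F[X]} (hs : IsSumSq s) :
    ∃ t : F[X], IsSumSq t ∧ p ∣ s - t ∧ t.natDegree ≤ 2 * (p.natDegree - 1) := by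
  induction hs with
  | zero => exact ⟨0, .zero, by simp, by simp⟩
  | @sq_add a s hs ih =>
    obtain ⟨t, h1, h2, h3⟩ := ih
    refine ⟨(a % p) * (a % p) + t, .sq_add _ h1, ?_, ?_⟩
    · have h : p ∣ a - a % p := ⟨a / p, by linear_combination - EuclideanDomain.div_add_mod a p⟩
      have : a * a + s - (a % p * (a % p) + t) = (a - a % p) * (a + a % p) + (s - t) := by ring
      rw [this]
      exact (h.mul_right _).add h2
    · have h := natDegree_mod_lt a hp.ne'
      refine natDegree_add_le_of_degree_le (natDegree_mul_le.trans ?_) h3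
      omega

/-- Springer: a semireal field stays semireal after adjoining a root of an irreducible polynomial
of odd degree. -/
theorem not_dvd_one_add_of_isSumSq {p : F[X]} (hp : Irreducible p) (hodd : Odd p.natDegree)
    {s : F[X]} (hs : IsSumSq s) : ¬ p ∣ 1 + s := by
  induction hn : p.natDegree using Nat.strong_induction_on generalizing p s with
  | _ n ih =>
    subst hn
    intro hdvd
    have hpos : 0 < p.natDegree := hodd.pos
    obtain ⟨t, ht, hst, hdeg⟩ := exists_isSumSq_natDegree_lt hpos hs
    have hdvd' : p ∣ 1 + t := by
      have : 1 + t = (1 + s) - (s - t) := by ring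
      rw [this]; exact hdvd.sub hst
    obtain ⟨h, hh⟩ := hdvd'
    have ht_one : IsSumSq (1 + t) := IsSumSq.one.add ht
    have hne : 1 + t ≠ 0 := fun h0 ↦ by
      have := IsSemireal.one_add_ne_zero (ht.map_ringHom_s5 (evalRingHom (0 : F)))
      apply this
      simpa using congrArg (eval 0) h0
    have hh0 : h ≠ 0 := by rintro rfl; simp [hne] at hh
    have hd : (1 + t).natDegree = p.natDegree + h.natDegree := by
      rw [hh, natDegree_mul hp.ne_zero hh0]
    have heven := (even_natDegree_of_isSumSq ht_one).1
    have hle : (1 + t).natDegree ≤ 2 * (p.natDegree - 1) :=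
      natDegree_add_le_of_degree_le (by simp) hdeg
    have hhodd : Odd h.natDegree := by rw [hd] at heven; grind
    obtain ⟨q, hq, hqh, hqodd⟩ := exists_irreducible_dvd_of_odd_natDegree h hhodd
    have hql := natDegree_le_of_dvd hqh hh0
    exact ih _ (by omega) hq hqodd ht rfl (hh ▸ hqh.mul_left p)

end Polynomial

open IntermediateField in
theorem IntermediateField.exists_maximal_isSemireal (K : Type*) [Field K] [IsSemireal K]
    (L : Type*) [Field L] [Algebra K L] :
    ∃ F : IntermediateField K L, Maximal (fun E : IntermediateField K L ↦ IsSemireal E) F := by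
  refine zorn_le₀ {E : IntermediateField K L | IsSemireal E} fun c hc hchain ↦ ?_
  rcases c.eq_empty_or_nonempty with rfl | hne
  · refine ⟨⊥, ?_, by simp⟩
    have : IsSemireal (⊥ : IntermediateField K L) :=
      .of_ringHom (IntermediateField.botEquiv K L : _ →+* K)
    exact this
  refine ⟨sSup c, ?_, fun z hz ↦ le_sSup hz⟩
  have : Nonempty c := hne.to_subtype
  have hdir : Directed (· ≤ ·) (fun E : c ↦ (E : IntermediateField K L)) :=
    hchain.directed
  have hmem : ∀ x : L, x ∈ sSup c → ∃ E : c, x ∈ (E : IntermediateField K L) := by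
    intro x hx
    rw [sSup_eq_iSup', ← SetLike.mem_coe, IntermediateField.coe_iSup_of_directed hdir] at hx
    simpa using hx
  have key : ∀ s : (sSup c : IntermediateField K L), IsSumSq s →
      ∃ E : c, ∃ t : (E : IntermediateField K L), IsSumSq t ∧ (t : L) = s := by
    intro s hs
    induction hs with
    | zero => exact ⟨Classical.arbitrary c, 0, .zero, rfl⟩
    | sq_add a _ ih =>
      obtain ⟨E, t, ht, hts⟩ := ih
      obtain ⟨E', ha⟩ := hmem a a.2
      obtain ⟨E'', h1, h2⟩ := hdir E E'
      dsimp only at h1 h2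
      refine ⟨E'', ⟨a, h2 ha⟩ * ⟨a, h2 ha⟩ + inclusion h1 t, .sq_add _ ?_, ?_⟩
      · exact ht.map_ringHom_s5 (inclusion h1).toRingHom
      · simp [← hts]
  refine IsSemireal.of_not_isSumSq_neg_one fun h ↦ ?_
  obtain ⟨E, t, ht, hts⟩ := key _ h
  have : IsSemireal (E : IntermediateField K L) := hc E.2
  refine IsSemireal.not_isSumSq_neg_one (E : IntermediateField K L) ?_
  have h1 : t = -1 := Subtype.ext (hts.trans (by simp))
  rwa [h1] at ht

theorem IntermediateField.exists_isSumSq_aeval_eq_neg_one {K L : Type*} [Field K] [Field L]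
    [Algebra K L] [Algebra.IsAlgebraic K L] {F : IntermediateField K L}
    (hF : Maximal (fun E : IntermediateField K L ↦ IsSemireal E) F) {x : L} (hx : x ∉ F) :
    ∃ s : F[X], IsSumSq s ∧ aeval x s = -1 := by
  have hlt : ¬ (IntermediateField.restrictScalars K (adjoin F {x})) ≤ F := fun h ↦
    hx (h (mem_adjoin_simple_self F x))
  have hle : F ≤ IntermediateField.restrictScalars K (adjoin F {x}) := fun y hy ↦
    (adjoin F {x}).algebraMap_mem ⟨y, hy⟩
  have hn : ¬ IsSemireal (adjoin F {x}) := fun h ↦ hlt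
    (hF.2 (y := IntermediateField.restrictScalars K (adjoin F {x})) h hle)
  rw [isSemireal_iff_not_isSumSq_neg_one, not_not] at hn
  have hmem : ∀ y : adjoin F {x}, ∃ g : F[X], aeval x g = (y : L) := by
    intro y
    have : (y : L) ∈ (adjoin F {x}).toSubalgebra := y.2
    rwa [adjoin_simple_toSubalgebra_of_isAlgebraic (Algebra.IsAlgebraic.isAlgebraic x),
      Algebra.adjoin_singleton_eq_range_aeval] at this
  have key : ∀ y : adjoin F {x}, IsSumSq y → ∃ s : F[X], IsSumSq s ∧ aeval x s = (y : L) := by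
    intro y hy
    induction hy with
    | zero => exact ⟨0, .zero, by simp⟩
    | sq_add a _ ih =>
      obtain ⟨s, hs, h⟩ := ih
      obtain ⟨g, hg⟩ := hmem a
      exact ⟨g * g + s, .sq_add _ hs, by simp [hg, h]⟩
  simpa using key _ hn

theorem exists_aeval_eq_add_mul {F L : Type*} [Field F] [Field L] [Algebra F L] {x : F} {y : L}
    (hy : y * y = algebraMap F L x) (g : F[X]) :
    ∃ a b : F, aeval y g = algebraMap F L a + algebraMap F L b * y := by
  induction g using Polynomial.induction_on with
  | C a => exact ⟨a, 0, by simp⟩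
  | add p q hp hq =>
    obtain ⟨a, b, h⟩ := hp
    obtain ⟨c, d, h'⟩ := hq
    exact ⟨a + c, b + d, by simp [h, h']; ring⟩
  | monomial n a h =>
    obtain ⟨c, d, h⟩ := h
    refine ⟨d * x, c, ?_⟩
    rw [pow_succ, ← mul_assoc, map_mul, h, map_mul, aeval_X]
    linear_combination algebraMap F L d * hy

theorem exists_aeval_eq_of_isSumSq {F L : Type*} [Field F] [Field L] [Algebra F L] {x : F} {y : L}
    (hy : y * y = algebraMap F L x) {s : F[X]} (hs : IsSumSq s) :
    ∃ u v w : F, IsSumSq u ∧ IsSumSq v ∧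
      aeval y s = algebraMap F L (u + v * x) + algebraMap F L w * y := by
  induction hs with
  | zero => exact ⟨0, 0, 0, by simp⟩
  | sq_add g _ ih =>
    obtain ⟨u, v, w, hu, hv, h⟩ := ih
    obtain ⟨a, b, hg⟩ := exists_aeval_eq_add_mul hy g
    refine ⟨a * a + u, b * b + v, 2 * a * b + w, .sq_add _ hu, .sq_add _ hv, ?_⟩
    simp only [map_add, map_mul, h, hg, map_ofNat]
    linear_combination algebraMap F L b * algebraMap F L b * hy

/-- Every semireal field embeds into a real closed field. -/
theorem exists_isRealClosed_algebra (K : Type u) [Field K] [IsSemireal K] :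
    ∃ (R : Type u) (_ : Field R) (_ : Algebra K R), IsRealClosed R := by
  obtain ⟨F, hF⟩ := IntermediateField.exists_maximal_isSemireal K (AlgebraicClosure K)
  have : IsSemireal F := hF.1
  have neg_isSumSq : ∀ x : F, ¬ IsSquare x → IsSumSq (-x) := by
    intro x hx
    obtain ⟨y, hy⟩ := IsAlgClosed.exists_eq_mul_self (x : AlgebraicClosure K)
    have hyF : y ∉ F := fun h ↦ hx ⟨⟨y, h⟩, Subtype.ext hy⟩
    obtain ⟨s, hs, hs1⟩ := IntermediateField.exists_isSumSq_aeval_eq_neg_one hF hyF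
    obtain ⟨u, v, w, hu, hv, h⟩ := exists_aeval_eq_of_isSumSq (F := F) (x := x) hy.symm hs
    rw [hs1] at h
    have hw : w = 0 := by
      by_contra hw
      apply hyF
      have : y = ((-1 - (u + v * x)) / w : F) := by
        have hw' : (w : AlgebraicClosure K) ≠ 0 := by simpa using hw
        push_cast
        rw [eq_div_iff hw']
        have h' : (-1 : AlgebraicClosure K) = (u + v * x : F) + (w : AlgebraicClosure K) * y := h
        push_cast at h'
        linear_combination -h'
      rw [this]
      exact SetLike.coe_mem _
    have h2 : -1 = u + v * x := by
      apply (algebraMap F (AlgebraicClosure K)).injective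
      rw [map_neg, map_one, h, hw]; simp
    have hv0 : v ≠ 0 := by
      rintro rfl
      exact IsSemireal.not_isSumSq_neg_one F (by rw [h2]; simpa using hu)
    have : -x = (1 + u) * v⁻¹ := by
      rw [← div_eq_mul_inv, eq_div_iff hv0]
      linear_combination h2
    rw [this]
    exact (IsSumSq.one.add hu).mul hv.inv_of_field
  refine ⟨F, inferInstance, inferInstance,
    { isSquare_or_isSquare_neg := ?_, exists_isRoot_of_odd_natDegree := ?_ }⟩
  · intro x
    by_contra! h
    have h1 := neg_isSumSq _ h.1
    have h2 := neg_isSumSq _ h.2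
    refine h.2 ?_
    rw [IsSemireal.eq_zero_of_add h1 h2 (by ring)]
    exact IsSquare.zero
  · intro f hf
    obtain ⟨q, hq, hqf, hodd⟩ := exists_irreducible_dvd_of_odd_natDegree f hf
    obtain ⟨y, hy⟩ := IsAlgClosed.exists_aeval_eq_zero (AlgebraicClosure K) q
      (by rw [degree_eq_natDegree hq.ne_zero]; exact_mod_cast hodd.pos.ne')
    have hyF : y ∈ F := by
      by_contra hyF
      obtain ⟨s, hs, hs1⟩ := IntermediateField.exists_isSumSq_aeval_eq_neg_one hF hyF
      refine not_dvd_one_add_of_isSumSq hq hodd hs ?_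
      exact ((minpoly.irreducible (Algebra.IsIntegral.isIntegral y)).dvd_symm hq
        (minpoly.dvd F y hy)).trans (minpoly.dvd F y (by simp [hs1]))
    refine ⟨⟨y, hyF⟩, ?_⟩
    refine IsRoot.dvd ?_ hqf
    apply (algebraMap F (AlgebraicClosure K)).injective
    rw [← aeval_algebraMap_apply_eq_algebraMap_eval]
    simpa using hy

namespace IsRealClosed

open IntermediateField Module

variable {K : Type*} [Field K] [IsRealClosed K]

theorem isSquare_of_isSumSq {s : K} (hs : IsSumSq s) : IsSquare s := by
  rcases isSquare_or_isSquare_neg s with h | h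
  · exact h
  · rw [IsSemireal.eq_zero_of_add hs h.isSumSq (by ring)]
    exact IsSquare.zero

theorem exists_re_im_sq (a b : K) : ∃ u v : K, u * u - v * v = a ∧ 2 * u * v = b := by
  have h2 : (2 : K) ≠ 0 := two_ne_zero
  by_cases hb : b = 0
  · subst hb
    rcases isSquare_or_isSquare_neg a with ⟨r, hr⟩ | ⟨r, hr⟩
    · exact ⟨r, 0, by simp [hr], by simp⟩
    · exact ⟨0, r, by linear_combination hr, by simp⟩
  obtain ⟨c, hc⟩ := isSquare_of_isSumSq ((IsSumSq.mul_self a).add (.mul_self b))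
  rcases isSquare_or_isSquare_neg ((a + c) / 2) with ⟨u, hu⟩ | ⟨u, hu⟩
  · have hu0 : u ≠ 0 := by
      rintro rfl
      apply hb
      have hac : a = -c := by field_simp at hu; linear_combination hu
      simpa [hac] using hc
    refine ⟨u, b / (2 * u), ?_, by field_simp⟩
    field_simp at hu ⊢
    grobner
  · have hu0 : u ≠ 0 := by
      rintro rfl
      apply hb
      have hac : a = -c := by field_simp at hu; linear_combination -hu
      simpa [hac] using hc
    refine ⟨b / (2 * u), u, ?_, by field_simp⟩
    field_simp at hu ⊢
    grobner

theorem mem_bot_of_odd_natDegree_minpoly {M : Type*} [Field M] [Algebra K M] {x : M}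
    (hx : IsIntegral K x) (hodd : Odd (minpoly K x).natDegree) :
    x ∈ (⊥ : IntermediateField K M) := by
  obtain ⟨r, hr⟩ := exists_isRoot_of_odd_natDegree hodd
  have h1 := degree_eq_one_of_irreducible_of_root (minpoly.irreducible hx) hr
  exact IntermediateField.mem_bot.2 (minpoly.mem_range_of_degree_eq_one K x h1)

theorem exists_card_galois_eq_two_pow (M : Type*) [Field M] [Algebra K M] [FiniteDimensional K M]
    [IsGalois K M] : ∃ k, Nat.card Gal(M/K) = 2 ^ k := by
  let P : Sylow 2 Gal(M/K) := default
  have hodd : Odd (finrank K (fixedField (P : Subgroup Gal(M/K)))) := by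
    rw [finrank_eq_fixingSubgroup_index, fixingSubgroup_fixedField,
      ← Nat.not_even_iff_odd, even_iff_two_dvd]
    exact P.not_dvd_index
  have hbot : fixedField (P : Subgroup Gal(M/K)) = ⊥ := by
    refine eq_bot_iff.2 fun x hx ↦ mem_bot_of_odd_natDegree_minpoly (.of_finite K x) ?_
    have h := minpoly.degree_dvd (K := K) (x := (⟨x, hx⟩ : fixedField (P : Subgroup Gal(M/K))))
      (.of_finite K _)
    rw [← minpoly.algebraMap_eq (algebraMap (fixedField (P : Subgroup Gal(M/K))) M).injective] at h
    exact hodd.of_dvd_nat h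
  have htop : (P : Subgroup Gal(M/K)) = ⊤ := by
    rw [← fixingSubgroup_fixedField (P : Subgroup Gal(M/K)), hbot, fixingSubgroup_bot]
  obtain ⟨k, hk⟩ := IsPGroup.iff_card.1 P.isPGroup'
  refine ⟨k, ?_⟩
  rw [← hk]
  rw [htop, Subgroup.card_top]

theorem exists_eq_add_mul {M : Type*} [Field M] [Algebra K M] [FiniteDimensional K M]
    [IsGalois K M] {i : M} (hi : i * i = -1) (y : M) :
    ∃ a b : K, y = algebraMap K M a + algebraMap K M b * i := by
  have : CharZero M := charZero_of_injective_algebraMap (algebraMap K M).injective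
  have hF : ∀ x : K⟮i⟯, ∃ a b : K, (x : M) = algebraMap K M a + algebraMap K M b * i := by
    intro x
    have : (x : M) ∈ K⟮i⟯.toSubalgebra := x.2
    rw [adjoin_simple_toSubalgebra_of_isAlgebraic (Algebra.IsAlgebraic.isAlgebraic i),
      Algebra.adjoin_singleton_eq_range_aeval] at this
    obtain ⟨g, hg⟩ := this
    change aeval i g = x at hg
    obtain ⟨a, b, h⟩ := exists_aeval_eq_add_mul (x := (-1 : K)) (y := i) (by simp [hi]) g
    exact ⟨a, b, hg.symm.trans h⟩
  have hFsq : ∀ x : K⟮i⟯, ∃ r : K⟮i⟯, r * r = x := by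
    intro x
    obtain ⟨a, b, h⟩ := hF x
    obtain ⟨u, v, h1, h2⟩ := exists_re_im_sq a b
    refine ⟨algebraMap K _ u + algebraMap K _ v * AdjoinSimple.gen K i, Subtype.ext ?_⟩
    rw [h, ← h1, ← h2]
    have hc : ∀ t : K, ((algebraMap K K⟮i⟯ t : K⟮i⟯) : M) = algebraMap K M t := fun _ ↦ rfl
    simp only [MulMemClass.coe_mul, AddMemClass.coe_add, AdjoinSimple.coe_gen, hc, map_sub,
      map_mul, map_ofNat]
    linear_combination algebraMap K M v * algebraMap K M v * hi
  obtain ⟨k, hk⟩ := exists_card_galois_eq_two_pow (K := K) M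
  rw [IsGalois.card_aut_eq_finrank, ← finrank_mul_finrank K K⟮i⟯ M] at hk
  obtain ⟨m, -, hm⟩ := (Nat.dvd_prime_pow Nat.prime_two).1 (Dvd.intro_left _ hk)
  have hm0 : m = 0 := by
    by_contra hm0
    obtain ⟨m, rfl⟩ := Nat.exists_eq_succ_of_ne_zero hm0
    rw [← IsGalois.card_aut_eq_finrank] at hm
    obtain ⟨H, hH⟩ := Sylow.exists_subgroup_card_pow_prime (G := Gal(M/K⟮i⟯)) 2 (n := m)
      (by rw [hm]; exact pow_dvd_pow _ (by omega))
    have h2 : finrank K⟮i⟯ (fixedField H) = 2 := by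
      have h3 := finrank_mul_finrank K⟮i⟯ (fixedField H) M
      rw [finrank_fixedField_eq_card, ← IsGalois.card_aut_eq_finrank K⟮i⟯ M, hH, hm,
        pow_succ'] at h3
      exact Nat.eq_of_mul_eq_mul_right (by positivity) h3
    have hbot : fixedField H = ⊥ := by
      refine eq_bot_iff.2 fun z hz ↦ ?_
      have h := minpoly.degree_dvd (K := K⟮i⟯) (x := (⟨z, hz⟩ : fixedField H)) (.of_finite _ _)
      rw [← minpoly.algebraMap_eq (algebraMap (fixedField H) M).injective, h2] at h
      change (minpoly K⟮i⟯ z).natDegree ∣ 2 at h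
      have h_int : IsIntegral K⟮i⟯ z := .of_finite _ _
      rcases (Nat.dvd_prime Nat.prime_two).1 h with h1 | h2
      · refine IntermediateField.mem_bot.2 (minpoly.mem_range_of_degree_eq_one _ z ?_)
        rw [degree_eq_natDegree (minpoly.ne_zero h_int), h1]; rfl
      · have hz := minpoly.aeval K⟮i⟯ z
        rw [(minpoly.monic h_int).as_sum, h2] at hz
        simp [Finset.sum_range_succ] at hz
        obtain ⟨r, hr⟩ := hFsq (((minpoly K⟮i⟯ z).coeff 1 / 2) ^ 2 - (minpoly K⟮i⟯ z).coeff 0)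
        generalize (minpoly K⟮i⟯ z).coeff 0 = q at hz hr
        generalize (minpoly K⟮i⟯ z).coeff 1 = p at hz hr
        have hr' := congrArg (algebraMap K⟮i⟯ M) hr
        simp only [map_sub, map_mul, map_pow, map_div₀, map_ofNat] at hr'
        have : (z + algebraMap K⟮i⟯ M p / 2 - algebraMap K⟮i⟯ M r) *
            (z + algebraMap K⟮i⟯ M p / 2 + algebraMap K⟮i⟯ M r) = 0 := by
          simp only [IntermediateField.algebraMap_apply] at *
          linear_combination hz - hr'
        rcases mul_eq_zero.1 this with h | h
        · exact IntermediateField.mem_bot.2 ⟨r - p / 2, by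
            simp only [map_sub, map_div₀, map_ofNat]; linear_combination -h⟩
        · exact IntermediateField.mem_bot.2 ⟨- r - p / 2, by
            simp only [map_sub, map_neg, map_div₀, map_ofNat]; linear_combination -h⟩
    rw [finrank_eq_one_iff.2 hbot] at h2
    omega
  subst hm0
  obtain ⟨x, rfl⟩ : ∃ x : K⟮i⟯, algebraMap K⟮i⟯ M x = y := by
    have h : K⟮i⟯ = ⊤ := IntermediateField.finrank_eq_one_iff_eq_top.1 hm
    exact ⟨⟨y, h ▸ trivial⟩, rfl⟩
  exact hF x

/-- A real closed field has no proper semireal algebraic extension. -/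
theorem algebraMap_surjective_of_isSemireal {L : Type*} [Field L] [Algebra K L] [IsSemireal L]
    [Algebra.IsIntegral K L] : Function.Surjective (algebraMap K L) := by
  intro x
  have hx := Algebra.IsIntegral.isIntegral (R := K) x
  let p : K[X] := minpoly K x * (X ^ 2 + 1)
  let M := p.SplittingField
  have hq : (X ^ 2 + 1 : K[X]) ≠ 0 := by
    have := (monic_X_pow_add_C (1 : K) two_ne_zero).ne_zero
    simpa using this
  have hp : p ≠ 0 := mul_ne_zero (minpoly.ne_zero hx) hq
  have hs : (p.map (algebraMap K M)).Splits := SplittingField.splits p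
  have : IsGalois K M := { __ := Normal.of_isSplittingField (E := M) p }
  have root : ∀ q : K[X], q ∣ p → q.degree ≠ 0 → ∃ y : M, aeval y q = 0 := by
    intro q hqp hq0
    have := (hs.of_dvd (by simpa using hp)
      (Polynomial.map_dvd (algebraMap K M) hqp)).exists_eval_eq_zero (by simpa using hq0)
    simpa [aeval_def, eval_map] using this
  obtain ⟨y, hy⟩ := root (minpoly K x) (dvd_mul_right _ _) (minpoly.degree_pos hx).ne'
  obtain ⟨i, hi⟩ := root (X ^ 2 + 1) (dvd_mul_left _ _) (by
    rw [← C_1, degree_X_pow_add_C (by simp)]; simp)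
  simp only [map_add, map_pow, aeval_X, map_one] at hi
  obtain ⟨a, b, h⟩ := exists_eq_add_mul (K := K) (i := i) (by linear_combination hi) y
  have hmin : minpoly K x = minpoly K y :=
    minpoly.eq_of_irreducible_of_monic (minpoly.irreducible hx) hy (minpoly.monic hx)
  have hdvd : minpoly K x ∣ (X - C a) ^ 2 + C b ^ 2 := by
    rw [hmin]
    refine minpoly.dvd K y ?_
    simp only [map_add, map_pow, map_sub, aeval_X, aeval_C, h]
    linear_combination algebraMap K M b ^ 2 * hi
  have hz := aeval_eq_zero_of_dvd_aeval_eq_zero hdvd (minpoly.aeval K x)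
  simp only [map_add, map_pow, map_sub, aeval_X, aeval_C] at hz
  have := IsSemireal.eq_zero_of_add (IsSquare.isSumSq (IsSquare.sq (x - algebraMap K L a)))
    (IsSquare.isSumSq (IsSquare.sq (algebraMap K L b))) hz
  exact ⟨a, by rw [eq_comm, ← sub_eq_zero]; simpa using this⟩

end IsRealClosed

theorem IsSumSq.exists_fin_sum {A : Type*} [CommRing A] {s : A} (hs : IsSumSq s) :
    ∃ (n : ℕ) (f : Fin n → A), s = ∑ i, f i ^ 2 := by
  induction hs with
  | zero => exact ⟨0, Fin.elim0, by simp⟩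
  | sq_add a _ ih =>
    obtain ⟨n, f, rfl⟩ := ih
    exact ⟨n + 1, Fin.cons a f, by simp [Fin.sum_univ_succ, pow_two]⟩

namespace IsRealRing

theorem isSemireal {A : Type*} [CommRing A] [Nontrivial A] (h : IsRealRing A) : IsSemireal A where
  one_add_ne_zero hs h0 := by
    obtain ⟨n, f, hf⟩ := (IsSumSq.one.add hs).exists_fin_sum
    obtain ⟨m, g, rfl⟩ := hs.exists_fin_sum
    have := h (m + 1) (Fin.cons 1 g) (by simpa [Fin.sum_univ_succ] using h0) 0
    simp at this

theorem isReduced {A : Type*} [CommRing A] (h : IsRealRing A) : IsReduced A := by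
  rw [isReduced_iff_pow_one_lt 2 (by lia)]
  intro x hx
  exact h 1 (fun _ ↦ x) (by simpa using hx) 0

theorem of_isSemireal (F : Type*) [Field F] [IsSemireal F] : IsRealRing F := by
  intro n f h i
  rw [← Finset.add_sum_erase _ _ (Finset.mem_univ i)] at h
  exact pow_eq_zero_iff (two_ne_zero) |>.1 (IsSemireal.eq_zero_of_add
    (IsSquare.sq (f i)).isSumSq (IsSumSq.sum_sq _ _) h)

theorem of_injective_s5 {A B : Type*} [CommRing A] [CommRing B] (hB : IsRealRing B) (f : A →+* B)
    (hf : Function.Injective f) : IsRealRing A := fun n g h i ↦ hf (by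
  rw [map_zero]
  exact hB n (f ∘ g) (by simpa using congrArg f h) i)

theorem pi {ι : Type*} {R : ι → Type*} [∀ i, CommRing (R i)] (h : ∀ i, IsRealRing (R i)) :
    IsRealRing (∀ i, R i) := fun n g hg i ↦ funext fun j ↦
  h j n (fun k ↦ g k j) (by simpa using congrFun hg j) i

theorem prod {A B : Type*} [CommRing A] [CommRing B] (hA : IsRealRing A) (hB : IsRealRing B) :
    IsRealRing (A × B) := fun n g hg i ↦ Prod.ext
  (hA n (fun k ↦ (g k).1) (by simpa [Prod.fst_sum] using congrArg Prod.fst hg) i)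
  (hB n (fun k ↦ (g k).2) (by simpa [Prod.snd_sum] using congrArg Prod.snd hg) i)

end IsRealRing

namespace IsVonNeumannRegular

variable {A : Type*} [CommRing A]

theorem exists_idempotent (h : IsVonNeumannRegular A) (a : A) :
    ∃ e b : A, e * e = e ∧ e = a * b ∧ e * a = a := by
  obtain ⟨b, hb⟩ := h a
  exact ⟨a * b, b, by linear_combination -b * hb, rfl, by linear_combination -hb⟩

theorem exists_idempotent_notMem (h : IsVonNeumannRegular A) {P : Ideal A} (hP : P ≠ ⊤) {a : A}
    (ha : a ∈ P) : ∃ e : A, e * e = e ∧ e ∉ P ∧ e * a = 0 := by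
  obtain ⟨e, b, h1, h2, h3⟩ := h.exists_idempotent a
  refine ⟨1 - e, by linear_combination h1, fun h4 ↦ hP ?_, by linear_combination -h3⟩
  rw [Ideal.eq_top_iff_one]
  simpa using P.add_mem h4 (h2 ▸ P.mul_mem_right b ha : e ∈ P)

theorem isMaximal (h : IsVonNeumannRegular A) (P : Ideal A) [hP : P.IsPrime] : P.IsMaximal := by
  refine Ideal.isMaximal_iff.2 ⟨(Ideal.ne_top_iff_one P).1 hP.ne_top, fun J x hPJ hx hxJ ↦ ?_⟩
  obtain ⟨e, b, h1, h2, h3⟩ := h.exists_idempotent x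
  have : (1 - e) * x ∈ P := by
    rw [show (1 - e) * x = 0 by linear_combination -h3]; exact P.zero_mem
  have h4 := hPJ ((hP.mem_or_mem this).resolve_right hx)
  simpa using J.add_mem h4 (h2 ▸ J.mul_mem_right b hxJ : e ∈ J)

theorem quotient_isRealRing (h : IsVonNeumannRegular A) (hr : IsRealRing A) (J : Ideal A) :
    IsRealRing (A ⧸ J) := by
  intro n f hf i
  choose g hg using fun i ↦ Ideal.Quotient.mk_surjective (f i)
  have hs : ∑ i, g i ^ 2 ∈ J := by
    rw [← Ideal.Quotient.eq_zero_iff_mem]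
    simpa [hg] using hf
  obtain ⟨e, b, h1, h2, h3⟩ := h.exists_idempotent (∑ i, g i ^ 2)
  have he : e ∈ J := h2 ▸ J.mul_mem_right b hs
  have h4 := hr n (fun i ↦ (1 - e) * g i) (by
    simp only [mul_pow, ← Finset.mul_sum]
    linear_combination (∑ i, g i ^ 2) * h1 - h3) i
  rw [← hg i, Ideal.Quotient.eq_zero_iff_mem, show g i = e * g i by linear_combination h4]
  exact J.mul_mem_right _ he

theorem of_isMaximal_of_isPrime [IsReduced A] (h : ∀ P : Ideal A, P.IsPrime → P.IsMaximal) :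
    IsVonNeumannRegular A := by
  intro a
  let I : Ideal A := Submodule.comap (LinearMap.mulRight A a) (Ideal.span {a ^ 2})
  have hI : ∀ r, r ∈ I ↔ ∃ b, a ^ 2 * b = r * a := by
    intro r
    simp [I, Ideal.mem_span_singleton, dvd_iff_exists_eq_mul_right, eq_comm]
  suffices I = ⊤ by
    obtain ⟨b, hb⟩ := (hI 1).1 (this ▸ trivial)
    exact ⟨b, by rw [hb, one_mul]⟩
  by_contra hne
  obtain ⟨M, hM, hIM⟩ := Ideal.exists_le_maximal I hne
  have kill : ∀ x ∈ M, ∃ s ∉ M, s * x = 0 := by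
    intro x hx
    by_contra! hx0
    have hdisj : Disjoint ((⊥ : Ideal A) : Set A)
        ((M.primeCompl ⊔ Submonoid.powers x : Submonoid A) : Set A) := by
      rw [Set.disjoint_left]
      rintro y hy hy'
      obtain rfl : y = 0 := by simpa using hy
      obtain ⟨s, hs, z, ⟨n, rfl⟩, hsz⟩ := Submonoid.mem_sup.1 hy'
      refine hx0 s hs (eq_zero_of_pow_eq_zero (n := n + 1) ?_)
      have hsz' : s * x ^ n = 0 := hsz
      rw [mul_pow, pow_succ, pow_succ]
      linear_combination s ^ n * x * hsz'
    obtain ⟨P, hP, -, hPd⟩ := Ideal.exists_le_prime_disjoint _ _ hdisj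
    have hPM : P ≤ M := fun y hy ↦ by
      by_contra hyM
      exact Set.disjoint_left.1 hPd hy (Submonoid.mem_sup_left (show y ∈ M.primeCompl from hyM))
    have hPeq := (h P hP).eq_of_le hM.ne_top hPM
    exact Set.disjoint_left.1 hPd (hPeq ▸ hx)
      (Submonoid.mem_sup_right (Submonoid.mem_powers x))
  by_cases ha : a ∈ M
  · obtain ⟨s, hs, hs0⟩ := kill a ha
    exact hs (hIM ((hI s).2 ⟨0, by simp [hs0]⟩))
  · obtain ⟨y, hy⟩ := hM.exists_inv ha
    obtain ⟨i, hi, hyi⟩ := hy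
    obtain ⟨s, hs, hs0⟩ := kill _ hi
    exact hs (hIM ((hI s).2 ⟨s * y, by linear_combination s * a * hyi - a * hs0⟩))

theorem of_isIntegral (h : IsVonNeumannRegular A) {B : Type*} [CommRing B] [IsReduced B]
    (f : A →+* B) (hf : f.IsIntegral) : IsVonNeumannRegular B :=
  of_isMaximal_of_isPrime fun P _ ↦
    Ideal.isMaximal_of_isIntegral_of_isMaximal_comap' f hf P (h.isMaximal _)

theorem exists_ringHom_isRealClosed {A : Type u} [CommRing A] (h : IsVonNeumannRegular A)
    (hr : IsRealRing A) (P : Ideal A) [P.IsPrime] :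
    ∃ (R : Type u) (_ : Field R) (f : A →+* R), IsRealClosed R ∧ RingHom.ker f = P := by
  have := h.isMaximal P
  let := Ideal.Quotient.field P
  have : IsSemireal (A ⧸ P) := (h.quotient_isRealRing hr P).isSemireal
  obtain ⟨R, _, _, hR⟩ := exists_isRealClosed_algebra (A ⧸ P)
  refine ⟨R, inferInstance, (algebraMap (A ⧸ P) R).comp (Ideal.Quotient.mk P), hR, ?_⟩
  rw [RingHom.ker_comp_of_injective _ (algebraMap (A ⧸ P) R).injective, Ideal.mk_ker]

end IsVonNeumannRegular

/-- Ring-level version of the two axioms of real closed fields on existence of roots. -/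
structure HasRealClosedRoots (A : Type*) [CommRing A] : Prop where
  exists_mul_self_eq (x : A) : ∃ e y : A, e * e = e ∧ y * y = (2 * e - 1) * x
  exists_isRoot (f : A[X]) (hf : f.Monic) (hodd : Odd f.natDegree) : ∃ x, f.IsRoot x

theorem isIntegral_of_mul_self (A : Type*) {B : Type*} [CommRing A] [CommRing B] [Algebra A B]
    {e : B} (he : e * e = e) : IsIntegral A e := by
  rcases subsingleton_or_nontrivial A with _ | _
  · exact ⟨0, monic_of_subsingleton 0, eval₂_zero _ _⟩
  exact ⟨X ^ 2 - X, monic_X_pow_sub (by rw [degree_X]; norm_num), by simp [pow_two, he]⟩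

namespace HasRealClosedRoots

theorem of_surjective {A B : Type*} [CommRing A] [CommRing B] (h : HasRealClosedRoots A)
    (f : A →+* B) (hf : Function.Surjective f) : HasRealClosedRoots B where
  exists_mul_self_eq x := by
    obtain ⟨x, rfl⟩ := hf x
    obtain ⟨e, y, h1, h2⟩ := h.exists_mul_self_eq x
    exact ⟨f e, f y, by rw [← map_mul, h1], by simpa [map_ofNat] using congrArg f h2⟩
  exists_isRoot p hp hodd := by
    obtain ⟨q, hq, hdeg, hmon⟩ := lifts_and_natDegree_eq_and_monic
      ((mem_lifts p).2 (map_surjective f hf p)) hp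
    obtain ⟨x, hx⟩ := h.exists_isRoot q hmon (hdeg ▸ hodd)
    exact ⟨f x, hq ▸ hx.map⟩

theorem isRealClosed {K : Type*} [Field K] [IsSemireal K] (h : HasRealClosedRoots K) :
    IsRealClosed K where
  isSquare_or_isSquare_neg x := by
    obtain ⟨e, y, h1, h2⟩ := h.exists_mul_self_eq x
    rcases (mul_eq_zero.1 (show e * (e - 1) = 0 by linear_combination h1)) with h | h
    · exact .inr ⟨y, by rw [h2, h]; ring⟩
    · exact .inl ⟨y, by rw [h2, sub_eq_zero.1 h]; ring⟩
  exists_isRoot_of_odd_natDegree {f} hf := by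
    have hf0 : f ≠ 0 := by rintro rfl; simp at hf
    obtain ⟨x, hx⟩ := h.exists_isRoot _ (monic_mul_leadingCoeff_inv hf0)
      (by rwa [natDegree_mul_leadingCoeff_inv _ hf0])
    refine ⟨x, ?_⟩
    simpa [hf0] using hx

theorem pi {ι : Type*} {R : ι → Type*} [∀ i, Field (R i)] [∀ i, IsRealClosed (R i)] :
    HasRealClosedRoots (∀ i, R i) where
  exists_mul_self_eq x := by
    have (i : ι) : ∃ e y : R i, e * e = e ∧ y * y = (2 * e - 1) * x i := by
      rcases IsRealClosed.isSquare_or_isSquare_neg (x i) with ⟨y, hy⟩ | ⟨y, hy⟩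
      · exact ⟨1, y, by simp, by rw [← hy]; ring⟩
      · exact ⟨0, y, by simp, by rw [← hy]; ring⟩
    choose e y h1 h2 using this
    exact ⟨e, y, funext h1, funext h2⟩
  exists_isRoot f hf hodd := by
    have (i : ι) : ∃ x : R i, (f.map (Pi.evalRingHom R i)).IsRoot x :=
      IsRealClosed.exists_isRoot_of_odd_natDegree (by rwa [hf.natDegree_map])
    choose x hx using this
    refine ⟨x, funext fun i ↦ ?_⟩
    have := hx i
    rw [IsRoot, show x i = Pi.evalRingHom R i x from rfl, eval_map_apply] at this
    exact this

theorem integralClosure {A B : Type*} [CommRing A] [CommRing B] [Algebra A B]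
    (h : HasRealClosedRoots B) : HasRealClosedRoots (integralClosure A B) where
  exists_mul_self_eq x := by
    obtain ⟨e, y, h1, h2⟩ := h.exists_mul_self_eq x
    have he := isIntegral_of_mul_self A h1
    have hy : IsIntegral A y := by
      refine IsIntegral.of_pow (n := 2) two_pos ?_
      rw [pow_two, h2, two_mul]
      exact ((he.add he).sub isIntegral_one).mul x.2
    exact ⟨⟨e, he⟩, ⟨y, hy⟩, Subtype.ext h1, Subtype.ext h2⟩
  exists_isRoot f hf hodd := by
    rcases subsingleton_or_nontrivial B with hB | hB
    · exact ⟨0, Subsingleton.elim _ _⟩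
    obtain ⟨x, hx⟩ := h.exists_isRoot (f.map (algebraMap _ B)) (hf.map _)
      (by rwa [hf.natDegree_map])
    have h_int : IsIntegral (_root_.integralClosure A B) x :=
      ⟨f, hf, by rwa [IsRoot, eval_map] at hx⟩
    refine ⟨⟨x, isIntegral_trans x h_int⟩, Subtype.ext ?_⟩
    have h2 := eval_map_apply (p := f) (f := algebraMap (_root_.integralClosure A B) B)
      ⟨x, isIntegral_trans x h_int⟩
    exact h2.symm.trans hx

end HasRealClosedRoots

/-- Every extension becomes essential after passing to a suitable quotient. -/
theorem exists_isEssentialExtension_quotient {B C : Type*} [CommRing B] [CommRing C]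
    {f : B →+* C} (hf : Function.Injective f) :
    ∃ J : Ideal C, IsEssentialExtension ((Ideal.Quotient.mk J).comp f) := by
  obtain ⟨J, hJ⟩ : ∃ J : Ideal C, Maximal (fun J ↦ Ideal.comap f J = ⊥) J := by
    refine zorn_le₀ {J : Ideal C | J.comap f = ⊥} fun c hc hchain ↦ ?_
    rcases c.eq_empty_or_nonempty with rfl | hne
    · exact ⟨⊥, (RingHom.injective_iff_ker_eq_bot f).1 hf, by simp⟩
    · refine ⟨sSup c, eq_bot_iff.2 fun x hx ↦ ?_, fun z hz ↦ le_sSup hz⟩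
      obtain ⟨J, hJ, hxJ⟩ := (Submodule.mem_sSup_of_directed hne hchain.directedOn).1 hx
      exact (hc hJ).le hxJ
  have hinj : Function.Injective ((Ideal.Quotient.mk J).comp f) := by
    rw [RingHom.injective_iff_ker_eq_bot, ← RingHom.comap_ker, Ideal.mk_ker]
    exact hJ.1
  refine ⟨J, hinj, fun L hL ↦ ?_⟩
  by_contra! h
  have hle : J ≤ L.comap (Ideal.Quotient.mk J) := fun x hx ↦ by
    rw [Ideal.mem_comap, Ideal.Quotient.eq_zero_iff_mem.2 hx]; exact L.zero_mem
  have hge := hJ.2 (y := L.comap (Ideal.Quotient.mk J)) (eq_bot_iff.2 fun x hx ↦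
    hinj ((h x hx).trans (map_zero _).symm)) hle
  refine hL (eq_bot_iff.2 fun y hy ↦ ?_)
  obtain ⟨y, rfl⟩ := Ideal.Quotient.mk_surjective y
  exact Ideal.Quotient.eq_zero_iff_mem.2 (hge hy)

namespace IsRealClosedStar

theorem isBaerRing {B : Type u} [CommRing B] (hB : IsRealClosedStar B) : IsBaerRing B := by
  have := hB.1.isReduced
  intro S
  let ann : Set B → Ideal B := fun T ↦
    { carrier := {x | ∀ s ∈ T, x * s = 0}
      add_mem' := fun hx hy s hs ↦ by rw [add_mul, hx s hs, hy s hs, add_zero]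
      zero_mem' := fun s _ ↦ zero_mul s
      smul_mem' := fun c x hx s hs ↦ by rw [smul_eq_mul, mul_assoc, hx s hs, mul_zero] }
  have mem_ann : ∀ T x, x ∈ ann T ↔ ∀ s ∈ T, x * s = 0 := fun _ _ ↦ Iff.rfl
  have real_ann : ∀ T, IsRealRing (B ⧸ ann T) := by
    intro T n f hf i
    choose g hg using fun i ↦ Ideal.Quotient.mk_surjective (f i)
    have hs : ∑ i, g i ^ 2 ∈ ann T := by
      rw [← Ideal.Quotient.eq_zero_iff_mem]
      simpa [hg] using hf
    rw [← hg i, Ideal.Quotient.eq_zero_iff_mem, mem_ann]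
    intro t ht
    refine hB.1 n (fun i ↦ g i * t) ?_ i
    simp only [mul_pow, ← Finset.sum_mul]
    linear_combination t * (mem_ann _ _).1 hs t ht
  let I := ann S
  let J := ann I
  have hdisj : ∀ x ∈ I, x ∈ J → x = 0 := fun x hI hJ ↦
    eq_zero_of_pow_eq_zero (n := 2) (by rw [pow_two]; exact hJ x hI)
  have hSJ : ∀ s ∈ S, s ∈ J := fun s hs x hx ↦ by rw [mul_comm]; exact hx s hs
  let f : B →+* (B ⧸ I) × (B ⧸ J) := (Ideal.Quotient.mk I).prod (Ideal.Quotient.mk J)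
  have hinj : Function.Injective f := by
    refine (injective_iff_map_eq_zero f).2 fun x hx ↦ ?_
    rw [Prod.ext_iff] at hx
    exact hdisj x (Ideal.Quotient.eq_zero_iff_mem.1 hx.1) (Ideal.Quotient.eq_zero_iff_mem.1 hx.2)
  have hess : IsEssentialExtension f := by
    refine ⟨hinj, fun L hL ↦ ?_⟩
    obtain ⟨⟨x, y⟩, hxy, hne⟩ := Submodule.exists_mem_ne_zero_of_ne_bot hL
    obtain ⟨x, rfl⟩ := Ideal.Quotient.mk_surjective x
    obtain ⟨y, rfl⟩ := Ideal.Quotient.mk_surjective y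
    by_cases hx : x ∈ I
    · have hy : y ∉ J := fun hy ↦ hne (Prod.ext (Ideal.Quotient.eq_zero_iff_mem.2 hx)
        (Ideal.Quotient.eq_zero_iff_mem.2 hy))
      obtain ⟨i, hi, hyi⟩ : ∃ i ∈ I, y * i ≠ 0 := by
        by_contra! h; exact hy h
      have hfe : f (y * i) = (0, 1) * (f i * (Ideal.Quotient.mk I x, Ideal.Quotient.mk J y)) := by
        refine Prod.ext ?_ ?_
        · change Ideal.Quotient.mk I (y * i) = 0 * _
          rw [zero_mul, Ideal.Quotient.eq_zero_iff_mem]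
          exact I.mul_mem_left y hi
        · change Ideal.Quotient.mk J (y * i) = 1 * (Ideal.Quotient.mk J i * Ideal.Quotient.mk J y)
          rw [one_mul, map_mul, mul_comm]
      refine ⟨y * i, ?_, fun h ↦ hyi (hinj (h.trans (map_zero f).symm))⟩
      rw [hfe]
      exact L.mul_mem_left _ (L.mul_mem_left _ hxy)
    · obtain ⟨s, hs, hxs⟩ : ∃ s ∈ S, x * s ≠ 0 := by
        by_contra! h; exact hx h
      have hfe : f (x * s) = (1, 0) * (f s * (Ideal.Quotient.mk I x, Ideal.Quotient.mk J y)) := by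
        refine Prod.ext ?_ ?_
        · change Ideal.Quotient.mk I (x * s) = 1 * (Ideal.Quotient.mk I s * Ideal.Quotient.mk I x)
          rw [one_mul, map_mul, mul_comm]
        · change Ideal.Quotient.mk J (x * s) = 0 * _
          rw [zero_mul, Ideal.Quotient.eq_zero_iff_mem]
          exact J.mul_mem_left x (hSJ s hs)
      refine ⟨x * s, ?_, fun h ↦ hxs (hinj (h.trans (map_zero f).symm))⟩
      rw [hfe]
      exact L.mul_mem_left _ (L.mul_mem_left _ hxy)
  have h_int : f.IsIntegral := by
    let := f.toAlgebra
    have hI : ∀ x, ∃ b, f b * (1, 0) = (x, 0) := fun x ↦ by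
      obtain ⟨b, rfl⟩ := Ideal.Quotient.mk_surjective x
      exact ⟨b, Prod.ext (mul_one _) (mul_zero _)⟩
    have hJ : ∀ y, ∃ b, f b * (0, 1) = (0, y) := fun y ↦ by
      obtain ⟨b, rfl⟩ := Ideal.Quotient.mk_surjective y
      exact ⟨b, Prod.ext (mul_zero _) (mul_one _)⟩
    rintro ⟨x, y⟩
    obtain ⟨a, ha⟩ := hI x
    obtain ⟨b, hb⟩ := hJ y
    have hxy : (x, y) = f a * (1, 0) + f b * (0, 1) := by rw [ha, hb]; simp
    rw [hxy]
    change IsIntegral B (algebraMap B _ a * (1, 0) + algebraMap B _ b * (0, 1))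
    exact (isIntegral_algebraMap.mul (isIntegral_of_mul_self B (by simp))).add
      (isIntegral_algebraMap.mul (isIntegral_of_mul_self B (by simp)))
  obtain ⟨e, he⟩ := hB.2 _ f ((real_ann S).prod (real_ann I)) hess h_int (0, 1)
  have heI : e ∈ I := Ideal.Quotient.eq_zero_iff_mem.1 (congrArg Prod.fst he)
  have heJ : e - 1 ∈ J := by
    rw [← Ideal.Quotient.eq_zero_iff_mem, map_sub, map_one, sub_eq_zero]
    exact congrArg Prod.snd he
  have key : ∀ x ∈ I, x = e * x := fun x hx ↦ by linear_combination - heJ x hx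
  refine ⟨e, (key e heI).symm, fun x ↦ ⟨fun hx ↦ ⟨x, key x hx⟩, ?_⟩⟩
  rintro ⟨y, rfl⟩
  exact I.mul_mem_right y heI

theorem hasRealClosedRoots_of_isIntegral {B C : Type u} [CommRing B] [CommRing C]
    (hB : IsRealClosedStar B) (hC : IsRealRing C) (hCv : IsVonNeumannRegular C)
    (hroots : HasRealClosedRoots C) {f : B →+* C} (hf : Function.Injective f)
    (h_int : f.IsIntegral) : HasRealClosedRoots B := by
  obtain ⟨J, hess⟩ := exists_isEssentialExtension_quotient hf
  have hsurj := hB.2 _ _ (hCv.quotient_isRealRing hC J) hess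
    (h_int.trans _ _ (RingHom.isIntegral_of_surjective _ Ideal.Quotient.mk_surjective))
  let e := RingEquiv.ofBijective _ ⟨hess.1, hsurj⟩
  exact (hroots.of_surjective _ Ideal.Quotient.mk_surjective).of_surjective
    (e.symm : C ⧸ J →+* B) e.symm.surjective

theorem hasRealClosedRoots {B : Type u} [CommRing B] (hB : IsRealClosedStar B)
    (hvnr : IsVonNeumannRegular B) : HasRealClosedRoots B := by
  have := hB.1.isReduced
  have hR := fun q : PrimeSpectrum B ↦ hvnr.exists_ringHom_isRealClosed hB.1 q.asIdeal
  choose R iR g hRC hker using hR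
  have realR : IsRealRing (∀ q, R q) := .pi fun q ↦ .of_isSemireal (R q)
  let φ : B →+* ∀ q, R q := RingHom.pi g
  have hφ : Function.Injective φ := by
    refine (injective_iff_map_eq_zero φ).2 fun x hx ↦ ?_
    suffices h : x ∈ nilradical B from (mem_nilradical.1 h).eq_zero
    rw [nilradical_eq_sInf, Submodule.mem_sInf]
    intro P hP
    have := congrFun hx ⟨P, hP⟩
    have h2 : x ∈ RingHom.ker (g ⟨P, hP⟩) := this
    rwa [hker] at h2
  let := φ.toAlgebra
  let C := integralClosure B (∀ q, R q)
  have realC : IsRealRing C := realR.of_injective_s5 (C.val : C →+* _) Subtype.val_injective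
  have := realC.isReduced
  have intC : (algebraMap B C).IsIntegral := algebraMap_isIntegral_iff.2 inferInstance
  have vnrC : IsVonNeumannRegular C := hvnr.of_isIntegral (algebraMap B C) intC
  have rootsC : HasRealClosedRoots C := HasRealClosedRoots.pi.integralClosure
  exact hB.hasRealClosedRoots_of_isIntegral realC vnrC rootsC
    (fun x y hxy ↦ hφ (congrArg Subtype.val hxy)) intC

end IsRealClosedStar

theorem IsBaerRing.integralClosure {A B : Type*} [CommRing A] [CommRing B] [Algebra A B]
    (h : IsBaerRing B) : IsBaerRing (integralClosure A B) := by
  intro S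
  obtain ⟨e, he, hS⟩ := h (Subtype.val '' S)
  refine ⟨⟨e, isIntegral_of_mul_self A he⟩, Subtype.ext he, fun x ↦ ?_⟩
  have hx : (∀ s ∈ S, x * s = 0) ↔ ∀ s ∈ Subtype.val '' S, (x : B) * s = 0 := by
    simp [Subtype.ext_iff]
  rw [hx, hS]
  refine ⟨fun ⟨y, hy⟩ ↦ ⟨x, Subtype.ext ?_⟩, fun ⟨y, hy⟩ ↦ ⟨y, congrArg Subtype.val hy⟩⟩
  change (x : B) = e * x
  rw [hy, ← mul_assoc, he]

theorem IsBaerRing.exists_eq_of_mul_self {D C : Type*} [CommRing D] [CommRing C]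
    (h : IsBaerRing D) {f : D →+* C} (hf : IsEssentialExtension f) {e : C} (he : e * e = e) :
    ∃ d : D, f d = e := by
  obtain ⟨a, ha, hS⟩ := h {d | f d * e = f d}
  have h1 : f a * e = 0 := by
    by_contra hne
    obtain ⟨d, hd, hd0⟩ := hf.2 (Ideal.span {f a * e}) (by simpa using hne)
    obtain ⟨c, hc⟩ := Ideal.mem_span_singleton.1 hd
    have hdS : f d * e = f d := by rw [hc]; linear_combination f a * c * he
    have had : a * d = 0 := (hS a).2 ⟨1, (mul_one a).symm⟩ d hdS
    have ha' : f a * f a = f a := by rw [← map_mul, ha]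
    have had' : f a * f d = 0 := by rw [← map_mul, had, map_zero]
    exact hd0 (by linear_combination had' - (f a - 1) * hc - e * c * ha')
  have h2 : (1 - e) * f (1 - a) = 0 := by
    by_contra hne
    obtain ⟨d, hd, hd0⟩ := hf.2 (Ideal.span {(1 - e) * f (1 - a)}) (by simpa using hne)
    obtain ⟨c, hc⟩ := Ideal.mem_span_singleton.1 hd
    have hde : f d * e = 0 := by rw [hc]; linear_combination - f (1 - a) * c * he
    obtain ⟨y, hy⟩ := (hS d).1 fun s hs ↦ hf.1 (by
      have hs' : f s * e = f s := hs
      rw [map_mul, map_zero]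
      linear_combination f s * hde - f d * hs')
    have had : (1 - a) * d = 0 := by rw [hy]; linear_combination - y * ha
    have had' : f (1 - a) * f d = 0 := by rw [← map_mul, had, map_zero]
    have ha' : f (1 - a) * f (1 - a) = f (1 - a) := by
      rw [← map_mul]; congr 1; linear_combination ha
    exact hd0 (by linear_combination had' - (f (1 - a) - 1) * hc - (1 - e) * c * ha')
  refine ⟨1 - a, ?_⟩
  rw [map_sub, map_one] at h2 ⊢
  linear_combination h2 - h1

theorem HasRealClosedRoots.surjective_of_isEssentialExtension {D C : Type*} [CommRing D]
    [CommRing C] (hD : HasRealClosedRoots D) (hDB : IsBaerRing D) (hDv : IsVonNeumannRegular D)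
    {f : D →+* C} (hC : IsRealRing C) (hess : IsEssentialExtension f) (h_int : f.IsIntegral) :
    Function.Surjective f := by
  have := hC.isReduced
  have hCv : IsVonNeumannRegular C := hDv.of_isIntegral f h_int
  intro c
  let I : Ideal D :=
    { carrier := {d | ∃ d', f d * c = f d'}
      add_mem' := by
        rintro a b ⟨a', ha⟩ ⟨b', hb⟩
        exact ⟨a' + b', by rw [map_add, map_add, add_mul, ha, hb]⟩
      zero_mem' := ⟨0, by simp⟩
      smul_mem' := by
        rintro r a ⟨a', ha⟩
        exact ⟨r * a', by rw [smul_eq_mul, map_mul, map_mul, mul_assoc, ha]⟩ }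
  suffices h : (1 : D) ∈ I by
    obtain ⟨d, hd⟩ := h
    exact ⟨d, by rw [← hd, map_one, one_mul]⟩
  by_contra hI
  obtain ⟨m, hm, hIm⟩ := Ideal.exists_le_maximal I ((Ideal.ne_top_iff_one I).2 hI)
  have hcomap : ∃ P : Ideal C, P.IsMaximal ∧ P.comap f = m := by
    let := f.toAlgebra
    have : Algebra.IsIntegral D C := algebraMap_isIntegral_iff.1 h_int
    refine Ideal.exists_ideal_over_maximal_of_isIntegral m ?_
    change RingHom.ker f ≤ m
    rw [(RingHom.injective_iff_ker_eq_bot f).1 hess.1]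
    exact bot_le
  obtain ⟨P, hP, hPm⟩ := hcomap
  let := Ideal.Quotient.field m
  let := Ideal.Quotient.field P
  have : IsSemireal (C ⧸ P) := (hCv.quotient_isRealRing hC P).isSemireal
  let q : D ⧸ m →+* C ⧸ P := Ideal.quotientMap P f hPm.ge
  have : IsSemireal (D ⧸ m) :=
    ((IsRealRing.of_isSemireal (C ⧸ P)).of_injective_s5 q q.injective).isSemireal
  have : IsRealClosed (D ⧸ m) := (hD.of_surjective _ Ideal.Quotient.mk_surjective).isRealClosed
  have hq : q.IsIntegral := RingHom.IsIntegral.tower_top (Ideal.Quotient.mk m) q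
    (h_int.trans _ _
      (RingHom.isIntegral_of_surjective _ (Ideal.Quotient.mk_surjective (I := P))))
  have hqs : Function.Surjective q := by
    let := q.toAlgebra
    have : Algebra.IsIntegral (D ⧸ m) (C ⧸ P) := algebraMap_isIntegral_iff.1 hq
    exact IsRealClosed.algebraMap_surjective_of_isSemireal
  obtain ⟨d, hd⟩ := hqs (Ideal.Quotient.mk P c)
  obtain ⟨d, rfl⟩ := Ideal.Quotient.mk_surjective d
  have hcd : c - f d ∈ P := by
    rw [← Ideal.Quotient.eq, ← hd, Ideal.quotientMap_mk]
  obtain ⟨e, he, heP, hec⟩ := hCv.exists_idempotent_notMem hP.ne_top hcd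
  obtain ⟨e, rfl⟩ := hDB.exists_eq_of_mul_self hess he
  refine heP (Ideal.mem_comap.1 (hPm.ge (hIm ⟨e * d, ?_⟩)))
  rw [map_mul]
  linear_combination hec

end RealClosure

/-- Let `(A, P)` be a real von Neumann regular poring and `(B, Q)` an
essential extension of `A` (as porings) which is a von Neumann regular real closed *
ring.  Then the integral closure of `A` in `B`, with the partial ordering induced from
`Q`, is a real closure * of `A`. -/
theorem integralClosure_isRealClosureStarOf
    (A : Type u) [CommRing A] (B : Type u) [CommRing B] [Algebra A B]
    (P : Set A) (Q : Set B) (hP : IsPartialOrdering P) (hQ : IsPartialOrdering Q)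
    (hAreal : IsRealRing A) (hAvnr : IsVonNeumannRegular A)
    (hBvnr : IsVonNeumannRegular B) (hBrcs : IsRealClosedStar B)
    (hess : IsEssentialExtension (algebraMap A B))
    (hord : ∀ a ∈ P, algebraMap A B a ∈ Q) :
    IsRealClosureStarOf A P (integralClosure A B)
      {x : integralClosure A B | (x : B) ∈ Q}
      (algebraMap A (integralClosure A B)) := by
  have hDreal : IsRealRing (integralClosure A B) :=
    hBrcs.1.of_injective_s5 (integralClosure A B).val.toRingHom Subtype.val_injective
  have := hDreal.isReduced
  have h_int : (algebraMap A (integralClosure A B)).IsIntegral :=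
    algebraMap_isIntegral_iff.2 inferInstance
  have hDvnr : IsVonNeumannRegular (integralClosure A B) := hAvnr.of_isIntegral _ h_int
  have hinj : Function.Injective (algebraMap A (integralClosure A B)) := fun x y h ↦
    hess.1 (congrArg Subtype.val h)
  refine
    { pos_partial := ⟨fun a ha b hb ↦ hQ.1 a ha b hb, fun a ha b hb ↦ hQ.2.1 a ha b hb,
        fun a ↦ hQ.2.2.1 a, fun a ha hna ↦ Subtype.ext (hQ.2.2.2 a ha hna)⟩
      rcs := ⟨hDreal, fun C _ f hC hfess hfint ↦
        (hBrcs.hasRealClosedRoots hBvnr).integralClosure.surjective_of_isEssentialExtension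
          hBrcs.isBaerRing.integralClosure hDvnr hC hfess hfint⟩
      essential := ⟨hinj, fun J hJ ↦ ?_⟩
      integral := h_int
      mono := hord }
  obtain ⟨x, hxJ, hx⟩ := Submodule.exists_mem_ne_zero_of_ne_bot hJ
  obtain ⟨e, b, he, heb, hex⟩ := hDvnr.exists_idempotent x
  have he0 : (e : B) ≠ 0 := fun h ↦ hx (by
    rw [← hex, show e = 0 from Subtype.ext h, zero_mul])
  obtain ⟨a, ha, ha0⟩ := hess.2 (Ideal.span {(e : B)}) (by simpa using he0)
  obtain ⟨c, hc⟩ := Ideal.mem_span_singleton.1 ha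
  refine ⟨a, ?_, fun h ↦ ha0 (congrArg Subtype.val h)⟩
  have hea : algebraMap A (integralClosure A B) a = x * (b * algebraMap A _ a) := by
    rw [← mul_assoc, ← heb]
    refine Subtype.ext ?_
    have he' : (e : B) * e = e := congrArg Subtype.val he
    change algebraMap A B a = e * algebraMap A B a
    rw [hc, ← mul_assoc, he']
  rw [hea]
  exact J.mul_mem_right _ hxJ
end
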